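/- Let g ∈ ℝ[x] be a polynomial with deg g ≥ 2, and let ε > 0. There exists a constant C > 0, depending only on deg g and ε, such that for all finite sets A, B ⊆ ℝ with |A| = |B|, one has |g(A) + B| ≥ C · min{ |A|^{32/13 − ε} / |A + A|^{12/13}, |A|^{3 − ε} / |A + A|^{4/3} }. -/

import Mathlib

/-! ### Part 1: a weak crossing lemma -/

/-- Davenport-Schinzel type counting. -/
lemma ds_count {E α : Type*} [DecidableEq E] [DecidableEq α] (F : Finset E) (V : Finset α)
    (ht : E → ℝ) (hinj : ∀ e ∈ F, ∀ e' ∈ F, ht e = ht e' → e = e')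
    (L R : E → α) (hL : ∀ e ∈ F, L e ∈ V) (hR : ∀ e ∈ F, R e ∈ V)
    (hLR : ∀ e ∈ F, ∀ e' ∈ F, L e = L e' → R e = R e' → e = e')
    (hpL : ∀ e1 ∈ F, ∀ e2 ∈ F, ∀ e3 ∈ F, ∀ e4 ∈ F, ht e1 < ht e2 → ht e2 < ht e3 → ht e3 < ht e4 →
      L e1 = L e3 → L e2 = L e4 → L e1 = L e2)
    (hpR : ∀ e1 ∈ F, ∀ e2 ∈ F, ∀ e3 ∈ F, ∀ e4 ∈ F, ht e1 < ht e2 → ht e2 < ht e3 → ht e3 < ht e4 →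
      R e1 = R e3 → R e2 = R e4 → R e1 = R e2) :
    F.card ≤ 4 * V.card + 1 := by
  classical
  -- successor
  have hs : ∀ e ∈ F, (∃ e' ∈ F, ht e < ht e') → ∃ e' ∈ F, ht e < ht e' ∧
      ∀ e'' ∈ F, ht e < ht e'' → ht e' ≤ ht e'' := by
    intro e he ⟨e', he', hlt⟩
    obtain ⟨m, hm, hmin⟩ := Finset.exists_min_image (F.filter (fun x => ht e < ht x)) ht
      ⟨e', by simp [he', hlt]⟩
    simp only [Finset.mem_filter] at hm hmin
    exact ⟨m, hm.1, hm.2, fun e'' h1 h2 => hmin e'' ⟨h1, h2⟩⟩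
  have hs' : ∀ e, ∃ e', e ∈ F → (∃ e' ∈ F, ht e < ht e') → e' ∈ F ∧ ht e < ht e' ∧
      ∀ e'' ∈ F, ht e < ht e'' → ht e' ≤ ht e'' := by
    intro e
    by_cases he : e ∈ F ∧ (∃ e' ∈ F, ht e < ht e')
    · obtain ⟨e', h⟩ := hs e he.1 he.2
      exact ⟨e', fun _ _ => h⟩
    · exact ⟨e, fun h1 h2 => absurd ⟨h1, h2⟩ he⟩
  choose sc hsc using hs'
  let top : (E → α) → Finset E := fun K => F.filter (fun e => ∀ e' ∈ F, K e' = K e → ht e' ≤ ht e)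
  let bot : (E → α) → Finset E := fun K => F.filter (fun e => (∃ e' ∈ F, ht e < ht e') ∧
    ∀ e' ∈ F, K e' = K (sc e) → ht (sc e) ≤ ht e')
  have htop : ∀ K : E → α, (∀ e ∈ F, K e ∈ V) → (top K).card ≤ V.card := by
    intro K hK
    refine Finset.card_le_card_of_injOn K (fun e he => hK e (Finset.mem_filter.1 he).1) ?_
    intro e he e' he' h
    simp only [top, Finset.coe_filter, Set.mem_setOf_eq] at he he'
    exact hinj e he.1 e' he'.1 (le_antisymm (he'.2 e he.1 h) (he.2 e' he'.1 h.symm))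
  have hbot : ∀ K : E → α, (∀ e ∈ F, K e ∈ V) → (bot K).card ≤ V.card := by
    intro K hK
    refine Finset.card_le_card_of_injOn (fun e => K (sc e)) (fun e he => ?_) ?_
    · simp only [bot, Finset.coe_filter, Set.mem_setOf_eq] at he
      exact hK _ (hsc e he.1 he.2.1).1
    intro e he e' he' h
    simp only [bot, Finset.coe_filter, Set.mem_setOf_eq] at he he'
    have h1 := hsc e he.1 he.2.1
    have h2 := hsc e' he'.1 he'.2.1
    have hse : ht (sc e) = ht (sc e') :=
      le_antisymm (he.2.2 _ h2.1 h.symm) (he'.2.2 _ h1.1 h)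
    apply hinj e he.1 e' he'.1
    by_contra hne
    rcases lt_or_gt_of_ne hne with hlt | hlt
    · have := h1.2.2 e' he'.1 hlt
      linarith [h2.2.1]
    · have := h2.2.2 e he.1 hlt
      linarith [h1.2.1]
  let mx : Finset E := F.filter (fun e => ¬ ∃ e' ∈ F, ht e < ht e')
  have hmx : mx.card ≤ 1 := by
    rw [Finset.card_le_one]
    intro a ha b hb
    simp only [mx, Finset.mem_filter, not_exists, not_and, not_lt] at ha hb
    exact hinj a ha.1 b hb.1 (le_antisymm (hb.2 a ha.1) (ha.2 b hb.1))
  have key : ∀ K : E → α, (∀ e1 ∈ F, ∀ e2 ∈ F, ∀ e3 ∈ F, ∀ e4 ∈ F, ht e1 < ht e2 → ht e2 < ht e3 →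
      ht e3 < ht e4 → K e1 = K e3 → K e2 = K e4 → K e1 = K e2) → ∀ e ∈ F, (∃ e' ∈ F, ht e < ht e') →
      K e ≠ K (sc e) → e ∈ top K ∪ bot K := by
    intro K hp e he hex hne
    have h1 := hsc e he hex
    by_contra hcon
    simp only [top, bot, Finset.mem_union, Finset.mem_filter, not_or, not_and, not_forall] at hcon
    obtain ⟨e4, he4, hK4, hlt4⟩ := hcon.1 he
    obtain ⟨e1, he1, hK1, hlt1⟩ := hcon.2 he hex
    push Not at hlt4 hlt1
    have a1 : ht e1 < ht e := by
      by_contra hc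
      push Not at hc
      rcases hc.lt_or_eq with hc | hc
      · linarith [h1.2.2 e1 he1 hc]
      · have := hinj e he e1 he1 hc
        subst this
        exact hne hK1
    have a2 : ht (sc e) < ht e4 := by
      rcases (h1.2.2 e4 he4 hlt4).lt_or_eq with hc | hc
      · exact hc
      · have := hinj _ h1.1 e4 he4 hc
        rw [← this] at hK4
        exact absurd hK4.symm hne
    have := hp e1 he1 e he (sc e) h1.1 e4 he4 a1 h1.2.1 a2 hK1 hK4.symm
    exact hne (this.symm.trans hK1)
  have hsub : F ⊆ (top L ∪ bot L) ∪ (top R ∪ bot R) ∪ mx := by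
    intro e he
    by_cases hex : ∃ e' ∈ F, ht e < ht e'
    · have h1 := hsc e he hex
      by_cases hl : L e = L (sc e)
      · by_cases hr : R e = R (sc e)
        · have := hLR e he _ h1.1 hl hr
          have h2 := h1.2.1
          rw [← this] at h2
          exact absurd h2 (lt_irrefl _)
        · exact Finset.mem_union_left _ (Finset.mem_union_right _ (key R hpR e he hex hr))
      · exact Finset.mem_union_left _ (Finset.mem_union_left _ (key L hpL e he hex hl))
    · exact Finset.mem_union_right _ (Finset.mem_filter.2 ⟨he, hex⟩)
  have c1 := Finset.card_le_card hsub
  have c2 := Finset.card_union_le ((top L ∪ bot L) ∪ (top R ∪ bot R)) mx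
  have c3 := Finset.card_union_le (top L ∪ bot L) (top R ∪ bot R)
  have c4 := Finset.card_union_le (top L) (bot L)
  have c5 := Finset.card_union_le (top R) (bot R)
  have := htop L hL
  have := htop R hR
  have := hbot L hL
  have := hbot R hR
  omega

/-- order of two noncrossing continuous functions persists to the left. -/
lemma order_persist (f g : ℝ → ℝ) (a v : ℝ) (hav : a < v) (hf : ContinuousOn f (Set.Icc a v))
    (hg : ContinuousOn g (Set.Icc a v)) (hne : ∀ x ∈ Set.Ioc a v, f x ≠ g x) (hv : f v < g v) :
    f a ≤ g a := by
  by_contra hc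
  push Not at hc
  have hcont : ContinuousOn (fun x => g x - f x) (Set.Icc a v) := hg.sub hf
  have := intermediate_value_Icc hav.le hcont
  obtain ⟨x, hx, hx0⟩ := this (show (0:ℝ) ∈ Set.Icc (g a - f a) (g v - f v) from ⟨by linarith, by linarith⟩)
  have hxa : x ≠ a := by
    rintro rfl
    simp only at hx0
    linarith
  exact hne x ⟨lt_of_le_of_ne hx.1 hxa.symm, hx.2⟩ (by simp only at hx0; linarith)

/-- abab pattern lemma at left endpoints -/
lemma left_pattern (h1 h2 h3 : ℝ → ℝ) (a b : ℝ × ℝ) (v : ℝ) (ha : a.1 < v) (hb : b.1 < v)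
    (hab : b.1 ≤ a.1)
    (c1 : ContinuousOn h1 (Set.Icc a.1 v)) (c2 : ContinuousOn h2 (Set.Icc b.1 v))
    (c3 : ContinuousOn h3 (Set.Icc a.1 v))
    (e1 : h1 a.1 = a.2) (e2 : h2 b.1 = b.2) (e3 : h3 a.1 = a.2)
    (n12 : ∀ x ∈ Set.Ioc a.1 v, h1 x ≠ h2 x) (n23 : ∀ x ∈ Set.Ioc a.1 v, h2 x ≠ h3 x)
    (hv : b.1 < a.1 → h2 a.1 ≠ a.2)
    (o12 : h1 v < h2 v) (o23 : h2 v < h3 v) : a = b := by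
  have c2' : ContinuousOn h2 (Set.Icc a.1 v) := c2.mono (Set.Icc_subset_Icc_left hab)
  have q1 := order_persist h1 h2 a.1 v ha c1 c2' n12 o12
  have q2 := order_persist h2 h3 a.1 v ha c2' c3 n23 o23
  have q : h2 a.1 = a.2 := le_antisymm (by linarith) (by linarith)
  rcases hab.lt_or_eq with h | h
  · exact absurd q (hv h)
  · ext
    · exact h.symm
    · rw [← q, ← h, e2]

/-- A drawing of edges as graphs of functions. -/
structure Drawing {E : Type*} (F : Finset E) (V : Finset (ℝ × ℝ)) (l r : E → ℝ × ℝ)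
    (h : E → ℝ → ℝ) : Prop where
  lV : ∀ e ∈ F, l e ∈ V
  rV : ∀ e ∈ F, r e ∈ V
  lr : ∀ e ∈ F, (l e).1 < (r e).1
  cont : ∀ e ∈ F, ContinuousOn (h e) (Set.Icc (l e).1 (r e).1)
  hl : ∀ e ∈ F, h e (l e).1 = (l e).2
  hr : ∀ e ∈ F, h e (r e).1 = (r e).2
  vert : ∀ e ∈ F, ∀ p ∈ V, (l e).1 < p.1 → p.1 < (r e).1 → h e p.1 ≠ p.2
  simple : ∀ e ∈ F, ∀ e' ∈ F, l e = l e' → r e = r e' → e = e'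

def Crosses {E : Type*} (l r : E → ℝ × ℝ) (h : E → ℝ → ℝ) (e e' : E) : Prop :=
  e ≠ e' ∧ ∃ x, (l e).1 < x ∧ x < (r e).1 ∧ (l e').1 < x ∧ x < (r e').1 ∧ h e x = h e' x

lemma line_bound {E : Type*} [DecidableEq E] (F : Finset E) (V : Finset (ℝ × ℝ)) (l r : E → ℝ × ℝ)
    (h : E → ℝ → ℝ) (hD : Drawing F V l r h)
    (hnc : ∀ e ∈ F, ∀ e' ∈ F, ¬ Crosses l r h e e') (v : ℝ)
    (hv : ∀ e ∈ F, (l e).1 < v ∧ v < (r e).1) : F.card ≤ 4 * V.card + 1 := by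
  have hne : ∀ e ∈ F, ∀ e' ∈ F, e ≠ e' → ∀ x, (l e).1 < x → x < (r e).1 → (l e').1 < x →
      x < (r e').1 → h e x ≠ h e' x := by
    intro e he e' he' hee x a b c d heq
    exact hnc e he e' he' ⟨hee, x, a, b, c, d, heq⟩
  have hneh : ∀ e1 e2 : E, h e1 v < h e2 v → e1 ≠ e2 := by
    rintro e1 e2 hlt rfl
    exact lt_irrefl _ hlt
  refine ds_count F V (fun e => h e v) ?_ l r hD.lV hD.rV hD.simple ?_ ?_
  · intro e he e' he' heq
    by_contra hc
    exact hne e he e' he' hc v (hv e he).1 (hv e he).2 (hv e' he').1 (hv e' he').2 heq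
  · -- left
    have main : ∀ e1 ∈ F, ∀ e2 ∈ F, ∀ e3 ∈ F, h e1 v < h e2 v → h e2 v < h e3 v → l e1 = l e3 →
        (l e2).1 ≤ (l e1).1 → l e1 = l e2 := by
      intro e1 m1 e2 m2 e3 m3 o12 o23 h13 hle
      have k1 := hv e1 m1
      have k2 := hv e2 m2
      have k3 := hv e3 m3
      refine left_pattern (h e1) (h e2) (h e3) (l e1) (l e2) v k1.1 k2.1 hle
        ((hD.cont e1 m1).mono (Set.Icc_subset_Icc_right k1.2.le))
        ((hD.cont e2 m2).mono (Set.Icc_subset_Icc_right k2.2.le))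
        (by rw [h13]; exact ((hD.cont e3 m3).mono (Set.Icc_subset_Icc_right k3.2.le)))
        (hD.hl e1 m1) (hD.hl e2 m2) (by rw [h13]; exact hD.hl e3 m3) ?_ ?_ ?_ o12 o23
      · intro x hx
        exact hne e1 m1 e2 m2 (hneh _ _ o12) x hx.1 (by linarith [hx.2]) (by linarith [hx.1])
          (by linarith [hx.2])
      · intro x hx
        exact hne e2 m2 e3 m3 (hneh _ _ o23) x (by linarith [hx.1]) (by linarith [hx.2])
          (by rw [← h13]; exact hx.1) (by linarith [hx.2])
      · intro hlt
        exact hD.vert e2 m2 (l e1) (hD.lV e1 m1) hlt (by linarith)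
    intro e1 m1 e2 m2 e3 m3 e4 m4 o12 o23 o34 h13 h24
    rcases le_total (l e2).1 (l e1).1 with hle | hle
    · exact main e1 m1 e2 m2 e3 m3 o12 o23 h13 hle
    · rw [h13] at hle
      rw [h13, main e2 m2 e3 m3 e4 m4 o23 o34 h24 hle]
  · -- right
    have main : ∀ e1 ∈ F, ∀ e2 ∈ F, ∀ e3 ∈ F, h e1 v < h e2 v → h e2 v < h e3 v → r e1 = r e3 →
        (r e1).1 ≤ (r e2).1 → r e1 = r e2 := by
      intro e1 m1 e2 m2 e3 m3 o12 o23 h13 hle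
      have k1 := hv e1 m1
      have k2 := hv e2 m2
      have k3 := hv e3 m3
      have cc : ∀ e ∈ F, ContinuousOn (fun x => h e (-x)) (Set.Icc (-(r e).1) (-v)) := by
        intro e he
        refine (hD.cont e he).comp continuous_neg.continuousOn ?_
        intro x hx
        have := hv e he
        exact ⟨by linarith [hx.2, this.1], by linarith [hx.1]⟩
      have hh := left_pattern (fun x => h e1 (-x)) (fun x => h e2 (-x)) (fun x => h e3 (-x))
        (-(r e1).1, (r e1).2) (-(r e2).1, (r e2).2) (-v) (by simpa using k1.2) (by simpa using k2.2)
        (by simpa using hle) (cc e1 m1) (cc e2 m2) (by rw [h13]; exact cc e3 m3)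
        (by simpa using hD.hr e1 m1) (by simpa using hD.hr e2 m2)
        (by rw [h13]; simpa using hD.hr e3 m3) ?_ ?_ ?_ (by simpa using o12) (by simpa using o23)
      · simp only [Prod.mk.injEq, neg_inj] at hh
        exact Prod.ext hh.1 hh.2
      · intro x hx
        simp only [Set.mem_Ioc] at hx
        exact hne e1 m1 e2 m2 (hneh _ _ o12) (-x) (by linarith [hx.2]) (by linarith [hx.1])
          (by linarith [hx.2]) (by linarith [hx.1])
      · intro x hx
        simp only [Set.mem_Ioc] at hx
        exact hne e2 m2 e3 m3 (hneh _ _ o23) (-x) (by linarith [hx.2]) (by linarith [hx.1])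
          (by linarith [hx.2]) (by rw [← h13]; linarith [hx.1])
      · intro hlt
        simp only [neg_lt_neg_iff, neg_neg] at hlt ⊢
        exact hD.vert e2 m2 (r e1) (hD.rV e1 m1) (by linarith) hlt
    intro e1 m1 e2 m2 e3 m3 e4 m4 o12 o23 o34 h13 h24
    rcases le_total (r e1).1 (r e2).1 with hle | hle
    · exact main e1 m1 e2 m2 e3 m3 o12 o23 h13 hle
    · rw [h13] at hle
      rw [h13, main e2 m2 e3 m3 e4 m4 o23 o34 h24 hle]

lemma Drawing.mono {E : Type*} {F F' : Finset E} {V V' : Finset (ℝ × ℝ)} {l r : E → ℝ × ℝ}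
    {h : E → ℝ → ℝ} (hD : Drawing F V l r h) (hF : F' ⊆ F) (hV : V' ⊆ V)
    (h1 : ∀ e ∈ F', l e ∈ V') (h2 : ∀ e ∈ F', r e ∈ V') : Drawing F' V' l r h where
  lV := h1
  rV := h2
  lr e he := hD.lr e (hF he)
  cont e he := hD.cont e (hF he)
  hl e he := hD.hl e (hF he)
  hr e he := hD.hr e (hF he)
  vert e he p hp := hD.vert e (hF he) p (hV hp)
  simple e he e' he' := hD.simple e (hF he) e' (hF he')

lemma exists_median (V : Finset (ℝ × ℝ)) (hV : V.Nonempty) :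
    ∃ v : ℝ, 2 * (V.filter (fun p => p.1 < v)).card ≤ V.card ∧
      2 * (V.filter (fun p => v < p.1)).card ≤ V.card := by
  classical
  -- take the smallest abscissa v with 2 * #{p.1 ≤ v} ≥ |V|
  have hne : (V.filter (fun p => V.card ≤ 2 * (V.filter (fun q => q.1 ≤ p.1)).card)).Nonempty := by
    obtain ⟨m, hm, hmax⟩ := Finset.exists_max_image V (fun p => p.1) hV
    refine ⟨m, ?_⟩
    rw [Finset.mem_filter]
    refine ⟨hm, ?_⟩
    rw [Finset.filter_true_of_mem (fun q hq => hmax q hq)]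
    omega
  obtain ⟨m, hm, hmin⟩ := Finset.exists_min_image _ (fun p => p.1) hne
  rw [Finset.mem_filter] at hm
  refine ⟨m.1, ?_, ?_⟩
  · by_contra hc
    push Not at hc
    -- the max of points < m.1 is also good
    have hne2 : (V.filter (fun p => p.1 < m.1)).Nonempty := by
      rw [← Finset.card_pos]; omega
    obtain ⟨q, hq, hqmax⟩ := Finset.exists_max_image _ (fun p => p.1) hne2
    rw [Finset.mem_filter] at hq
    have := hmin q (by
      rw [Finset.mem_filter]
      refine ⟨hq.1, ?_⟩
      have : (V.filter (fun p => p.1 < m.1)).card ≤ (V.filter (fun p => p.1 ≤ q.1)).card := by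
        apply Finset.card_le_card
        intro p hp
        have h1 := hqmax p hp
        rw [Finset.mem_filter] at hp ⊢
        exact ⟨hp.1, h1⟩
      omega)
    linarith [hq.2]
  · have h1 := hm.2
    have h2 := Finset.card_filter_add_card_filter_not (s := V) (fun q => q.1 ≤ m.1)
    have h3 : (V.filter (fun q => ¬ q.1 ≤ m.1)) = V.filter (fun p => m.1 < p.1) := by
      ext; simp
    rw [h3] at h2
    omega

lemma noncross_bound {E : Type*} [DecidableEq E] (l r : E → ℝ × ℝ) (h : E → ℝ → ℝ) :
    ∀ (m : ℕ) (F : Finset E) (V : Finset (ℝ × ℝ)), V.card ≤ m → Drawing F V l r h →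
    (∀ e ∈ F, ∀ e' ∈ F, ¬ Crosses l r h e e') → F.card ≤ 10 * V.card * (Nat.log 2 V.card + 1) := by
  intro m
  induction m with
  | zero =>
    intro F V hV hD _
    have hV0 : V = ∅ := Finset.card_eq_zero.1 (by omega)
    have : F = ∅ := by
      rw [Finset.eq_empty_iff_forall_notMem]
      intro e he
      have := hD.lV e he
      rw [hV0] at this
      simp at this
    simp [this]
  | succ m ih =>
    intro F V hV hD hnc
    by_cases hne : V.Nonempty
    swap
    · rw [Finset.not_nonempty_iff_eq_empty] at hne
      have : F = ∅ := by
        rw [Finset.eq_empty_iff_forall_notMem]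
        intro e he
        have := hD.lV e he
        rw [hne] at this
        simp at this
      simp [this]
    obtain ⟨v, hv1, hv2⟩ := exists_median V hne
    set V1 := V.filter (fun p => p.1 < v) with hV1
    set V2 := V.filter (fun p => v < p.1) with hV2
    have hpos : 0 < V.card := hne.card_pos
    have hV12 : V1.card + V2.card ≤ V.card := by omega
    -- v1 and v2
    have hv1e : ∃ v1, v1 < v ∧ ∀ p ∈ V1, p.1 < v1 := by
      by_cases hn : V1.Nonempty
      · obtain ⟨q, hq, hqm⟩ := Finset.exists_max_image V1 (fun p => p.1) hn
        have : q.1 < v := (Finset.mem_filter.1 hq).2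
        obtain ⟨w, hw1, hw2⟩ := exists_between this
        exact ⟨w, hw2, fun p hp => lt_of_le_of_lt (hqm p hp) hw1⟩
      · rw [Finset.not_nonempty_iff_eq_empty] at hn
        exact ⟨v - 1, by linarith, by simp [hn]⟩
    have hv2e : ∃ v2, v < v2 ∧ ∀ p ∈ V2, v2 < p.1 := by
      by_cases hn : V2.Nonempty
      · obtain ⟨q, hq, hqm⟩ := Finset.exists_min_image V2 (fun p => p.1) hn
        have : v < q.1 := (Finset.mem_filter.1 hq).2
        obtain ⟨w, hw1, hw2⟩ := exists_between this
        exact ⟨w, hw1, fun p hp => lt_of_lt_of_le hw2 (hqm p hp)⟩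
      · rw [Finset.not_nonempty_iff_eq_empty] at hn
        exact ⟨v + 1, by linarith, by simp [hn]⟩
    obtain ⟨v1, hv1v, hv1p⟩ := hv1e
    obtain ⟨v2, hv2v, hv2p⟩ := hv2e
    let F1 := F.filter (fun e => (r e).1 < v)
    let F2 := F.filter (fun e => v < (l e).1)
    let F3 := F.filter (fun e => (l e).1 < v ∧ v ≤ (r e).1)
    let F4 := F.filter (fun e => (l e).1 = v)
    have hsub : F ⊆ (F1 ∪ F2) ∪ (F3 ∪ F4) := by
      intro e he
      simp only [F1, F2, F3, F4, Finset.mem_union, Finset.mem_filter, he, true_and]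
      rcases lt_trichotomy (l e).1 v with h1 | h1 | h1
      · rcases lt_or_ge (r e).1 v with h2 | h2
        · tauto
        · tauto
      · tauto
      · tauto
    have hF1 : F1.card ≤ 10 * V1.card * (Nat.log 2 V1.card + 1) := by
      refine ih F1 V1 (by omega) (hD.mono (Finset.filter_subset _ _) (Finset.filter_subset _ _) ?_ ?_) ?_
      · intro e he
        rw [Finset.mem_filter] at he
        exact Finset.mem_filter.2 ⟨hD.lV e he.1, (hD.lr e he.1).trans he.2⟩
      · intro e he
        rw [Finset.mem_filter] at he
        exact Finset.mem_filter.2 ⟨hD.rV e he.1, he.2⟩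
      · intro e he e' he'
        exact hnc e (Finset.mem_filter.1 he).1 e' (Finset.mem_filter.1 he').1
    have hF2 : F2.card ≤ 10 * V2.card * (Nat.log 2 V2.card + 1) := by
      refine ih F2 V2 (by omega) (hD.mono (Finset.filter_subset _ _) (Finset.filter_subset _ _) ?_ ?_) ?_
      · intro e he
        rw [Finset.mem_filter] at he
        exact Finset.mem_filter.2 ⟨hD.lV e he.1, he.2⟩
      · intro e he
        rw [Finset.mem_filter] at he
        exact Finset.mem_filter.2 ⟨hD.rV e he.1, he.2.trans (hD.lr e he.1)⟩
      · intro e he e' he'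
        exact hnc e (Finset.mem_filter.1 he).1 e' (Finset.mem_filter.1 he').1
    have hF3 : F3.card ≤ 4 * V.card + 1 := by
      refine line_bound F3 V l r h (hD.mono (Finset.filter_subset _ _) (Finset.Subset.refl _) ?_ ?_) ?_ v1 ?_
      · intro e he; exact hD.lV e (Finset.mem_filter.1 he).1
      · intro e he; exact hD.rV e (Finset.mem_filter.1 he).1
      · intro e he e' he'
        exact hnc e (Finset.mem_filter.1 he).1 e' (Finset.mem_filter.1 he').1
      · intro e he
        rw [Finset.mem_filter] at he
        exact ⟨hv1p _ (Finset.mem_filter.2 ⟨hD.lV e he.1, he.2.1⟩), lt_of_lt_of_le hv1v he.2.2⟩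
    have hF4 : F4.card ≤ 4 * V.card + 1 := by
      refine line_bound F4 V l r h (hD.mono (Finset.filter_subset _ _) (Finset.Subset.refl _) ?_ ?_) ?_ v2 ?_
      · intro e he; exact hD.lV e (Finset.mem_filter.1 he).1
      · intro e he; exact hD.rV e (Finset.mem_filter.1 he).1
      · intro e he e' he'
        exact hnc e (Finset.mem_filter.1 he).1 e' (Finset.mem_filter.1 he').1
      · intro e he
        rw [Finset.mem_filter] at he
        refine ⟨by rw [he.2]; exact hv2v, hv2p _ (Finset.mem_filter.2 ⟨hD.rV e he.1, ?_⟩)⟩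
        rw [← he.2]; exact hD.lr e he.1
    have hc : F.card ≤ (F1.card + F2.card) + (F3.card + F4.card) :=
      (Finset.card_le_card hsub).trans ((Finset.card_union_le _ _).trans
        (add_le_add (Finset.card_union_le _ _) (Finset.card_union_le _ _)))
    have hlog : ∀ k, 2 * k ≤ V.card → 10 * k * (Nat.log 2 k + 1) ≤ 10 * k * Nat.log 2 V.card := by
      intro k hk
      rcases Nat.eq_zero_or_pos k with h0 | h0
      · simp [h0]
      · apply Nat.mul_le_mul_left
        have : Nat.log 2 (k * 2) = Nat.log 2 k + 1 := Nat.log_mul_base (by norm_num) (by omega)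
        rw [← this]
        exact Nat.log_mono_right (by omega)
    have l1 := hlog _ hv1
    have l2 := hlog _ hv2
    have : 10 * V1.card * Nat.log 2 V.card + 10 * V2.card * Nat.log 2 V.card
        ≤ 10 * V.card * Nat.log 2 V.card := by
      rw [← add_mul, ← mul_add]
      gcongr
    calc F.card ≤ 10 * V.card * Nat.log 2 V.card + (8 * V.card + 2) := by omega
      _ ≤ 10 * V.card * (Nat.log 2 V.card + 1) := by rw [mul_add]; omega


lemma card_colorings {α : Type*} [Fintype α] [DecidableEq α] (r : ℕ) [NeZero r] (S : Finset α) :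
    (Finset.univ.filter (fun χ : α → Fin r => ∀ p ∈ S, χ p = 0)).card * r ^ S.card
      = r ^ Fintype.card α := by
  have : (Finset.univ.filter (fun χ : α → Fin r => ∀ p ∈ S, χ p = 0))
      = Fintype.piFinset (fun p => if p ∈ S then ({0} : Finset (Fin r)) else Finset.univ) := by
    ext χ
    simp only [Finset.mem_filter, Finset.mem_univ, true_and, Fintype.mem_piFinset]
    constructor
    · intro h p
      by_cases hp : p ∈ S
      · simp [hp, h p hp]
      · simp [hp]
    · intro h p hp
      have := h p
      simpa [hp] using this
  rw [this, Fintype.card_piFinset]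
  have h2 : ∀ p, (if p ∈ S then ({0} : Finset (Fin r)) else Finset.univ).card = if p ∈ S then 1 else r := by
    intro p; split_ifs <;> simp
  simp only [h2]
  rw [Finset.prod_ite]
  simp only [Finset.prod_const_one, one_mul, Finset.prod_const]
  rw [← pow_add]
  congr 1
  have := Finset.card_filter_add_card_filter_not (s := (Finset.univ : Finset α)) (fun p => p ∈ S)
  simp only [Finset.filter_univ_mem] at this
  rw [Finset.card_univ] at this
  omega

lemma sampling {E α : Type} [DecidableEq E] [DecidableEq α] (V : Finset α) (F : Finset E)
    (l r : E → α) (hl : ∀ e ∈ F, l e ∈ V) (hr : ∀ e ∈ F, r e ∈ V) (hlr : ∀ e ∈ F, l e ≠ r e)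
    (X : Finset (E × E)) (hX : ∀ q ∈ X, q.1 ∈ F ∧ q.2 ∈ F ∧ l q.1 ≠ l q.2 ∧ l q.1 ≠ r q.2 ∧
      r q.1 ≠ l q.2 ∧ r q.1 ≠ r q.2) (c : ℕ)
    (H : ∀ V' ⊆ V, (F.filter (fun e => l e ∈ V' ∧ r e ∈ V')).card ≤ c * V'.card +
      (X.filter (fun q => l q.1 ∈ V' ∧ r q.1 ∈ V' ∧ l q.2 ∈ V' ∧ r q.2 ∈ V')).card)
    (k : ℕ) (hk : 0 < k) : F.card * k ^ 2 ≤ c * V.card * k ^ 3 + X.card := by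
  classical
  have : NeZero k := ⟨hk.ne'⟩
  let VV (χ : V → Fin k) : Finset α := (Finset.univ.filter (fun p : V => χ p = 0)).image Subtype.val
  have hVV : ∀ χ, VV χ ⊆ V := by
    intro χ p hp
    simp only [VV, Finset.mem_image] at hp
    obtain ⟨q, _, rfl⟩ := hp
    exact q.2
  have hmem : ∀ χ (p : α) (hp : p ∈ V), p ∈ VV χ ↔ χ ⟨p, hp⟩ = 0 := by
    intro χ p hp
    simp only [VV, Finset.mem_image, Finset.mem_filter, Finset.mem_univ, true_and]
    constructor
    · rintro ⟨q, hq, rfl⟩; exact hq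
    · intro h; exact ⟨⟨p, hp⟩, h, rfl⟩
  set N := k ^ Fintype.card V with hN
  have hNpos : 0 < N := pow_pos hk _
  -- sum of edges
  have hsum : ∀ (β : Type) (G : Finset β) (s : β → Finset V) (j : ℕ) (P : β → (V → Fin k) → Prop)
      [∀ e χ, Decidable (P e χ)],
      (∀ e ∈ G, (s e).card = j) → (∀ e ∈ G, ∀ χ, P e χ ↔ ∀ p ∈ s e, χ p = 0) →
      (∑ χ : V → Fin k, (G.filter (fun e => P e χ)).card) * k ^ j = G.card * N := by
    intro β G s j P _ hs hP
    have : ∑ χ : V → Fin k, (G.filter (fun e => P e χ)).card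
        = ∑ e ∈ G, (Finset.univ.filter (fun χ : V → Fin k => P e χ)).card := by
      simp only [Finset.card_filter]
      rw [Finset.sum_comm]
    rw [this, Finset.sum_mul]
    rw [Finset.sum_congr rfl (g := fun _ => N)]
    · simp
    · intro e he
      have : (Finset.univ.filter (fun χ : V → Fin k => P e χ))
          = Finset.univ.filter (fun χ : V → Fin k => ∀ p ∈ s e, χ p = 0) := by
        apply Finset.filter_congr
        intro χ _
        exact hP e he χ
      rw [this, ← hs e he, card_colorings]
  -- vertices
  have s1 := hsum V Finset.univ (fun p => {p}) 1 (fun p χ => χ p = 0) (by simp) (by simp)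
  let tv : α → Finset V := fun p => if hp : p ∈ V then {⟨p, hp⟩} else ∅
  have htv : ∀ p (hp : p ∈ V), tv p = {⟨p, hp⟩} := by intro p hp; simp [tv, hp]
  have s2 := hsum E F (fun e => tv (l e) ∪ tv (r e)) 2 (fun e χ => l e ∈ VV χ ∧ r e ∈ VV χ) (by
      intro e he
      rw [htv _ (hl e he), htv _ (hr e he)]
      rw [Finset.card_union_of_disjoint]
      · simp
      · simpa using hlr e he)
    (by
      intro e he χ
      rw [htv _ (hl e he), htv _ (hr e he), hmem _ _ (hl e he), hmem _ _ (hr e he)]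
      simp [or_imp, forall_and])
  have s3 := hsum (E × E) X (fun q => {x : V | x.1 = l q.1 ∨ x.1 = r q.1 ∨ x.1 = l q.2 ∨ x.1 = r q.2}) 4
    (fun q χ => l q.1 ∈ VV χ ∧ r q.1 ∈ VV χ ∧ l q.2 ∈ VV χ ∧ r q.2 ∈ VV χ) (by
      intro q hq
      obtain ⟨q1, q2, n1, n2, n3, n4⟩ := hX q hq
      have : (({x : V | x.1 = l q.1 ∨ x.1 = r q.1 ∨ x.1 = l q.2 ∨ x.1 = r q.2} : Finset V).map
          ⟨Subtype.val, Subtype.val_injective⟩) = {l q.1, r q.1, l q.2, r q.2} := by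
        ext x
        simp only [Finset.mem_map, Finset.mem_filter, Finset.mem_univ, true_and,
          Function.Embedding.coeFn_mk, Finset.mem_insert, Finset.mem_singleton]
        constructor
        · rintro ⟨y, hy, rfl⟩; exact hy
        · intro hx
          have : x ∈ V := by
            rcases hx with h | h | h | h <;> rw [h]
            exacts [hl _ q1, hr _ q1, hl _ q2, hr _ q2]
          exact ⟨⟨x, this⟩, hx, rfl⟩
      rw [← Finset.card_map, this]
      rw [Finset.card_insert_of_notMem, Finset.card_insert_of_notMem, Finset.card_insert_of_notMem,
        Finset.card_singleton]
      · simpa using hlr _ q2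
      · simp [n3, n4]
      · simp [n1, n2, hlr _ q1])
    (by
      intro q hq χ
      obtain ⟨q1, q2, -⟩ := hX q hq
      rw [hmem _ _ (hl _ q1), hmem _ _ (hr _ q1), hmem _ _ (hl _ q2), hmem _ _ (hr _ q2)]
      constructor
      · rintro ⟨a1, a2, a3, a4⟩ ⟨p, hp⟩ hx
        simp only [Finset.mem_filter, Finset.mem_univ, true_and] at hx
        rcases hx with h | h | h | h <;> subst h <;> assumption
      · intro h
        refine ⟨h _ ?_, h _ ?_, h _ ?_, h _ ?_⟩ <;> simp)
  have hVVc : ∀ χ, (VV χ).card = (Finset.univ.filter (fun p : V => χ p = 0)).card := by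
    intro χ
    exact Finset.card_image_of_injective _ Subtype.val_injective
  have hle : ∑ χ : V → Fin k, (F.filter (fun e => l e ∈ VV χ ∧ r e ∈ VV χ)).card ≤
      c * ∑ χ : V → Fin k, (Finset.univ.filter (fun p : V => χ p = 0)).card +
      ∑ χ : V → Fin k, (X.filter (fun q => l q.1 ∈ VV χ ∧ r q.1 ∈ VV χ ∧ l q.2 ∈ VV χ ∧ r q.2 ∈ VV χ)).card := by
    rw [Finset.mul_sum, ← Finset.sum_add_distrib]
    apply Finset.sum_le_sum
    intro χ _
    have := H (VV χ) (hVV χ)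
    rwa [hVVc] at this
  have hcard : (Finset.univ : Finset V).card = V.card := by simp
  rw [hcard] at s1
  set a := ∑ χ : V → Fin k, (F.filter (fun e => l e ∈ VV χ ∧ r e ∈ VV χ)).card
  set b := ∑ χ : V → Fin k, (Finset.univ.filter (fun p : V => χ p = 0)).card
  set d := ∑ χ : V → Fin k, (X.filter (fun q => l q.1 ∈ VV χ ∧ r q.1 ∈ VV χ ∧ l q.2 ∈ VV χ ∧ r q.2 ∈ VV χ)).card
  have : (F.card * k ^ 2) * N ≤ (c * V.card * k ^ 3 + X.card) * N := by
    calc (F.card * k ^ 2) * N = (F.card * N) * k ^ 2 := by ring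
      _ = a * k ^ 4 := by rw [← s2]; ring
      _ ≤ (c * b + d) * k ^ 4 := Nat.mul_le_mul_right _ hle
      _ = c * (b * k ^ 1) * k ^ 3 + d * k ^ 4 := by ring
      _ = (c * V.card * k ^ 3 + X.card) * N := by rw [s1, s3]; ring
  exact Nat.le_of_mul_le_mul_right this hNpos

/-- crossing bound for a drawing -/
lemma crossing_bound {E : Type} [DecidableEq E] (l r : E → ℝ × ℝ) (h : E → ℝ → ℝ)
    (F : Finset E) (V : Finset (ℝ × ℝ)) (hD : Drawing F V l r h)
    (X : Finset (E × E)) (hX : ∀ q ∈ X, q.1 ∈ F ∧ q.2 ∈ F ∧ l q.1 ≠ l q.2 ∧ l q.1 ≠ r q.2 ∧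
      r q.1 ≠ l q.2 ∧ r q.1 ≠ r q.2)
    (hcr : ∀ e ∈ F, ∀ e' ∈ F, Crosses l r h e e' → (e, e') ∈ X)
    (k : ℕ) (hk : 0 < k) :
    F.card * k ^ 2 ≤ 10 * (Nat.log 2 V.card + 1) * V.card * k ^ 3 + X.card := by
  classical
  refine sampling V F l r hD.lV hD.rV ?_ X hX _ ?_ k hk
  · intro e he heq
    have := hD.lr e he
    rw [heq] at this
    exact lt_irrefl _ this
  intro V' hV'
  set F' := F.filter (fun e => l e ∈ V' ∧ r e ∈ V') with hF'
  set X' := X.filter (fun q => l q.1 ∈ V' ∧ r q.1 ∈ V' ∧ l q.2 ∈ V' ∧ r q.2 ∈ V') with hX'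
  set F'' := F' \ X'.image Prod.fst with hF''
  have h1 : F''.card ≤ 10 * V'.card * (Nat.log 2 V'.card + 1) := by
    have hs : F'' ⊆ F' := Finset.sdiff_subset
    refine noncross_bound l r h V'.card F'' V' le_rfl (hD.mono (hs.trans (Finset.filter_subset _ _)) hV' ?_ ?_) ?_
    · intro e he; exact (Finset.mem_filter.1 (hs he)).2.1
    · intro e he; exact (Finset.mem_filter.1 (hs he)).2.2
    · intro e he e' he' hc
      have m1 := Finset.mem_filter.1 (hs he)
      have m2 := Finset.mem_filter.1 (hs he')
      have := hcr e m1.1 e' m2.1 hc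
      rw [hF'', Finset.mem_sdiff] at he
      apply he.2
      rw [Finset.mem_image]
      exact ⟨(e, e'), Finset.mem_filter.2 ⟨this, m1.2.1, m1.2.2, m2.2.1, m2.2.2⟩, rfl⟩
  have h2 : F'.card ≤ F''.card + X'.card := by
    have := Finset.le_card_sdiff (X'.image Prod.fst) F'
    have h3 : (X'.image Prod.fst).card ≤ X'.card := Finset.card_image_le
    rw [← hF''] at this
    omega
  calc F'.card ≤ F''.card + X'.card := h2
    _ ≤ 10 * V'.card * (Nat.log 2 V'.card + 1) + X'.card := by omega
    _ ≤ 10 * (Nat.log 2 V.card + 1) * V'.card + X'.card := by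
      have : Nat.log 2 V'.card ≤ Nat.log 2 V.card := Nat.log_mono_right (Finset.card_le_card hV')
      have h4 : 10 * V'.card * (Nat.log 2 V'.card + 1) ≤ 10 * V'.card * (Nat.log 2 V.card + 1) := by gcongr
      have h5 : 10 * V'.card * (Nat.log 2 V.card + 1) = 10 * (Nat.log 2 V.card + 1) * V'.card := by ring
      omega

/-- Szemeredi-Trotter type bound for arcs that pairwise meet at most once. -/
theorem arcs_ST {ι : Type} [DecidableEq ι] (S : Finset ι) (dom : ι → Set ℝ) (f : ι → ℝ → ℝ)
    (hdom : ∀ i ∈ S, (dom i).OrdConnected) (hf : ∀ i ∈ S, ContinuousOn (f i) (dom i))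
    (hone : ∀ i ∈ S, ∀ j ∈ S, i ≠ j → ∀ x y, x ∈ dom i → x ∈ dom j → y ∈ dom i → y ∈ dom j →
      f i x = f j x → f i y = f j y → x = y)
    (V : Finset (ℝ × ℝ)) (X : Finset (ι × ι))
    (hX : ∀ i ∈ S, ∀ j ∈ S, i ≠ j → ∀ x, x ∈ dom i → x ∈ dom j → f i x = f j x → (i, j) ∈ X)
    (I : Finset (ι × (ℝ × ℝ))) (hI : ∀ q ∈ I, q.1 ∈ S ∧ q.2 ∈ V ∧ q.2.1 ∈ dom q.1 ∧ f q.1 q.2.1 = q.2.2)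
    (k : ℕ) (hk : 0 < k) :
    I.card * k ^ 2 ≤ S.card * k ^ 2 + 10 * (Nat.log 2 V.card + 1) * V.card * k ^ 3 + X.card := by
  classical
  -- full incidence set
  set J : Finset (ι × (ℝ × ℝ)) := (S ×ˢ V).filter (fun q => q.2.1 ∈ dom q.1 ∧ f q.1 q.2.1 = q.2.2) with hJ
  have hIJ : I ⊆ J := by
    intro q hq
    obtain ⟨h1, h2, h3, h4⟩ := hI q hq
    simp [hJ, h1, h2, h3, h4]
  have memJ : ∀ i p, (i, p) ∈ J ↔ i ∈ S ∧ p ∈ V ∧ p.1 ∈ dom i ∧ f i p.1 = p.2 := by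
    intro i p; simp [hJ, and_assoc]
  -- edges
  let isE : ι × (ℝ × ℝ) → Prop := fun q => ∃ p, (q.1, p) ∈ J ∧ q.2.1 < p.1
  have hnext : ∀ q : ι × (ℝ × ℝ), ∃ p, isE q → (q.1, p) ∈ J ∧ q.2.1 < p.1 ∧
      ∀ p', (q.1, p') ∈ J → q.2.1 < p'.1 → p.1 ≤ p'.1 := by
    intro q
    by_cases hq : isE q
    · obtain ⟨p0, hp0, hlt0⟩ := hq
      obtain ⟨p, hp, hmin⟩ := Finset.exists_min_image (V.filter (fun p => (q.1, p) ∈ J ∧ q.2.1 < p.1))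
        (fun p => p.1) ⟨p0, Finset.mem_filter.2 ⟨((memJ _ _).1 hp0).2.1, hp0, hlt0⟩⟩
      rw [Finset.mem_filter] at hp
      exact ⟨p, fun _ => ⟨hp.2.1, hp.2.2, fun p' h1 h2 => hmin p' (Finset.mem_filter.2
        ⟨((memJ _ _).1 h1).2.1, h1, h2⟩)⟩⟩
    · exact ⟨0, fun h => absurd h hq⟩
  choose nx hnx using hnext
  set F := J.filter isE with hF
  have hFE : ∀ q ∈ F, q ∈ J ∧ isE q := fun q hq => Finset.mem_filter.1 hq
  have h1 : J.card ≤ F.card + S.card := by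
    have h2 : F.card + (J.filter (fun q => ¬ isE q)).card = J.card := by
      rw [hF]; convert Finset.card_filter_add_card_filter_not (s := J) isE
    have h3 : (J.filter (fun q => ¬ isE q)).card ≤ S.card := by
      refine Finset.card_le_card_of_injOn Prod.fst ?_ ?_
      · rintro ⟨i, p⟩ hq
        have := (Finset.mem_filter.1 hq).1
        exact ((memJ _ _).1 this).1
      · rintro ⟨i, p⟩ hq ⟨j, p'⟩ hq' hij
        simp only at hij
        subst hij
        have m1 := Finset.mem_filter.1 hq
        have m2 := Finset.mem_filter.1 hq'
        have m3 := (memJ _ _).1 m1.1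
        have m4 := (memJ _ _).1 m2.1
        have e1 : p.1 = p'.1 := by
          apply le_antisymm
          · by_contra hc
            push Not at hc
            exact m2.2 ⟨p, m1.1, hc⟩
          · by_contra hc
            push Not at hc
            exact m1.2 ⟨p', m2.1, hc⟩
        have e2 : p.2 = p'.2 := by rw [← m3.2.2.2, ← m4.2.2.2, e1]
        rw [Prod.ext e1 e2]
    omega
  have hicc : ∀ q ∈ F, Set.Icc q.2.1 (nx q).1 ⊆ dom q.1 := by
    intro q hq
    obtain ⟨h1, h2⟩ := hFE q hq
    have m1 := (memJ q.1 q.2).1 h1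
    have m2 := hnx q h2
    have m3 := (memJ _ _).1 m2.1
    exact (hdom q.1 m1.1).out m1.2.2.1 m3.2.2.1
  have hD : Drawing F V (fun q => q.2) nx (fun q => f q.1) := by
    refine ⟨?_, ?_, ?_, ?_, ?_, ?_, ?_, ?_⟩
    · intro q hq; exact ((memJ q.1 q.2).1 (hFE q hq).1).2.1
    · intro q hq; exact ((memJ _ _).1 (hnx q (hFE q hq).2).1).2.1
    · intro q hq; exact (hnx q (hFE q hq).2).2.1
    · intro q hq; exact (hf q.1 ((memJ q.1 q.2).1 (hFE q hq).1).1).mono (hicc q hq)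
    · intro q hq; exact ((memJ q.1 q.2).1 (hFE q hq).1).2.2.2
    · intro q hq; exact ((memJ _ _).1 (hnx q (hFE q hq).2).1).2.2.2
    · intro q hq p hp hlt hlt' heq
      have := (hnx q (hFE q hq).2).2.2 p ((memJ _ _).2 ⟨((memJ q.1 q.2).1 (hFE q hq).1).1, hp,
        hicc q hq ⟨hlt.le, hlt'.le⟩, heq⟩) hlt
      linarith
    · rintro ⟨i, p⟩ hq ⟨j, p'⟩ hq' hl hr
      simp only at hl
      subst hl
      by_cases hij : i = j
      · rw [hij]
      exfalso
      have a1 := (memJ _ _).1 (hFE _ hq).1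
      have a2 := (memJ _ _).1 (hFE _ hq').1
      have b1 := hnx _ (hFE _ hq).2
      have b2 := hnx _ (hFE _ hq').2
      rw [← hr] at b2
      have c1 := (memJ _ _).1 b1.1
      have c2 := (memJ _ _).1 b2.1
      have := hone i a1.1 j a2.1 hij p.1 _ a1.2.2.1 a2.2.2.1 c1.2.2.1 c2.2.2.1
        (by rw [a1.2.2.2, a2.2.2.2]) (by rw [c1.2.2.2, c2.2.2.2])
      have := b1.2.1
      simp only at this
      linarith
  -- crossing pairs
  set XE : Finset ((ι × (ℝ × ℝ)) × (ι × (ℝ × ℝ))) := (F ×ˢ F).filter (fun q => Crosses (fun q => q.2) nx (fun q => f q.1) q.1 q.2) with hXE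
  -- arcs of a crossing pair are distinct
  have hdist : ∀ e ∈ F, ∀ e' ∈ F, Crosses (fun q => q.2) nx (fun q => f q.1) e e' → e.1 ≠ e'.1 := by
    rintro ⟨i, p⟩ he ⟨j, p'⟩ he' ⟨hne, x, h1, h2, h3, h4, h5⟩ hij
    simp only at hij h1 h3
    subst hij
    have b1 := hnx _ (hFE _ he).2
    have b2 := hnx _ (hFE _ he').2
    simp only at b1 b2
    have a1 := (memJ _ _).1 (hFE _ he).1
    have a2 := (memJ _ _).1 (hFE _ he').1
    rcases lt_trichotomy p.1 p'.1 with hlt | heq | hlt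
    · have := b1.2.2 p' (hFE _ he').1 hlt
      linarith
    · have : p.2 = p'.2 := by rw [← a1.2.2.2, ← a2.2.2.2, heq]
      exact hne (by rw [Prod.ext heq this])
    · have := b2.2.2 p (hFE _ he).1 hlt
      linarith
  have hXc : XE.card ≤ X.card := by
    refine Finset.card_le_card_of_injOn (fun q => (q.1.1, q.2.1)) ?_ ?_
    · rintro ⟨e, e'⟩ hq
      obtain ⟨hq1, hq2⟩ := Finset.mem_filter.1 hq
      obtain ⟨m1, m2⟩ := Finset.mem_product.1 hq1
      have hd := hdist e m1 e' m2 hq2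
      obtain ⟨_, x, x1, x2, x3, x4, x5⟩ := hq2
      exact hX _ ((memJ e.1 e.2).1 (hFE _ m1).1).1 _ ((memJ e'.1 e'.2).1 (hFE _ m2).1).1 hd x
        (hicc e m1 ⟨x1.le, x2.le⟩) (hicc e' m2 ⟨x3.le, x4.le⟩) x5
    · rintro ⟨⟨i, p⟩, ⟨j, p'⟩⟩ hq ⟨⟨i2, p2⟩, ⟨j2, p2'⟩⟩ hqq heq
      simp only [Prod.mk.injEq] at heq
      obtain ⟨rfl, rfl⟩ := heq
      obtain ⟨hq1, hq2⟩ := Finset.mem_filter.1 hq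
      obtain ⟨m1, m2⟩ := Finset.mem_product.1 hq1
      obtain ⟨hqq1, hqq2⟩ := Finset.mem_filter.1 hqq
      obtain ⟨mm1, mm2⟩ := Finset.mem_product.1 hqq1
      have hd := hdist _ m1 _ m2 hq2
      obtain ⟨_, x, x1, x2, x3, x4, x5⟩ := hq2
      obtain ⟨_, y, y1, y2, y3, y4, y5⟩ := hqq2
      simp only at m1 m2 mm1 mm2 hd x1 x2 x3 x4 x5 y1 y2 y3 y4 y5
      have hxy : x = y := hone _ ((memJ _ _).1 (hFE _ m1).1).1 _ ((memJ _ _).1 (hFE _ m2).1).1 hd x y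
        (hicc _ m1 ⟨x1.le, x2.le⟩) (hicc _ m2 ⟨x3.le, x4.le⟩)
        (hicc _ mm1 ⟨y1.le, y2.le⟩) (hicc _ mm2 ⟨y3.le, y4.le⟩) x5 y5
      subst hxy
      have uniq : ∀ i p p2, (i, p) ∈ F → (i, p2) ∈ F → p.1 < x → x < (nx (i, p)).1 → p2.1 < x →
          x < (nx (i, p2)).1 → p = p2 := by
        intro i p p2 u1 u2 u3 u4 u5 u6
        have b1 := hnx _ (hFE _ u1).2
        have b2 := hnx _ (hFE _ u2).2
        simp only at b1 b2
        have a1 := (memJ _ _).1 (hFE _ u1).1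
        have a2 := (memJ _ _).1 (hFE _ u2).1
        rcases lt_trichotomy p.1 p2.1 with hlt | heq | hlt
        · have := b1.2.2 p2 (hFE _ u2).1 hlt
          linarith
        · have : p.2 = p2.2 := by rw [← a1.2.2.2, ← a2.2.2.2, heq]
          exact Prod.ext heq this
        · have := b2.2.2 p (hFE _ u1).1 hlt
          linarith
      rw [uniq _ p p2 m1 mm1 x1 x2 y1 y2, uniq _ p' p2' m2 mm2 x3 x4 y3 y4]
  have hcb := crossing_bound (fun q : ι × (ℝ × ℝ) => q.2) nx (fun q => f q.1) F V hD XE ?_ ?_ k hk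
  · have h5 : I.card ≤ F.card + S.card := (Finset.card_le_card hIJ).trans h1
    calc I.card * k ^ 2 ≤ (F.card + S.card) * k ^ 2 := Nat.mul_le_mul_right _ h5
      _ = S.card * k ^ 2 + F.card * k ^ 2 := by ring
      _ ≤ _ := by omega
  · rintro ⟨e, e'⟩ hq
    obtain ⟨hq1, hq2⟩ := Finset.mem_filter.1 hq
    obtain ⟨m1, m2⟩ := Finset.mem_product.1 hq1
    have hd := hdist e m1 e' m2 hq2
    obtain ⟨_, x, x1, x2, x3, x4, x5⟩ := hq2
    have a1 := (memJ e.1 e.2).1 (hFE _ m1).1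
    have a2 := (memJ e'.1 e'.2).1 (hFE _ m2).1
    have b1 := (memJ _ _).1 (hnx _ (hFE _ m1).2).1
    have b2 := (memJ _ _).1 (hnx _ (hFE _ m2).2).1
    have gen : ∀ p : ℝ × ℝ, p.1 ∈ dom e.1 → p.1 ∈ dom e'.1 → f e.1 p.1 = p.2 → f e'.1 p.1 = p.2 → x = p.1 := by
      intro p w1 w2 w3 w4
      exact hone _ a1.1 _ a2.1 hd x p.1 (hicc e m1 ⟨x1.le, x2.le⟩) (hicc e' m2 ⟨x3.le, x4.le⟩) w1 w2 x5 (by rw [w3, w4])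
    refine ⟨m1, m2, ?_, ?_, ?_, ?_⟩
    · intro heq
      have := gen e.2 a1.2.2.1 (by rw [heq]; exact a2.2.2.1) a1.2.2.2 (by rw [heq]; exact a2.2.2.2)
      simp only at x1; linarith
    · intro heq
      have := gen e.2 a1.2.2.1 (by rw [heq]; exact b2.2.2.1) a1.2.2.2 (by rw [heq]; exact b2.2.2.2)
      simp only at x1; linarith
    · intro heq
      have := gen (nx e) b1.2.2.1 (by rw [heq]; exact a2.2.2.1) b1.2.2.2 (by rw [heq]; exact a2.2.2.2)
      linarith
    · intro heq
      have := gen (nx e) b1.2.2.1 (by rw [heq]; exact b2.2.2.1) b1.2.2.2 (by rw [heq]; exact b2.2.2.2)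
      linarith
  · intro e he e' he' hc
    exact Finset.mem_filter.2 ⟨Finset.mem_product.2 ⟨he, he'⟩, hc⟩



def AlgHyp (P : Set ℝ) (θ : ℝ → ℝ → ℝ) (Vs : ℝ → Set ℝ) (t : ℕ) : Prop :=
  ∀ s1 ∈ P, ∀ s2 ∈ P, ∀ δ1 δ2 : ℝ, (s1, δ1) ≠ (s2, δ2) → ∃ Z : Finset ℝ, Z.card ≤ t ∧
    ∀ v v' : ℝ, v < v' → v - δ1 ∈ Vs s1 → v' - δ1 ∈ Vs s1 → v - δ2 ∈ Vs s2 → v' - δ2 ∈ Vs s2 →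
      (∀ z ∈ Z, ¬ (v ≤ z ∧ z ≤ v')) →
      θ s1 (v - δ1) - θ s2 (v - δ2) ≠ θ s1 (v' - δ1) - θ s2 (v' - δ2)

lemma count_lt_inj (Z : Finset ℝ) (v v' : ℝ) (h : v < v') (hv' : v' ∉ Z)
    (hc : (Z.filter (fun z => z < v)).card = (Z.filter (fun z => z < v')).card) :
    ∀ z ∈ Z, ¬ (v ≤ z ∧ z ≤ v') := by
  intro z hz ⟨h1, h2⟩
  have : (Z.filter (fun z => z < v)) ⊂ (Z.filter (fun z => z < v')) := by
    rw [Finset.ssubset_iff_of_subset]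
    · refine ⟨z, ?_, ?_⟩
      · rw [Finset.mem_filter]
        exact ⟨hz, lt_of_le_of_ne h2 (fun hh => hv' (hh ▸ hz))⟩
      · rw [Finset.mem_filter]
        push Not
        intro _; exact h1
    · intro y hy
      rw [Finset.mem_filter] at hy ⊢
      exact ⟨hy.1, hy.2.trans h⟩
  have := Finset.card_lt_card this
  omega

lemma core_instance (θ : ℝ → ℝ → ℝ) (Vs : ℝ → Set ℝ) (t : ℕ) (Pf : Finset ℝ)
    (halg : AlgHyp (Pf : Set ℝ) θ Vs t) (hV : ∀ s ∈ Pf, (Vs s).OrdConnected)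
    (hθ : ∀ s ∈ Pf, ContinuousOn (θ s) (Vs s))
    (Df : Finset ℝ) (𝒞 : Finset ((ℝ × ℝ) × ℝ)) (h𝒞 : ∀ q ∈ 𝒞, q.1.2 - q.1.1 ∈ Df ∧ q.2 ∈ Pf)
    (Pt : Finset (ℝ × ℝ)) (I : Finset ((ℝ × ℝ) × ℝ × (ℝ × ℝ)))
    (hI : ∀ q ∈ I, (q.1, q.2.1) ∈ 𝒞 ∧ q.2.2.2 - q.2.2.1 ∈ Vs q.2.1 ∧
      θ q.2.1 (q.2.2.2 - q.2.2.1) = q.2.2.1 ∧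
      ((q.1.2 + q.2.2.2) - (q.1.1 + q.2.2.1), q.1.1 + q.2.2.1) ∈ Pt)
    (r : ℕ) (hr : 0 < r) :
    I.card * r ^ 2 ≤ 𝒞.card * (2 * (t * Df.card * Pf.card) + 1) * r ^ 2 +
      10 * (Nat.log 2 Pt.card + 1) * Pt.card * r ^ 3 + (t + 1) * 𝒞.card ^ 2 := by
  classical
  -- choose the Z sets
  have hZ : ∀ a b : ℝ × ℝ, ∃ Z : Finset ℝ, Z.card ≤ t ∧ (a.1 ∈ Pf → b.1 ∈ Pf → a ≠ b →
      ∀ v v' : ℝ, v < v' → v - a.2 ∈ Vs a.1 → v' - a.2 ∈ Vs a.1 → v - b.2 ∈ Vs b.1 → v' - b.2 ∈ Vs b.1 →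
      (∀ z ∈ Z, ¬ (v ≤ z ∧ z ≤ v')) →
      θ a.1 (v - a.2) - θ b.1 (v - b.2) ≠ θ a.1 (v' - a.2) - θ b.1 (v' - b.2)) := by
    intro a b
    by_cases h : a.1 ∈ Pf ∧ b.1 ∈ Pf ∧ a ≠ b
    · obtain ⟨Z, h1, h2⟩ := halg a.1 h.1 b.1 h.2.1 a.2 b.2 h.2.2
      exact ⟨Z, h1, fun _ _ _ => h2⟩
    · exact ⟨∅, by simp, fun h1 h2 h3 => absurd ⟨h1, h2, h3⟩ h⟩
  choose Z hZc hZ using hZ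
  -- class of a curve
  let cl : (ℝ × ℝ) × ℝ → ℝ × ℝ := fun q => (q.2, q.1.2 - q.1.1)
  let Cut : (ℝ × ℝ) × ℝ → Finset ℝ := fun q => (Pf ×ˢ Df).biUnion (fun a => Z (cl q) a)
  set N := t * Df.card * Pf.card with hN
  have hCut : ∀ q, (Cut q).card ≤ N := by
    intro q
    calc (Cut q).card ≤ ∑ a ∈ Pf ×ˢ Df, (Z (cl q) a).card := Finset.card_biUnion_le
      _ ≤ ∑ a ∈ Pf ×ˢ Df, t := Finset.sum_le_sum (fun a _ => hZc _ _)
      _ = N := by rw [Finset.sum_const, Finset.card_product, smul_eq_mul, hN]; ring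
  have hZCut : ∀ q q', q' ∈ 𝒞 → Z (cl q) (cl q') ⊆ Cut q := by
    intro q q' hq'
    apply Finset.subset_biUnion_of_mem (fun a => Z (cl q) a)
    exact Finset.mem_product.2 ⟨(h𝒞 q' hq').2, (h𝒞 q' hq').1⟩
  let cnt : (ℝ × ℝ) × ℝ → ℝ → ℕ := fun q v => ((Cut q).filter (fun z => z < v)).card
  have hcnt : ∀ q v, cnt q v < N + 1 := fun q v =>
    Nat.lt_succ_of_le ((Finset.card_le_card (Finset.filter_subset _ _)).trans (hCut q))
  -- arcs
  let dom : ((ℝ × ℝ) × ℝ) × ℕ → Set ℝ := fun i => {v | v - (i.1.1.2 - i.1.1.1) ∈ Vs i.1.2 ∧ v ∉ Cut i.1 ∧ cnt i.1 v = i.2}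
  let f : ((ℝ × ℝ) × ℝ) × ℕ → ℝ → ℝ := fun i v => i.1.1.1 + θ i.1.2 (v - (i.1.1.2 - i.1.1.1))
  set S := 𝒞 ×ˢ Finset.range (N + 1) with hS
  have hdd : ∀ i v, v ∈ dom i ↔ v - (i.1.1.2 - i.1.1.1) ∈ Vs i.1.2 ∧ v ∉ Cut i.1 ∧ cnt i.1 v = i.2 :=
    fun i v => Iff.rfl
  -- if two curves meet twice
  have hkey : ∀ q ∈ 𝒞, ∀ q' ∈ 𝒞, q ≠ q' → ∀ v v', v < v' → v - (q.1.2 - q.1.1) ∈ Vs q.2 →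
      v' - (q.1.2 - q.1.1) ∈ Vs q.2 → v - (q'.1.2 - q'.1.1) ∈ Vs q'.2 → v' - (q'.1.2 - q'.1.1) ∈ Vs q'.2 →
      q.1.1 + θ q.2 (v - (q.1.2 - q.1.1)) = q'.1.1 + θ q'.2 (v - (q'.1.2 - q'.1.1)) →
      q.1.1 + θ q.2 (v' - (q.1.2 - q.1.1)) = q'.1.1 + θ q'.2 (v' - (q'.1.2 - q'.1.1)) →
      ¬ (∀ z ∈ Z (cl q) (cl q'), ¬ (v ≤ z ∧ z ≤ v')) := by
    intro q hq q' hq' hne v v' hlt d1 d2 d3 d4 e1 e2 hcon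
    by_cases hcl : cl q = cl q'
    · have a1 : q.2 = q'.2 := congrArg Prod.fst hcl
      have a2 : q.1.2 - q.1.1 = q'.1.2 - q'.1.1 := congrArg Prod.snd hcl
      rw [a1, a2] at e1
      have a3 : q.1.1 = q'.1.1 := by linarith
      have a4 : q.1.2 = q'.1.2 := by linarith
      exact hne (Prod.ext (Prod.ext a3 a4) a1)
    · have := hZ (cl q) (cl q') (h𝒞 q hq).2 (h𝒞 q' hq').2 hcl v v' hlt d1 d2 d3 d4 hcon
      apply this
      simp only [cl]
      linarith
  have hdomO : ∀ i ∈ S, (dom i).OrdConnected := by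
    intro i hi
    have hi1 := (Finset.mem_product.1 hi).1
    refine ⟨fun v hv v' hv' w hw => ?_⟩
    rw [hdd] at hv hv'
    have hmono : ∀ a b, a ≤ b → cnt i.1 a ≤ cnt i.1 b := by
      intro a b hab
      apply Finset.card_le_card
      intro z hz
      rw [Finset.mem_filter] at hz ⊢
      exact ⟨hz.1, lt_of_lt_of_le hz.2 hab⟩
    have c1 := hmono _ _ hw.1
    have c2 := hmono _ _ hw.2
    refine (hdd _ _).2 ⟨?_, ?_, by omega⟩
    · exact (hV _ (h𝒞 _ hi1).2).out hv.1 hv'.1 ⟨by linarith [hw.1], by linarith [hw.2]⟩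
    · intro hwc
      rcases hw.1.lt_or_eq with h | h
      · rcases hw.2.lt_or_eq with h' | h'
        · exact count_lt_inj (Cut i.1) v v' (h.trans h') hv'.2.1
            (by change cnt i.1 v = cnt i.1 v'; omega) w hwc ⟨h.le, h'.le⟩
        · exact hv'.2.1 (h' ▸ hwc)
      · exact hv.2.1 (h ▸ hwc)
  have hfO : ∀ i ∈ S, ContinuousOn (f i) (dom i) := by
    intro i hi
    have hi1 := (Finset.mem_product.1 hi).1
    refine continuousOn_const.add ((hθ _ (h𝒞 _ hi1).2).comp (by fun_prop) ?_)
    intro v hv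
    exact hv.1
  have hone' : ∀ i ∈ S, ∀ j ∈ S, i ≠ j → ∀ x y, x ∈ dom i → x ∈ dom j → y ∈ dom i → y ∈ dom j →
      f i x = f j x → f i y = f j y → ¬ x < y := by
    rintro ⟨q, a⟩ hi ⟨q', a'⟩ hj hij x y xi xj yi yj e1 e2 hlt
    have hi1 := (Finset.mem_product.1 hi).1
    have hj1 := (Finset.mem_product.1 hj).1
    rw [hdd] at xi xj yi yj
    simp only at hi1 hj1 xi xj yi yj
    by_cases hqq : q = q'
    · subst hqq
      apply hij
      rw [← xi.2.2, ← xj.2.2]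
    · apply hkey q hi1 q' hj1 hqq x y hlt xi.1 yi.1 xj.1 yj.1 e1 e2
      intro z hz
      exact count_lt_inj (Cut q) x y hlt yi.2.1 (by change cnt q x = cnt q y; omega) z
        (hZCut q q' hj1 hz)
  let X : Finset ((((ℝ × ℝ) × ℝ) × ℕ) × (((ℝ × ℝ) × ℝ) × ℕ)) := (S ×ˢ S).filter (fun p => p.1.1 ≠ p.2.1 ∧
    ∃ x, x ∈ dom p.1 ∧ x ∈ dom p.2 ∧ f p.1 x = f p.2 x)
  have hXw : ∀ p, ∃ x, p ∈ X → x ∈ dom p.1 ∧ x ∈ dom p.2 ∧ f p.1 x = f p.2 x := by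
    intro p
    by_cases hp : p ∈ X
    · obtain ⟨x, hx⟩ := (Finset.mem_filter.1 hp).2.2
      exact ⟨x, fun _ => hx⟩
    · exact ⟨0, fun h => absurd h hp⟩
  choose xw hxw using hXw
  have hXcard : X.card ≤ (t + 1) * 𝒞.card ^ 2 := by
    have : X.card ≤ ((𝒞 ×ˢ 𝒞) ×ˢ Finset.range (t + 1)).card := by
      refine Finset.card_le_card_of_injOn (fun p => ((p.1.1, p.2.1),
        ((Z (cl p.1.1) (cl p.2.1)).filter (fun z => z < xw p)).card)) ?_ ?_
      · intro p hp
        have hp' := (Finset.mem_filter.1 hp).1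
        have h1 := (Finset.mem_product.1 (Finset.mem_product.1 hp').1).1
        have h2 := (Finset.mem_product.1 (Finset.mem_product.1 hp').2).1
        have h3 : ((Z (cl p.1.1) (cl p.2.1)).filter (fun z => z < xw p)).card < t + 1 :=
          Nat.lt_succ_of_le ((Finset.card_le_card (Finset.filter_subset _ _)).trans (hZc _ _))
        simp only [Finset.coe_product, Finset.coe_range, Set.mem_prod, Finset.mem_coe, Set.mem_Iio]
        exact ⟨⟨h1, h2⟩, h3⟩
      · have main : ∀ p ∈ X, ∀ p' ∈ X, p.1.1 = p'.1.1 → p.2.1 = p'.2.1 →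
            ((Z (cl p.1.1) (cl p.2.1)).filter (fun z => z < xw p)).card =
            ((Z (cl p'.1.1) (cl p'.2.1)).filter (fun z => z < xw p')).card → ¬ xw p < xw p' := by
          intro p hp p' hp' e1 e2 e3 hlt
          have w1 := hxw p hp
          have w2 := hxw p' hp'
          rw [hdd, hdd] at w1 w2
          have m1 := Finset.mem_filter.1 hp
          have q1 := (Finset.mem_product.1 (Finset.mem_product.1 m1.1).1).1
          have q2 := (Finset.mem_product.1 (Finset.mem_product.1 m1.1).2).1
          have w2e := w2.2.2
          simp only [f] at w2e
          rw [← e1, ← e2] at w2 w2e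
          rw [← e1, ← e2] at e3
          apply hkey _ q1 _ q2 m1.2.1 _ _ hlt w1.1.1 w2.1.1 w1.2.1.1 w2.2.1.1 w1.2.2 w2e
          exact count_lt_inj _ _ _ hlt (fun h => w2.1.2.1 (hZCut _ _ q2 h)) e3
        intro p hp p' hp' heq
        simp only [Prod.mk.injEq] at heq
        obtain ⟨⟨e1, e2⟩, e3⟩ := heq
        have hx : xw p = xw p' := le_antisymm
          (not_lt.1 (main p' hp' p hp e1.symm e2.symm e3.symm)) (not_lt.1 (main p hp p' hp' e1 e2 e3))
        have w1 := hxw p hp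
        have w2 := hxw p' hp'
        rw [hdd, hdd] at w1 w2
        have f1 : p.1.2 = p'.1.2 := by rw [← w1.1.2.2, ← w2.1.2.2, hx, e1]
        have f2 : p.2.2 = p'.2.2 := by rw [← w1.2.1.2.2, ← w2.2.1.2.2, hx, e2]
        exact Prod.ext (Prod.ext e1 f1) (Prod.ext e2 f2)
    rw [Finset.card_product, Finset.card_product, Finset.card_range] at this
    calc X.card ≤ _ := this
      _ = (t + 1) * 𝒞.card ^ 2 := by ring
  -- split the tuples
  let lev : (ℝ × ℝ) × ℝ × (ℝ × ℝ) → ℝ := fun q => (q.1.2 + q.2.2.2) - (q.1.1 + q.2.2.1)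
  let I1 := I.filter (fun q => lev q ∈ Cut (q.1, q.2.1))
  let I2 := I.filter (fun q => ¬ lev q ∈ Cut (q.1, q.2.1))
  have hI12 : I1.card + I2.card = I.card := Finset.card_filter_add_card_filter_not _
  -- tuple determined by curve and level
  have hdet : ∀ q ∈ I, ∀ q' ∈ I, (q.1, q.2.1) = (q'.1, q'.2.1) → lev q = lev q' → q = q' := by
    rintro ⟨⟨c, c'⟩, s, ⟨u, w⟩⟩ hq ⟨⟨d, d'⟩, s', ⟨u', w'⟩⟩ hq' he hl
    simp only [Prod.mk.injEq] at he
    obtain ⟨⟨rfl, rfl⟩, rfl⟩ := he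
    have h1 := (hI _ hq).2.2.1
    have h2 := (hI _ hq').2.2.1
    simp only [lev] at h1 h2 hl
    have h3 : w - u = w' - u' := by linarith
    rw [h3, h2] at h1
    subst h1
    have : w = w' := by linarith
    rw [this]
  have hI1 : I1.card ≤ 𝒞.card * N := by
    have hsub : I1.card ≤ (𝒞.sigma (fun q => Cut q)).card := by
      refine Finset.card_le_card_of_injOn (fun q => (⟨(q.1, q.2.1), lev q⟩ : Σ _ : (ℝ × ℝ) × ℝ, ℝ)) ?_ ?_
      · intro q hq
        have := Finset.mem_filter.1 hq
        exact Finset.mem_coe.2 (Finset.mem_sigma.2 ⟨(hI q this.1).1, this.2⟩)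
      · intro q hq q' hq' he
        simp only [Sigma.mk.injEq] at he
        exact hdet q (Finset.mem_filter.1 hq).1 q' (Finset.mem_filter.1 hq').1 he.1 (eq_of_heq he.2)
    rw [Finset.card_sigma] at hsub
    calc I1.card ≤ _ := hsub
      _ ≤ ∑ _q ∈ 𝒞, N := Finset.sum_le_sum (fun q _ => hCut q)
      _ = 𝒞.card * N := by simp
  have hinc : ∀ q, q ∈ I2 → ((q.1, q.2.1), cnt (q.1, q.2.1) (lev q)) ∈ S ∧
      (lev q, q.1.1 + q.2.2.1) ∈ Pt ∧ lev q ∈ dom ((q.1, q.2.1), cnt (q.1, q.2.1) (lev q)) ∧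
      f ((q.1, q.2.1), cnt (q.1, q.2.1) (lev q)) (lev q) = q.1.1 + q.2.2.1 := by
    intro q hq
    have h1 := Finset.mem_filter.1 hq
    obtain ⟨h2, h3, h4, h5⟩ := hI q h1.1
    have h6 : lev q - (q.1.2 - q.1.1) = q.2.2.2 - q.2.2.1 := by simp only [lev]; ring
    refine ⟨?_, h5, ?_, ?_⟩
    · exact Finset.mem_product.2 ⟨h2, Finset.mem_range.2 (hcnt _ _)⟩
    · refine (hdd _ _).2 ⟨?_, h1.2, rfl⟩
      simp only
      rw [h6]; exact h3
    · simp only [f]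
      rw [h6, h4]
  have hST := arcs_ST S dom f hdomO hfO (by
      intro i hi j hj hij x y xi xj yi yj e1 e2
      exact le_antisymm (not_lt.1 (hone' i hi j hj hij y x yi yj xi xj e2 e1))
        (not_lt.1 (hone' i hi j hj hij x y xi xj yi yj e1 e2)))
    Pt X (by
      intro i hi j hj hij x xi xj he
      refine Finset.mem_filter.2 ⟨Finset.mem_product.2 ⟨hi, hj⟩, ?_, x, xi, xj, he⟩
      intro hqq
      apply hij
      have e1 := ((hdd _ _).1 xi).2.2
      have e2 := ((hdd _ _).1 xj).2.2
      refine Prod.ext hqq ?_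
      rw [← e1, ← e2]
      simp only at hqq
      rw [hqq])
    (I2.image (fun q => (((q.1, q.2.1), cnt (q.1, q.2.1) (lev q)), (lev q, q.1.1 + q.2.2.1)))) (by
      intro p hp
      rw [Finset.mem_image] at hp
      obtain ⟨q, hq, rfl⟩ := hp
      exact hinc q hq) r hr
  rw [Finset.card_image_of_injOn] at hST
  · have hSc : S.card = 𝒞.card * (N + 1) := by rw [hS, Finset.card_product, Finset.card_range]
    rw [hSc] at hST
    calc I.card * r ^ 2 = I1.card * r ^ 2 + I2.card * r ^ 2 := by rw [← hI12]; ring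
      _ ≤ (𝒞.card * N) * r ^ 2 + (𝒞.card * (N + 1) * r ^ 2 + 10 * (Nat.log 2 Pt.card + 1) * Pt.card * r ^ 3 + (t + 1) * 𝒞.card ^ 2) := by
        gcongr
        omega
      _ = _ := by ring
  · intro q hq q' hq' he
    simp only [Prod.mk.injEq] at he
    exact hdet q (Finset.mem_filter.1 hq).1 q' (Finset.mem_filter.1 hq').1
      (by rw [Prod.mk.injEq]; exact ⟨he.1.1.1, he.1.1.2⟩) he.2.1


lemma core_points (Y : Finset ℝ) (sub : ℝ → ℕ) (τ b KD KP : ℕ) (hb : 0 < b)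
    (hsub : ∀ h, (Y.filter (fun y => sub y = h)).card ≤ τ)
    (kD : ℝ × ℝ → ℕ) (fP : ℝ → ℕ)
    (I : Finset ((ℝ × ℝ) × ℝ × (ℝ × ℝ)))
    (hk : ∀ q ∈ I, kD q.1 ≤ KD) (hf : ∀ q ∈ I, fP q.2.1 ≤ KP)
    (hkm : ∀ q ∈ I, ∀ q' ∈ I, kD q.1 < kD q'.1 → q.1.1 ≤ q'.1.1)
    (hfm : ∀ q ∈ I, ∀ q' ∈ I, fP q.2.1 < fP q'.2.1 → q.2.1 ≤ q'.2.1)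
    (hxY : ∀ q ∈ I, q.1.1 + q.2.2.1 ∈ Y) (hyY : ∀ q ∈ I, q.1.2 + q.2.2.2 ∈ Y)
    (hblk : ∀ q ∈ I, sub (q.1.1 + q.2.2.1) / b = sub (q.1.1 + q.2.2.2) / b)
    (hs : ∀ q ∈ I, sub (q.1.2 + q.2.2.2) = sub (q.1.1 + q.2.2.2))
    (hmon : ∀ q ∈ I, ∀ q' ∈ I, q.1.1 + q.2.2.1 = q'.1.1 + q'.2.2.1 → q.1.1 ≤ q'.1.1 →
      q'.2.1 ≤ q.2.1 → sub (q.1.1 + q.2.2.2) ≤ sub (q'.1.1 + q'.2.2.2)) :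
    (I.image (fun q => ((kD q.1, fP q.2.1), ((q.1.2 + q.2.2.2) - (q.1.1 + q.2.2.1), q.1.1 + q.2.2.1)))).card
      ≤ Y.card * τ * ((b + KD) * (b + KP)) := by
  classical
  set T := I.image (fun q => ((kD q.1, fP q.2.1), ((q.1.2 + q.2.2.2) - (q.1.1 + q.2.2.1), q.1.1 + q.2.2.1))) with hT
  let g : (ℕ × ℕ) × (ℝ × ℝ) → ℝ × ℕ × ℕ := fun p =>
    (p.2.2, sub (p.2.1 + p.2.2) % b + p.1.1, sub (p.2.1 + p.2.2) % b + (KP - p.1.2))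
  have hval : ∀ q : (ℝ × ℝ) × ℝ × (ℝ × ℝ), (q.1.2 + q.2.2.2) - (q.1.1 + q.2.2.1) + (q.1.1 + q.2.2.1) = q.1.2 + q.2.2.2 := by
    intro q; ring
  have himg : T.image g ⊆ Y ×ˢ (Finset.range (b + KD) ×ˢ Finset.range (b + KP)) := by
    intro z hz
    rw [Finset.mem_image] at hz
    obtain ⟨p, hp, rfl⟩ := hz
    rw [hT, Finset.mem_image] at hp
    obtain ⟨q, hq, rfl⟩ := hp
    have := hk q hq
    have m1 := Nat.mod_lt (sub (q.1.2 + q.2.2.2)) hb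
    simp only [g, Finset.mem_product, Finset.mem_range, hval]
    refine ⟨hxY q hq, by omega, by omega⟩
  have hfib : ∀ z ∈ T.image g, (T.filter (fun p => g p = z)).card ≤ τ := by
    intro z hz
    rw [Finset.mem_image] at hz
    obtain ⟨p0, hp0, rfl⟩ := hz
    -- all elements of the fibre agree in x, k, f, sub y
    have agree : ∀ p ∈ T, ∀ p' ∈ T, g p = g p' → ¬ sub (p.2.1 + p.2.2) < sub (p'.2.1 + p'.2.2) := by
      intro p hp p' hp' hg hlt
      rw [hT, Finset.mem_image] at hp hp'
      obtain ⟨q, hq, rfl⟩ := hp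
      obtain ⟨q', hq', rfl⟩ := hp'
      simp only [g, Prod.mk.injEq, hval] at hg hlt
      obtain ⟨g1, g2, g3⟩ := hg
      have b1 : sub (q.1.2 + q.2.2.2) / b = sub (q'.1.2 + q'.2.2.2) / b := by
        rw [hs q hq, hs q' hq', ← hblk q hq, ← hblk q' hq', g1]
      have b2 := Nat.div_add_mod (sub (q.1.2 + q.2.2.2)) b
      have b3 := Nat.div_add_mod (sub (q'.1.2 + q'.2.2.2)) b
      rw [b1] at b2
      have f1 := hf q hq
      have f2 := hf q' hq'
      have k1 : kD q'.1 < kD q.1 := by omega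
      have k2 : fP q.2.1 < fP q'.2.1 := by omega
      have := hmon q' hq' q hq g1.symm (hkm q' hq' q hq k1) (hfm q hq q' hq' k2)
      rw [← hs q hq, ← hs q' hq'] at this
      omega
    have agree2 : ∀ p ∈ T, g p = g p0 → p.1 = p0.1 ∧ p.2.2 = p0.2.2 ∧
        sub (p.2.1 + p.2.2) = sub (p0.2.1 + p0.2.2) := by
      intro p hp hg
      have e : sub (p.2.1 + p.2.2) = sub (p0.2.1 + p0.2.2) :=
        le_antisymm (not_lt.1 (agree p0 hp0 p hp hg.symm)) (not_lt.1 (agree p hp p0 hp0 hg))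
      simp only [g, Prod.mk.injEq, e] at hg
      have f1 : p.1.2 ≤ KP := by
        rw [hT, Finset.mem_image] at hp
        obtain ⟨q, hq, rfl⟩ := hp
        exact hf q hq
      have f2 : p0.1.2 ≤ KP := by
        rw [hT, Finset.mem_image] at hp0
        obtain ⟨q, hq, rfl⟩ := hp0
        exact hf q hq
      exact ⟨Prod.ext (by omega) (by omega), hg.1, e⟩
    refine le_trans ?_ (hsub (sub (p0.2.1 + p0.2.2)))
    refine Finset.card_le_card_of_injOn (fun p => p.2.1 + p.2.2) ?_ ?_
    · intro p hp
      obtain ⟨h1, h2⟩ := Finset.mem_filter.1 hp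
      have h3 := agree2 p h1 h2
      refine Finset.mem_coe.2 (Finset.mem_filter.2 ⟨?_, h3.2.2⟩)
      rw [hT, Finset.mem_image] at h1
      obtain ⟨q, hq, rfl⟩ := h1
      simp only [hval]
      exact hyY q hq
    · intro p hp p' hp' he
      obtain ⟨h1, h2⟩ := Finset.mem_filter.1 hp
      obtain ⟨h1', h2'⟩ := Finset.mem_filter.1 hp'
      have h3 := agree2 p h1 h2
      have h3' := agree2 p' h1' h2'
      simp only at he
      have e2 : p.2.2 = p'.2.2 := h3.2.1.trans h3'.2.1.symm
      exact Prod.ext (h3.1.trans h3'.1.symm) (Prod.ext (by linarith) e2)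
  calc T.card ≤ τ * (T.image g).card := Finset.card_le_mul_card_image T τ hfib
    _ ≤ τ * (Y ×ˢ (Finset.range (b + KD) ×ˢ Finset.range (b + KP))).card :=
        Nat.mul_le_mul_left _ (Finset.card_le_card himg)
    _ = _ := by
      rw [Finset.card_product, Finset.card_product, Finset.card_range, Finset.card_range]; ring

theorem core (Y : Finset ℝ) (sub : ℝ → ℕ) (τ b KD KP τD τP t : ℕ) (hb : 0 < b)
    (hsub : ∀ h, (Y.filter (fun y => sub y = h)).card ≤ τ)
    (θ : ℝ → ℝ → ℝ) (Vs : ℝ → Set ℝ) (P : Finset ℝ)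
    (halg : AlgHyp (P : Set ℝ) θ Vs t) (hV : ∀ s ∈ P, (Vs s).OrdConnected)
    (hθ : ∀ s ∈ P, ContinuousOn (θ s) (Vs s))
    (𝒟 : Finset (ℝ × ℝ)) (Df : Finset ℝ) (hDf : ∀ p ∈ 𝒟, p.2 - p.1 ∈ Df)
    (kD : ℝ × ℝ → ℕ) (hkD : ∀ k, (𝒟.filter (fun p => kD p = k)).card ≤ τD)
    (hkD2 : ∀ p ∈ 𝒟, kD p ≤ KD) (hkD3 : ∀ p ∈ 𝒟, ∀ q ∈ 𝒟, kD p < kD q → p.1 ≤ q.1)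
    (fP : ℝ → ℕ) (hfP : ∀ k, (P.filter (fun p => fP p = k)).card ≤ τP)
    (hfP2 : ∀ p ∈ P, fP p ≤ KP) (hfP3 : ∀ p ∈ P, ∀ q ∈ P, fP p < fP q → p ≤ q)
    (I : Finset ((ℝ × ℝ) × ℝ × (ℝ × ℝ)))
    (hI𝒟 : ∀ q ∈ I, q.1 ∈ 𝒟) (hIP : ∀ q ∈ I, q.2.1 ∈ P)
    (hIV : ∀ q ∈ I, q.2.2.2 - q.2.2.1 ∈ Vs q.2.1)
    (hIθ : ∀ q ∈ I, θ q.2.1 (q.2.2.2 - q.2.2.1) = q.2.2.1)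
    (hxY : ∀ q ∈ I, q.1.1 + q.2.2.1 ∈ Y) (hyY : ∀ q ∈ I, q.1.2 + q.2.2.2 ∈ Y)
    (hblk : ∀ q ∈ I, sub (q.1.1 + q.2.2.1) / b = sub (q.1.1 + q.2.2.2) / b)
    (hs : ∀ q ∈ I, sub (q.1.2 + q.2.2.2) = sub (q.1.1 + q.2.2.2))
    (hmon : ∀ q ∈ I, ∀ q' ∈ I, q.1.1 + q.2.2.1 = q'.1.1 + q'.2.2.1 → q.1.1 ≤ q'.1.1 →
      q'.2.1 ≤ q.2.1 → sub (q.1.1 + q.2.2.2) ≤ sub (q'.1.1 + q'.2.2.2))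
    (r : ℕ) (hr : 0 < r) :
    I.card * r ^ 2 ≤ 𝒟.card * P.card * (2 * (t * Df.card * τP) + 1) * r ^ 2 +
      10 * (Nat.log 2 (Y.card ^ 2) + 1) * (Y.card * τ * ((b + KD) * (b + KP))) * r ^ 3
      + (t + 1) * (τD * τP * (𝒟.card * P.card)) := by
  classical
  set R := Finset.range (KD + 1) ×ˢ Finset.range (KP + 1) with hR
  let pt : (ℝ × ℝ) × ℝ × (ℝ × ℝ) → ℝ × ℝ := fun q => ((q.1.2 + q.2.2.2) - (q.1.1 + q.2.2.1), q.1.1 + q.2.2.1)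
  let Ii : ℕ × ℕ → Finset ((ℝ × ℝ) × ℝ × (ℝ × ℝ)) := fun m => I.filter (fun q => (kD q.1, fP q.2.1) = m)
  let Pp : ℕ → Finset ℝ := fun k => P.filter (fun p => fP p = k)
  let Dd : ℕ → Finset (ℝ × ℝ) := fun k => 𝒟.filter (fun p => kD p = k)
  let Pt : ℕ × ℕ → Finset (ℝ × ℝ) := fun m => (Ii m).image pt
  have hmapR : ∀ q ∈ I, (kD q.1, fP q.2.1) ∈ R := by
    intro q hq
    have := hkD2 _ (hI𝒟 q hq)
    have := hfP2 _ (hIP q hq)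
    simp only [hR, Finset.mem_product, Finset.mem_range]
    omega
  have hcardI : I.card = ∑ m ∈ R, (Ii m).card := Finset.card_eq_sum_card_fiberwise (fun q hq => hmapR q hq)
  have hinst : ∀ m ∈ R, (Ii m).card * r ^ 2 ≤ (Dd m.1).card * (Pp m.2).card * (2 * (t * Df.card * τP) + 1) * r ^ 2 +
      10 * (Nat.log 2 (Y.card ^ 2) + 1) * (Pt m).card * r ^ 3 + (t + 1) * (τD * τP * ((Dd m.1).card * (Pp m.2).card)) := by
    intro m _
    have hc := core_instance θ Vs t (Pp m.2)
      (by
        intro s1 h1 s2 h2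
        exact halg s1 (Finset.mem_filter.1 h1).1 s2 (Finset.mem_filter.1 h2).1)
      (fun s hs => hV s (Finset.mem_filter.1 hs).1) (fun s hs => hθ s (Finset.mem_filter.1 hs).1)
      Df (Dd m.1 ×ˢ Pp m.2)
      (by
        intro q hq
        obtain ⟨h1, h2⟩ := Finset.mem_product.1 hq
        exact ⟨hDf _ (Finset.mem_filter.1 h1).1, h2⟩)
      (Pt m) (Ii m)
      (by
        intro q hq
        obtain ⟨h1, h2⟩ := Finset.mem_filter.1 hq
        refine ⟨Finset.mem_product.2 ⟨Finset.mem_filter.2 ⟨hI𝒟 q h1, ?_⟩, Finset.mem_filter.2 ⟨hIP q h1, ?_⟩⟩,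
          hIV q h1, hIθ q h1, Finset.mem_image_of_mem pt hq⟩
        · rw [← h2]
        · rw [← h2]) r hr
    rw [Finset.card_product] at hc
    have p1 : (Pp m.2).card ≤ τP := hfP _
    have p2 : (Dd m.1).card ≤ τD := hkD _
    have p3 : (Pt m).card ≤ Y.card ^ 2 := by
      have : (Pt m).card ≤ (Y ×ˢ Y).card := by
        refine Finset.card_le_card_of_injOn (fun p => (p.2, p.1 + p.2)) ?_ ?_
        · intro p hp
          simp only [Pt, Finset.coe_image, Set.mem_image, Finset.mem_coe] at hp
          obtain ⟨q, hq, rfl⟩ := hp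
          have hq1 := (Finset.mem_filter.1 hq).1
          simp only [Finset.coe_product, Set.mem_prod, Finset.mem_coe, pt]
          refine ⟨hxY q hq1, ?_⟩
          have := hyY q hq1
          convert this using 1
          ring
        · intro p _ p' _ he
          simp only [Prod.mk.injEq] at he
          exact Prod.ext (by linarith [he.1, he.2]) he.1
      rw [Finset.card_product] at this
      rw [pow_two]; exact this
    have p4 : Nat.log 2 (Pt m).card ≤ Nat.log 2 (Y.card ^ 2) := Nat.log_mono_right p3
    refine hc.trans ?_
    have e1 : (Dd m.1).card * (Pp m.2).card * (2 * (t * Df.card * (Pp m.2).card) + 1) * r ^ 2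
      ≤ (Dd m.1).card * (Pp m.2).card * (2 * (t * Df.card * τP) + 1) * r ^ 2 := by gcongr
    have e2 : 10 * (Nat.log 2 (Pt m).card + 1) * (Pt m).card * r ^ 3
      ≤ 10 * (Nat.log 2 (Y.card ^ 2) + 1) * (Pt m).card * r ^ 3 := by gcongr
    have e3 : (t + 1) * ((Dd m.1).card * (Pp m.2).card) ^ 2 ≤ (t + 1) * (τD * τP * ((Dd m.1).card * (Pp m.2).card)) := by
      rw [pow_two]; gcongr
    omega
  have hDP : ∑ m ∈ R, (Dd m.1).card * (Pp m.2).card = 𝒟.card * P.card := by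
    rw [hR, Finset.sum_product]
    simp only
    rw [← Finset.sum_mul_sum]
    congr 1
    · exact (Finset.card_eq_sum_card_fiberwise (fun p hp => by
        simpa using Nat.lt_succ_of_le (hkD2 p hp))).symm
    · exact (Finset.card_eq_sum_card_fiberwise (fun p hp => by
        simpa using Nat.lt_succ_of_le (hfP2 p hp))).symm
  have hPt : ∑ m ∈ R, (Pt m).card ≤ Y.card * τ * ((b + KD) * (b + KP)) := by
    refine le_trans (le_of_eq ?_) (core_points Y sub τ b KD KP hb hsub kD fP I
      (fun q hq => hkD2 _ (hI𝒟 q hq)) (fun q hq => hfP2 _ (hIP q hq))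
      (fun q hq q' hq' => hkD3 _ (hI𝒟 q hq) _ (hI𝒟 q' hq'))
      (fun q hq q' hq' => hfP3 _ (hIP q hq) _ (hIP q' hq')) hxY hyY hblk hs hmon)
    rw [Finset.card_eq_sum_card_fiberwise (t := R) (f := Prod.fst)]
    · apply Finset.sum_congr rfl
      intro m _
      have : (I.image (fun q => ((kD q.1, fP q.2.1), ((q.1.2 + q.2.2.2) - (q.1.1 + q.2.2.1), q.1.1 + q.2.2.1)))).filter
          (fun p => p.1 = m) = (Pt m).image (fun p => (m, p)) := by
        ext z
        simp only [Finset.mem_filter, Finset.mem_image, Pt, Ii, pt]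
        constructor
        · rintro ⟨⟨q, hq, rfl⟩, rfl⟩
          exact ⟨_, ⟨q, ⟨hq, rfl⟩, rfl⟩, rfl⟩
        · rintro ⟨_, ⟨q, ⟨hq, rfl⟩, rfl⟩, rfl⟩
          exact ⟨⟨q, hq, rfl⟩, rfl⟩
      rw [this]
      exact (Finset.card_image_of_injective _ (fun a b hab => (Prod.mk.inj hab).2)).symm
    · intro z hz
      rw [Finset.mem_coe, Finset.mem_image] at hz
      obtain ⟨q, hq, rfl⟩ := hz
      exact hmapR q hq
  calc I.card * r ^ 2 = ∑ m ∈ R, (Ii m).card * r ^ 2 := by rw [hcardI, Finset.sum_mul]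
    _ ≤ ∑ m ∈ R, ((Dd m.1).card * (Pp m.2).card * (2 * (t * Df.card * τP) + 1) * r ^ 2 +
      10 * (Nat.log 2 (Y.card ^ 2) + 1) * (Pt m).card * r ^ 3 + (t + 1) * (τD * τP * ((Dd m.1).card * (Pp m.2).card))) :=
        Finset.sum_le_sum hinst
    _ = (∑ m ∈ R, (Dd m.1).card * (Pp m.2).card) * (2 * (t * Df.card * τP) + 1) * r ^ 2 +
      10 * (Nat.log 2 (Y.card ^ 2) + 1) * (∑ m ∈ R, (Pt m).card) * r ^ 3 +
      (t + 1) * (τD * τP * (∑ m ∈ R, (Dd m.1).card * (Pp m.2).card)) := by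
        rw [Finset.sum_add_distrib, Finset.sum_add_distrib]
        simp only [Finset.sum_mul, Finset.mul_sum]
    _ ≤ _ := by rw [hDP]; gcongr


/-! ### Part 3: ranks, blocks and the tuple lemma -/

/-- rank -/
def rk {α : Type*} [LinearOrder α] (Y : Finset α) (y : α) : ℕ := (Y.filter (fun z => z < y)).card

lemma rk_le {α : Type*} [LinearOrder α] (Y : Finset α) (y : α) : rk Y y ≤ Y.card :=
  Finset.card_le_card (Finset.filter_subset _ _)

lemma rk_mono {α : Type*} [LinearOrder α] (Y : Finset α) {y y' : α} (h : y ≤ y') : rk Y y ≤ rk Y y' := by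
  apply Finset.card_le_card
  intro z hz
  rw [Finset.mem_filter] at hz ⊢
  exact ⟨hz.1, lt_of_lt_of_le hz.2 h⟩

lemma rk_lt {α : Type*} [LinearOrder α] (Y : Finset α) {y y' : α} (hy : y ∈ Y) (h : y < y') :
    rk Y y < rk Y y' := by
  apply Finset.card_lt_card
  rw [Finset.ssubset_iff_of_subset]
  · exact ⟨y, by simp [hy, h], by simp⟩
  · intro z hz
    rw [Finset.mem_filter] at hz ⊢
    exact ⟨hz.1, hz.2.trans h⟩

lemma rk_block_card {α : Type*} [LinearOrder α] (Y : Finset α) (τ : ℕ) (hτ : 0 < τ) (h : ℕ) :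
    (Y.filter (fun y => rk Y y / τ = h)).card ≤ τ := by
  have : (Y.filter (fun y => rk Y y / τ = h)).card ≤ (Finset.Ico (h * τ) (h * τ + τ)).card := by
    refine Finset.card_le_card_of_injOn (rk Y) ?_ ?_
    · intro y hy
      have h1 := (Finset.mem_filter.1 hy).2
      rw [Nat.div_eq_iff hτ] at h1
      simp only [Finset.coe_Ico, Set.mem_Ico]
      omega
    · intro y hy y' hy' he
      have m1 := (Finset.mem_filter.1 hy).1
      have m2 := (Finset.mem_filter.1 hy').1
      rcases lt_trichotomy y y' with hlt | heq | hlt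
      · have := rk_lt Y m1 hlt
        omega
      · exact heq
      · have := rk_lt Y m2 hlt
        omega
  simpa using this

lemma lt_of_rk_div_lt {α : Type*} [LinearOrder α] (Y : Finset α) (τ : ℕ) {y y' : α}
    (h : rk Y y / τ < rk Y y' / τ) : y < y' := by
  by_contra hc
  push Not at hc
  have := Nat.div_le_div_right (c := τ) (rk_mono Y hc)
  omega

/-- split lemma: number of nonconstant blocks -/
lemma split_blocks (T : Finset ℝ) (tb : ℝ → ℕ) (htb : ∀ t ∈ T, ∀ t' ∈ T, tb t < tb t' → t ≤ t')
    (F : ℝ → ℕ) (hF : ∀ t ∈ T, ∀ t' ∈ T, t ≤ t' → F t ≤ F t') (B : ℕ) (hB : ∀ t ∈ T, F t ≤ B)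
    (S : Finset ℕ) (hS : ∀ i ∈ S, ∃ t ∈ T, ∃ t' ∈ T, tb t = i ∧ tb t' = i ∧ F t ≠ F t') :
    S.card ≤ B := by
  classical
  have hS' : ∀ i, ∃ q : ℝ × ℝ, i ∈ S → q.1 ∈ T ∧ q.2 ∈ T ∧ tb q.1 = i ∧ tb q.2 = i ∧ F q.1 < F q.2 := by
    intro i
    by_cases hi : i ∈ S
    · obtain ⟨t, ht, t', ht', h1, h2, h3⟩ := hS i hi
      rcases lt_or_gt_of_ne h3 with h | h
      · exact ⟨(t, t'), fun _ => ⟨ht, ht', h1, h2, h⟩⟩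
      · exact ⟨(t', t), fun _ => ⟨ht', ht, h2, h1, h⟩⟩
    · exact ⟨0, fun h => absurd h hi⟩
  choose q hq using hS'
  have : S.card ≤ (Finset.Icc 1 B).card := by
    refine Finset.card_le_card_of_injOn (fun i => F (q i).2) ?_ ?_
    · intro i hi
      have := hq i hi
      have := hB _ this.2.1
      simp only [Finset.coe_Icc, Set.mem_Icc]
      omega
    · have main : ∀ i ∈ S, ∀ j ∈ S, i < j → F (q i).2 < F (q j).2 := by
        intro i hi j hj hij
        have a := hq i hi
        have b := hq j hj
        have := hF _ a.2.1 _ b.1 (htb _ a.2.1 _ b.1 (by omega))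
        omega
      intro i hi j hj he
      simp only at he
      rcases lt_trichotomy i j with h | h | h
      · have := main i hi j hj h
        omega
      · exact h
      · have := main j hj i hi h
        omega
  simpa using this

/-- Good functions -/
structure Good (D : Set ℝ) (e : ℝ → ℝ) (k : ℕ) : Prop where
  smono : StrictMonoOn e D
  ord : D.OrdConnected
  incr : ∀ t t' s : ℝ, 0 < s → t ≤ t' → t - s ∈ D → t' ∈ D → e t - e (t - s) ≤ e t' - e (t' - s)
  alg : ∃ (θ : ℝ → ℝ → ℝ) (Vs : ℝ → Set ℝ), AlgHyp (Set.Ioi 0) θ Vs k ∧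
    (∀ s, 0 < s → (Vs s).OrdConnected ∧ ContinuousOn (θ s) (Vs s)) ∧
    (∀ s t, 0 < s → t ∈ D → t - s ∈ D → e (t - s) - e t ∈ Vs s ∧ θ s (e (t - s) - e t) = e t)

open Classical in
/-- points of `T` in good blocks -/
noncomputable def TStar (T C Y : Finset ℝ) (e : ℝ → ℝ) (M N G : ℕ) : Finset ℝ :=
  T.filter (fun t => 64 * G * (C.filter (fun c => ∃ t1 ∈ T, ∃ t2 ∈ T, rk T t1 / M = rk T t / M ∧
    rk T t2 / M = rk T t / M ∧ rk Y (e t1 + c) / N ≠ rk Y (e t2 + c) / N)).card ≤ C.card)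

lemma TStar_card (D : Set ℝ) (e : ℝ → ℝ) (he : StrictMonoOn e D) (T C Y : Finset ℝ) (hT : ∀ t ∈ T, t ∈ D)
    (M N G : ℕ) (hM : 0 < M) (hN : 0 < N) (hC : 0 < C.card)
    (h : 256 * G * Y.card * M ≤ T.card * N) : 3 * T.card ≤ 4 * (TStar T C Y e M N G).card := by
  classical
  let ns : ℕ → ℝ → Prop := fun i c => ∃ t1 ∈ T, ∃ t2 ∈ T, rk T t1 / M = i ∧
    rk T t2 / M = i ∧ rk Y (e t1 + c) / N ≠ rk Y (e t2 + c) / N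
  let idx := T.image (fun t => rk T t / M)
  let bad := idx.filter (fun i => C.card < 64 * G * (C.filter (fun c => ns i c)).card)
  -- double count
  have h1 : ∑ i ∈ idx, (C.filter (fun c => ns i c)).card ≤ C.card * (Y.card / N) := by
    have : ∑ i ∈ idx, (C.filter (fun c => ns i c)).card = ∑ c ∈ C, (idx.filter (fun i => ns i c)).card := by
      simp only [Finset.card_filter]
      rw [Finset.sum_comm]
    rw [this, ← smul_eq_mul, ← Finset.sum_const]
    apply Finset.sum_le_sum
    intro c _
    refine split_blocks T (fun t => rk T t / M) (fun t _ t' _ hlt => (lt_of_rk_div_lt T M hlt).le)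
      (fun t => rk Y (e t + c) / N) ?_ (Y.card / N) (fun t _ => Nat.div_le_div_right (rk_le _ _)) _ ?_
    · intro t ht t' ht' hle
      apply Nat.div_le_div_right
      apply rk_mono
      have := (he.le_iff_le (hT t ht) (hT t' ht')).2 hle
      linarith
    · intro i hi
      obtain ⟨t1, m1, t2, m2, e1, e2, e3⟩ := (Finset.mem_filter.1 hi).2
      exact ⟨t1, m1, t2, m2, e1, e2, e3⟩
  have h2 : bad.card * C.card ≤ 64 * G * (C.card * (Y.card / N)) := by
    calc bad.card * C.card = ∑ _i ∈ bad, C.card := by simp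
      _ ≤ ∑ i ∈ bad, 64 * G * (C.filter (fun c => ns i c)).card :=
          Finset.sum_le_sum (fun i hi => (Finset.mem_filter.1 hi).2.le)
      _ ≤ ∑ i ∈ idx, 64 * G * (C.filter (fun c => ns i c)).card :=
          Finset.sum_le_sum_of_subset (Finset.filter_subset _ _)
      _ = 64 * G * ∑ i ∈ idx, (C.filter (fun c => ns i c)).card := by rw [Finset.mul_sum]
      _ ≤ _ := Nat.mul_le_mul_left _ h1
  have h3 : bad.card ≤ 64 * G * (Y.card / N) := by
    have : bad.card * C.card ≤ (64 * G * (Y.card / N)) * C.card := by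
      calc _ ≤ _ := h2
        _ = _ := by ring
    exact Nat.le_of_mul_le_mul_right this hC
  have hTs : TStar T C Y e M N G = T.filter (fun t => 64 * G * (C.filter (fun c => ns (rk T t / M) c)).card ≤ C.card) := by
    unfold TStar
    apply Finset.filter_congr
    intro t _
    have : (C.filter (fun c => ns (rk T t / M) c)) = C.filter (fun c => ∃ t1 ∈ T, ∃ t2 ∈ T, rk T t1 / M = rk T t / M ∧
      rk T t2 / M = rk T t / M ∧ rk Y (e t1 + c) / N ≠ rk Y (e t2 + c) / N) := by
      apply Finset.filter_congr
      intro c _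
      rfl
    rw [this]
  have h4 := Finset.card_filter_add_card_filter_not (s := T) (fun t => 64 * G * (C.filter (fun c => ns (rk T t / M) c)).card ≤ C.card)
  rw [← hTs] at h4
  have h5 : (T.filter (fun t => ¬ 64 * G * (C.filter (fun c => ns (rk T t / M) c)).card ≤ C.card)).card ≤ M * bad.card := by
    refine Finset.card_le_mul_card_image_of_maps_to (f := fun t => rk T t / M) ?_ M ?_
    · intro t ht
      obtain ⟨m1, m2⟩ := Finset.mem_filter.1 ht
      exact Finset.mem_filter.2 ⟨Finset.mem_image_of_mem _ m1, not_le.1 m2⟩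
    · intro i _
      refine le_trans (Finset.card_le_card ?_) (rk_block_card T M hM i)
      intro t ht
      obtain ⟨m1, m2⟩ := Finset.mem_filter.1 ht
      exact Finset.mem_filter.2 ⟨(Finset.mem_filter.1 m1).1, m2⟩
  have h6 : (4 * (M * bad.card)) * N ≤ T.card * N := by
    calc (4 * (M * bad.card)) * N ≤ (4 * (M * (64 * G * (Y.card / N)))) * N := by gcongr
      _ = 256 * G * M * ((Y.card / N) * N) := by ring
      _ ≤ 256 * G * M * Y.card := Nat.mul_le_mul_left _ (Nat.div_mul_le_self _ _)
      _ = 256 * G * Y.card * M := by ring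
      _ ≤ _ := h
  have h7 := Nat.le_of_mul_le_mul_right h6 hN
  omega

theorem HT_main (D : Set ℝ) (e : ℝ → ℝ) (t : ℕ) (hg : Good D e t) (T C Y : Finset ℝ)
    (hT : ∀ t ∈ T, t ∈ D) (hY : ∀ t ∈ T, ∀ c ∈ C, e t + c ∈ Y) (M κ τ b G : ℕ) (hκ0 : 0 < κ) (hτ : 0 < τ) (hb : 0 < b)
    (hκ : 64 * G * κ * Y.card ≤ C.card * τ) (hGpos : 0 < G)
    (P : Finset ℝ) (hP : ∀ s ∈ P, 0 < s)
    (Q : Finset (ℝ × ℝ)) (hQ : ∀ q ∈ Q, q.1 ∈ TStar T C Y e M (τ * b) G ∧ q.2 ∈ T ∧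
      rk T q.2 / M = rk T q.1 / M ∧ q.1 - q.2 ∈ P)
    (𝒟 : Finset (ℝ × ℝ)) (h𝒟 : ∀ p ∈ 𝒟, p.1 ∈ C ∧ p.2 ∈ C ∧ rk C p.2 / κ = rk C p.1 / κ)
    (h𝒟c : κ * C.card ≤ 4 * G * 𝒟.card) (Df : Finset ℝ) (hDf : ∀ p ∈ 𝒟, p.2 - p.1 ∈ Df) :
    ∃ (𝒟' : Finset (ℝ × ℝ)) (Δ : ℕ), 𝒟' ⊆ 𝒟 ∧ 𝒟.card ≤ 2 * 𝒟'.card ∧ Δ ≤ Df.card ∧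
      Δ * T.card ≤ 2 * Y.card * τ ∧ ∀ τD τP r : ℕ, 0 < τD → 0 < τP → 0 < r →
      𝒟'.card * Q.card * r ^ 2 ≤ 2 * (𝒟'.card * P.card * (2 * (t * Δ * τP) + 1) * r ^ 2 +
        10 * (Nat.log 2 (Y.card ^ 2) + 1) * (Y.card * τ * ((b + 𝒟'.card / τD) * (b + P.card / τP))) * r ^ 3
        + (t + 1) * (τD * τP * (𝒟'.card * P.card))) := by
  classical
  obtain ⟨θ, Vs, halg, hVθ, hθe⟩ := hg.alg
  -- split predicate
  let sp : ℝ → ℝ → Prop := fun t' c => ∃ c1 ∈ C, rk C c1 / κ = rk C c / κ ∧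
    rk Y (e t' + c1) / τ ≠ rk Y (e t' + c) / τ
  have hsp : ∀ t' ∈ T, 64 * G * (C.filter (fun c => sp t' c)).card ≤ C.card := by
    intro t' _
    let bl := (C.filter (fun c => sp t' c)).image (fun c => rk C c / κ)
    have h1 : bl.card ≤ Y.card / τ := by
      refine split_blocks C (fun c => rk C c / κ) (fun c _ c' _ hlt => (lt_of_rk_div_lt C κ hlt).le)
        (fun c => rk Y (e t' + c) / τ) ?_ (Y.card / τ) (fun t _ => Nat.div_le_div_right (rk_le _ _)) _ ?_
      · intro c _ c' _ hle
        exact Nat.div_le_div_right (rk_mono _ (by linarith))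
      · intro i hi
        rw [Finset.mem_image] at hi
        obtain ⟨c, hc, rfl⟩ := hi
        obtain ⟨hc1, c1, hc2, h3, h4⟩ := Finset.mem_filter.1 hc
        exact ⟨c1, hc2, c, hc1, h3, rfl, h4⟩
    have h2 : (C.filter (fun c => sp t' c)).card ≤ κ * bl.card := by
      refine Finset.card_le_mul_card_image _ κ ?_
      intro i _
      refine le_trans (Finset.card_le_card ?_) (rk_block_card C κ hκ0 i)
      intro c hc
      obtain ⟨m1, m2⟩ := Finset.mem_filter.1 hc
      exact Finset.mem_filter.2 ⟨(Finset.mem_filter.1 m1).1, m2⟩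
    have h3 : (64 * G * (C.filter (fun c => sp t' c)).card) * τ ≤ C.card * τ := by
      calc (64 * G * (C.filter (fun c => sp t' c)).card) * τ ≤ (64 * G * (κ * (Y.card / τ))) * τ := by
            have := h2.trans (Nat.mul_le_mul_left κ h1)
            gcongr
        _ = 64 * G * κ * (Y.card / τ * τ) := by ring
        _ ≤ 64 * G * κ * Y.card := Nat.mul_le_mul_left _ (Nat.div_mul_le_self _ _)
        _ ≤ _ := hκ
    exact Nat.le_of_mul_le_mul_right h3 hτ
  -- lost pairs
  let bs : ℝ × ℝ → ℝ → Prop := fun q c => rk Y (e q.1 + c) / τ / b ≠ rk Y (e q.2 + c) / τ / b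
  have hTsub : ∀ q ∈ Q, q.1 ∈ T := fun q hq => (Finset.mem_filter.1 (hQ q hq).1).1
  have hbs : ∀ q ∈ Q, 64 * G * (C.filter (fun c => bs q c)).card ≤ C.card := by
    intro q hq
    obtain ⟨h1, h2, h3, h4⟩ := hQ q hq
    have h5 := (Finset.mem_filter.1 h1).2
    refine le_trans (Nat.mul_le_mul_left _ (Finset.card_le_card ?_)) h5
    intro c hc
    obtain ⟨m1, m2⟩ := Finset.mem_filter.1 hc
    refine Finset.mem_filter.2 ⟨m1, q.1, hTsub q hq, q.2, h2, rfl, h3, ?_⟩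
    rw [← Nat.div_div_eq_div_mul, ← Nat.div_div_eq_div_mul]
    exact m2
  let lost : ℝ → Finset (ℝ × ℝ) := fun c => Q.filter (fun q => bs q c ∨ sp q.2 c)
  have hlost : 32 * G * ∑ c ∈ C, (lost c).card ≤ Q.card * C.card := by
    have : ∑ c ∈ C, (lost c).card = ∑ q ∈ Q, (C.filter (fun c => bs q c ∨ sp q.2 c)).card := by
      simp only [lost, Finset.card_filter]
      rw [Finset.sum_comm]
    rw [this, Finset.mul_sum, ← smul_eq_mul (a := Q.card), ← Finset.sum_const]
    apply Finset.sum_le_sum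
    intro q hq
    have h1 := hbs q hq
    have h2 := hsp q.2 (hQ q hq).2.1
    have h3 : (C.filter (fun c => bs q c ∨ sp q.2 c)).card ≤ (C.filter (fun c => bs q c)).card + (C.filter (fun c => sp q.2 c)).card := by
      rw [Finset.filter_or]; exact Finset.card_union_le _ _
    have h4 : 32 * G * (C.filter (fun c => bs q c ∨ sp q.2 c)).card ≤ 32 * G * ((C.filter (fun c => bs q c)).card + (C.filter (fun c => sp q.2 c)).card) :=
      Nat.mul_le_mul_left _ h3
    have h5 : 2 * (32 * G * ((C.filter (fun c => bs q c)).card + (C.filter (fun c => sp q.2 c)).card)) =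
      64 * G * (C.filter (fun c => bs q c)).card + 64 * G * (C.filter (fun c => sp q.2 c)).card := by ring
    omega
  have hspl : 64 * G * ∑ c ∈ C, (T.filter (fun t' => sp t' c)).card ≤ T.card * C.card := by
    have : ∑ c ∈ C, (T.filter (fun t' => sp t' c)).card = ∑ t' ∈ T, (C.filter (fun c => sp t' c)).card := by
      simp only [Finset.card_filter]
      rw [Finset.sum_comm]
    rw [this, Finset.mul_sum, ← smul_eq_mul (a := T.card), ← Finset.sum_const]
    exact Finset.sum_le_sum (fun t' ht' => hsp t' ht')
  have markov : ∀ (g : ℝ → ℕ) (m A : ℕ), A * ∑ c ∈ C, g c ≤ m * C.card →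
      A * (C.filter (fun c => m < 2 * g c)).card ≤ 2 * C.card := by
    intro g m A h
    rcases Nat.eq_zero_or_pos m with h0 | h0
    · subst h0
      rw [zero_mul, Nat.le_zero, mul_eq_zero] at h
      rcases h with h | h
      · simp [h]
      · have : C.filter (fun c => 0 < 2 * g c) = ∅ := by
          rw [Finset.filter_eq_empty_iff]
          intro c hc
          rw [Finset.sum_eq_zero_iff] at h
          simp [h c hc]
        rw [this]; simp
    · have h1 : (C.filter (fun c => m < 2 * g c)).card * m ≤ 2 * ∑ c ∈ C, g c := by
        calc _ = ∑ _c ∈ C.filter (fun c => m < 2 * g c), m := by simp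
          _ ≤ ∑ c ∈ C.filter (fun c => m < 2 * g c), 2 * g c := Finset.sum_le_sum (fun c hc => (Finset.mem_filter.1 hc).2.le)
          _ ≤ ∑ c ∈ C, 2 * g c := Finset.sum_le_sum_of_subset (Finset.filter_subset _ _)
          _ = _ := by rw [Finset.mul_sum]
      have h2 : (A * (C.filter (fun c => m < 2 * g c)).card) * m ≤ (2 * C.card) * m := by
        calc _ = A * ((C.filter (fun c => m < 2 * g c)).card * m) := by ring
          _ ≤ A * (2 * ∑ c ∈ C, g c) := Nat.mul_le_mul_left _ h1
          _ = 2 * (A * ∑ c ∈ C, g c) := by ring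
          _ ≤ 2 * (m * C.card) := Nat.mul_le_mul_left _ h
          _ = _ := by ring
      exact Nat.le_of_mul_le_mul_right h2 h0
  have hb1 := markov (fun c => (lost c).card) Q.card (32 * G) hlost
  have hb2 := markov (fun c => (T.filter (fun t' => sp t' c)).card) T.card (64 * G) hspl
  let bad : ℝ → Prop := fun c => Q.card < 2 * (lost c).card ∨ T.card < 2 * (T.filter (fun t' => sp t' c)).card
  have hbad : 32 * G * (C.filter bad).card ≤ 3 * C.card := by
    have h3 : (C.filter bad).card ≤ (C.filter (fun c => Q.card < 2 * (lost c).card)).card +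
        (C.filter (fun c => T.card < 2 * (T.filter (fun t' => sp t' c)).card)).card := by
      have : C.filter bad = C.filter (fun c => Q.card < 2 * (lost c).card ∨ T.card < 2 * (T.filter (fun t' => sp t' c)).card) := by
        apply Finset.filter_congr; intro c _; rfl
      rw [this, Finset.filter_or]; exact Finset.card_union_le _ _
    have h4 := Nat.mul_le_mul_left (64 * G) h3
    have h5 : 64 * G * ((C.filter (fun c => Q.card < 2 * (lost c).card)).card +
        (C.filter (fun c => T.card < 2 * (T.filter (fun t' => sp t' c)).card)).card) =
        2 * (32 * G * (C.filter (fun c => Q.card < 2 * (lost c).card)).card) +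
        64 * G * (C.filter (fun c => T.card < 2 * (T.filter (fun t' => sp t' c)).card)).card := by ring
    have h6 : 64 * G * (C.filter bad).card = 2 * (32 * G * (C.filter bad).card) := by ring
    omega
  let 𝒟' := 𝒟.filter (fun p => ¬ bad p.1)
  have h𝒟' : 𝒟.card ≤ 2 * 𝒟'.card := by
    have h1 := Finset.card_filter_add_card_filter_not (s := 𝒟) (fun p => bad p.1)
    have h2 : (𝒟.filter (fun p => bad p.1)).card ≤ κ * (C.filter bad).card := by
      refine Finset.card_le_mul_card_image_of_maps_to (f := Prod.fst) ?_ κ ?_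
      · intro p hp
        obtain ⟨m1, m2⟩ := Finset.mem_filter.1 hp
        exact Finset.mem_filter.2 ⟨(h𝒟 p m1).1, m2⟩
      · intro c _
        refine le_trans ?_ (rk_block_card C κ hκ0 (rk C c / κ))
        refine Finset.card_le_card_of_injOn Prod.snd ?_ ?_
        · intro p hp
          obtain ⟨m1, m2⟩ := Finset.mem_filter.1 hp
          have := h𝒟 p (Finset.mem_filter.1 m1).1
          refine Finset.mem_coe.2 (Finset.mem_filter.2 ⟨this.2.1, ?_⟩)
          rw [← m2]; exact this.2.2
        · intro p hp p' hp' he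
          exact Prod.ext ((Finset.mem_filter.1 hp).2.trans (Finset.mem_filter.1 hp').2.symm) he
    have h3 : 32 * G * (𝒟.filter (fun p => bad p.1)).card ≤ 12 * G * 𝒟.card := by
      calc _ ≤ 32 * G * (κ * (C.filter bad).card) := Nat.mul_le_mul_left _ h2
        _ = κ * (32 * G * (C.filter bad).card) := by ring
        _ ≤ κ * (3 * C.card) := Nat.mul_le_mul_left _ hbad
        _ = 3 * (κ * C.card) := by ring
        _ ≤ 3 * (4 * G * 𝒟.card) := Nat.mul_le_mul_left _ h𝒟c
        _ = _ := by ring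
    have h4 : 32 * (𝒟.filter (fun p => bad p.1)).card ≤ 12 * 𝒟.card := by
      apply Nat.le_of_mul_le_mul_left _ hGpos
      calc _ = 32 * G * (𝒟.filter (fun p => bad p.1)).card := by ring
        _ ≤ _ := h3
        _ = _ := by ring
    have h5 : (𝒟.filter (fun p => ¬ bad p.1)).card = 𝒟'.card := rfl
    omega
  have h𝒟'm : ∀ p ∈ 𝒟', p ∈ 𝒟 ∧ 2 * (lost p.1).card ≤ Q.card ∧ 2 * (T.filter (fun t' => sp t' p.1)).card ≤ T.card := by
    intro p hp
    obtain ⟨m1, m2⟩ := Finset.mem_filter.1 hp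
    simp only [bad, not_or, not_lt] at m2
    exact ⟨m1, m2.1, m2.2⟩
  let Dfs := 𝒟'.image (fun p => p.2 - p.1)
  refine ⟨𝒟', Dfs.card, Finset.filter_subset _ _, h𝒟', ?_, ?_, ?_⟩
  · apply Finset.card_le_card
    intro δ hδ
    rw [Finset.mem_image] at hδ
    obtain ⟨p, hp, rfl⟩ := hδ
    exact hDf p (h𝒟'm p hp).1
  · -- Katz-Koester
    let near := (Y ×ˢ Y).filter (fun z => rk Y z.2 / τ = rk Y z.1 / τ)
    have h1 : near.card ≤ Y.card * τ := by
      rw [mul_comm]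
      refine Finset.card_le_mul_card_image_of_maps_to (f := Prod.fst) ?_ τ ?_
      · intro z hz
        exact (Finset.mem_product.1 (Finset.mem_filter.1 hz).1).1
      · intro y _
        refine le_trans ?_ (rk_block_card Y τ hτ (rk Y y / τ))
        refine Finset.card_le_card_of_injOn Prod.snd ?_ ?_
        · intro z hz
          obtain ⟨m1, m2⟩ := Finset.mem_filter.1 hz
          obtain ⟨m3, m4⟩ := Finset.mem_filter.1 m1
          refine Finset.mem_coe.2 (Finset.mem_filter.2 ⟨(Finset.mem_product.1 m3).2, ?_⟩)
          rw [← m2]; exact m4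
        · intro p hp p' hp' he
          exact Prod.ext ((Finset.mem_filter.1 hp).2.trans (Finset.mem_filter.1 hp').2.symm) he
    have h2 : Dfs.card * T.card ≤ 2 * near.card := by
      have h3 : near.card ≥ ∑ δ ∈ Dfs, (near.filter (fun z => z.2 - z.1 = δ)).card := by
        rw [← Finset.card_biUnion]
        · apply Finset.card_le_card
          intro z hz
          rw [Finset.mem_biUnion] at hz
          obtain ⟨δ, _, hz⟩ := hz
          exact (Finset.mem_filter.1 hz).1
        · intro δ _ δ' _ hne
          rw [Function.onFun, Finset.disjoint_left]
          intro z h1 h2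
          exact hne ((Finset.mem_filter.1 h1).2.symm.trans (Finset.mem_filter.1 h2).2)
      have h4 : ∀ δ ∈ Dfs, T.card ≤ 2 * (near.filter (fun z => z.2 - z.1 = δ)).card := by
        intro δ hδ
        rw [Finset.mem_image] at hδ
        obtain ⟨p, hp, rfl⟩ := hδ
        obtain ⟨a1, a2, a3⟩ := h𝒟'm p hp
        have a4 := h𝒟 p a1
        have h5 : (T.filter (fun t' => ¬ sp t' p.1)).card ≤ (near.filter (fun z => z.2 - z.1 = p.2 - p.1)).card := by
          refine Finset.card_le_card_of_injOn (fun t' => (e t' + p.1, e t' + p.2)) ?_ ?_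
          · intro t' ht'
            obtain ⟨m1, m2⟩ := Finset.mem_filter.1 ht'
            refine Finset.mem_coe.2 (Finset.mem_filter.2 ⟨Finset.mem_filter.2 ⟨Finset.mem_product.2
              ⟨hY _ m1 _ a4.1, hY _ m1 _ a4.2.1⟩, ?_⟩, by ring⟩)
            by_contra hc
            exact m2 ⟨p.2, a4.2.1, a4.2.2, hc⟩
          · intro t1 h1 t2 h2 he
            simp only [Prod.mk.injEq] at he
            exact hg.smono.injOn (hT _ (Finset.mem_filter.1 h1).1) (hT _ (Finset.mem_filter.1 h2).1) (by linarith [he.1])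
        have h6 := Finset.card_filter_add_card_filter_not (s := T) (fun t' => sp t' p.1)
        omega
      calc Dfs.card * T.card = ∑ _δ ∈ Dfs, T.card := by simp
        _ ≤ ∑ δ ∈ Dfs, 2 * (near.filter (fun z => z.2 - z.1 = δ)).card := Finset.sum_le_sum h4
        _ = 2 * ∑ δ ∈ Dfs, (near.filter (fun z => z.2 - z.1 = δ)).card := by rw [Finset.mul_sum]
        _ ≤ _ := Nat.mul_le_mul_left _ h3
    calc _ ≤ _ := h2
      _ ≤ 2 * (Y.card * τ) := Nat.mul_le_mul_left _ h1
      _ = _ := by ring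
  · intro τD τP r hτD hτP hr
    -- tuples
    let raw := (𝒟' ×ˢ Q).filter (fun z => ¬ (bs z.2 z.1.1 ∨ sp z.2.2 z.1.1))
    let mk : (ℝ × ℝ) × (ℝ × ℝ) → (ℝ × ℝ) × ℝ × (ℝ × ℝ) := fun z => (z.1, z.2.1 - z.2.2, (e z.2.1, e z.2.2))
    let I := raw.image mk
    have hraw : ∀ z ∈ raw, z.1 ∈ 𝒟' ∧ z.2 ∈ Q ∧ ¬ bs z.2 z.1.1 ∧ ¬ sp z.2.2 z.1.1 := by
      intro z hz
      obtain ⟨m1, m2⟩ := Finset.mem_filter.1 hz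
      obtain ⟨m3, m4⟩ := Finset.mem_product.1 m1
      rw [not_or] at m2
      exact ⟨m3, m4, m2.1, m2.2⟩
    have hIc : I.card = raw.card := by
      apply Finset.card_image_of_injOn
      intro z hz z' hz' he
      have a := hraw z hz
      have a' := hraw z' hz'
      simp only [mk, Prod.mk.injEq] at he
      have b1 : z.2.1 = z'.2.1 := hg.smono.injOn (hT _ (hTsub _ a.2.1)) (hT _ (hTsub _ a'.2.1)) he.2.2.1
      have b2 : z.2.2 = z'.2.2 := hg.smono.injOn (hT _ (hQ _ a.2.1).2.1) (hT _ (hQ _ a'.2.1).2.1) he.2.2.2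
      exact Prod.ext he.1 (Prod.ext b1 b2)
    have hrawc : 𝒟'.card * Q.card ≤ 2 * raw.card := by
      have h1 : raw.card = ∑ p ∈ 𝒟', (Q.filter (fun q => ¬ (bs q p.1 ∨ sp q.2 p.1))).card := by
        simp only [raw, Finset.card_filter]
        rw [Finset.sum_product]
      rw [h1, Finset.mul_sum, ← smul_eq_mul, ← Finset.sum_const]
      apply Finset.sum_le_sum
      intro p hp
      have h2 := (h𝒟'm p hp).2.1
      have h3 := Finset.card_filter_add_card_filter_not (s := Q) (fun q => bs q p.1 ∨ sp q.2 p.1)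
      have h4 : (Q.filter (fun q => bs q p.1 ∨ sp q.2 p.1)).card = (lost p.1).card := rfl
      omega
    -- element facts
    have hel : ∀ q ∈ I, ∃ z, z.1 ∈ 𝒟' ∧ z.2 ∈ Q ∧ ¬ bs z.2 z.1.1 ∧ ¬ sp z.2.2 z.1.1 ∧ q = mk z := by
      intro q hq
      rw [Finset.mem_image] at hq
      obtain ⟨z, hz, rfl⟩ := hq
      obtain ⟨h1, h2, h3, h4⟩ := hraw z hz
      exact ⟨z, h1, h2, h3, h4, rfl⟩
    let SD : Finset (ℝ ×ₗ ℝ) := 𝒟'.image toLex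
    have hSDc : SD.card = 𝒟'.card := Finset.card_image_of_injective _ toLex.injective
    have hc := core Y (fun y => rk Y y / τ) τ b (𝒟'.card / τD) (P.card / τP) τD τP t hb
      (rk_block_card Y τ hτ) θ Vs P
      (by
        intro s1 h1 s2 h2
        exact halg s1 (hP s1 h1) s2 (hP s2 h2))
      (fun s hs => (hVθ s (hP s hs)).1) (fun s hs => (hVθ s (hP s hs)).2)
      𝒟' Dfs (fun p hp => Finset.mem_image_of_mem _ hp)
      (fun p => rk SD (toLex p) / τD)
      (by
        intro k
        refine le_trans ?_ (rk_block_card SD τD hτD k)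
        refine Finset.card_le_card_of_injOn toLex ?_ toLex.injective.injOn
        intro p hp
        obtain ⟨m1, m2⟩ := Finset.mem_filter.1 hp
        exact Finset.mem_coe.2 (Finset.mem_filter.2 ⟨Finset.mem_image_of_mem _ m1, m2⟩))
      (by
        intro p _
        rw [← hSDc]
        exact Nat.div_le_div_right (rk_le _ _))
      (by
        intro p _ q _ hlt
        have := lt_of_rk_div_lt SD τD hlt
        rw [Prod.Lex.toLex_lt_toLex] at this
        rcases this with h | h
        · exact h.le
        · exact h.1.le)
      (fun s => rk P s / τP) (rk_block_card P τP hτP)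
      (fun p _ => Nat.div_le_div_right (rk_le _ _))
      (fun p _ q _ hlt => (lt_of_rk_div_lt P τP hlt).le)
      I
      (by rintro q hq; obtain ⟨z, h1, h2, h3, h4, rfl⟩ := hel q hq; exact h1)
      (by rintro q hq; obtain ⟨z, h1, h2, h3, h4, rfl⟩ := hel q hq; exact (hQ _ h2).2.2.2)
      (by
        rintro q hq; obtain ⟨z, h1, h2, h3, h4, rfl⟩ := hel q hq
        have a := hQ _ h2
        have := (hθe (z.2.1 - z.2.2) z.2.1 (hP _ a.2.2.2) (hT _ (hTsub _ h2)) (by rw [sub_sub_cancel]; exact hT _ a.2.1)).1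
        rw [sub_sub_cancel] at this
        exact this)
      (by
        rintro q hq; obtain ⟨z, h1, h2, h3, h4, rfl⟩ := hel q hq
        have a := hQ _ h2
        have := (hθe (z.2.1 - z.2.2) z.2.1 (hP _ a.2.2.2) (hT _ (hTsub _ h2)) (by rw [sub_sub_cancel]; exact hT _ a.2.1)).2
        rw [sub_sub_cancel] at this
        exact this)
      (by
        rintro q hq; obtain ⟨z, h1, h2, h3, h4, rfl⟩ := hel q hq
        have := hY _ (hTsub _ h2) _ (h𝒟 _ (h𝒟'm _ h1).1).1
        rw [add_comm]; exact this)
      (by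
        rintro q hq; obtain ⟨z, h1, h2, h3, h4, rfl⟩ := hel q hq
        have := hY _ (hQ _ h2).2.1 _ (h𝒟 _ (h𝒟'm _ h1).1).2.1
        rw [add_comm]; exact this)
      (by
        rintro q hq; obtain ⟨z, h1, h2, h3, h4, rfl⟩ := hel q hq
        simp only [bs, not_not] at h3
        simp only [mk]
        rw [add_comm z.1.1, add_comm z.1.1]
        exact h3)
      (by
        rintro q hq; obtain ⟨z, h1, h2, h3, h4, rfl⟩ := hel q hq
        simp only [mk]
        rw [add_comm z.1.2, add_comm z.1.1]
        by_contra hc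
        have := h𝒟 _ (h𝒟'm _ h1).1
        exact h4 ⟨z.1.2, this.2.1, this.2.2, hc⟩)
      (by
        rintro q hq q' hq' hx hcc hss
        obtain ⟨z, h1, h2, h3, h4, rfl⟩ := hel q hq
        obtain ⟨z', h1', h2', h3', h4', rfl⟩ := hel q' hq'
        apply Nat.div_le_div_right
        apply rk_mono
        simp only [mk] at hx hcc hss ⊢
        have a := hQ _ h2
        have a' := hQ _ h2'
        have d1 := hT _ (hTsub _ h2)
        have d2 := hT _ a.2.1
        have d1' := hT _ (hTsub _ h2')
        have d2' := hT _ a'.2.1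
        have p' := hP _ a'.2.2.2
        have hle : z'.2.1 ≤ z.2.1 := by
          rw [← hg.smono.le_iff_le d1' d1]; linarith
        have e1 := hg.incr z'.2.1 z.2.1 (z'.2.1 - z'.2.2) p' hle (by rw [sub_sub_cancel]; exact d2') d1
        rw [sub_sub_cancel] at e1
        have d3 : z.2.1 - (z'.2.1 - z'.2.2) ∈ D := hg.ord.out d2 d1 ⟨by linarith, by linarith⟩
        have e2 : e z.2.2 ≤ e (z.2.1 - (z'.2.1 - z'.2.2)) := (hg.smono.le_iff_le d2 d3).2 (by linarith)
        linarith)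
      r hr
    calc 𝒟'.card * Q.card * r ^ 2 ≤ 2 * raw.card * r ^ 2 := by gcongr
      _ = 2 * (I.card * r ^ 2) := by rw [hIc]; ring
      _ ≤ _ := Nat.mul_le_mul_left _ hc


/-- span of monomials of degree at most `k` in two functions -/
def mspan {ι : Type} (x y : ι → ℝ) (k : ℕ) : Submodule ℝ (ι → ℝ) :=
  Submodule.span ℝ {f | ∃ i j : ℕ, i + j ≤ k ∧ f = x ^ i * y ^ j}

lemma mspan_mono {ι : Type} (x y : ι → ℝ) {k l : ℕ} (h : k ≤ l) : mspan x y k ≤ mspan x y l := by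
  apply Submodule.span_mono
  rintro f ⟨i, j, hij, rfl⟩
  exact ⟨i, j, hij.trans h, rfl⟩

lemma mon_mem {ι : Type} (x y : ι → ℝ) {i j k : ℕ} (h : i + j ≤ k) : x ^ i * y ^ j ∈ mspan x y k :=
  Submodule.subset_span ⟨i, j, h, rfl⟩

lemma mspan_mul {ι : Type} (x y : ι → ℝ) {k a b : ℕ} {f : ι → ℝ} (hf : f ∈ mspan x y k) :
    x ^ a * y ^ b * f ∈ mspan x y (k + (a + b)) := by
  induction hf using Submodule.span_induction with
  | mem f h =>
    obtain ⟨i, j, hij, rfl⟩ := h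
    have : x ^ a * y ^ b * (x ^ i * y ^ j) = x ^ (a + i) * y ^ (b + j) := by ring
    rw [this]
    exact mon_mem x y (by omega)
  | zero => simp
  | add f g _ _ h1 h2 => rw [mul_add]; exact Submodule.add_mem _ h1 h2
  | smul c f _ h => rw [mul_smul_comm]; exact Submodule.smul_mem _ c h

/-- a polynomial with vanishing of large coefficients -/
lemma poly_mem_x {ι : Type} (x y : ι → ℝ) (p : Polynomial ℝ) (k : ℕ) (hp : p.natDegree ≤ k) :
    (fun z => p.eval (x z)) ∈ mspan x y k := by
  have : (fun z => p.eval (x z)) = ∑ i ∈ Finset.range (k + 1), p.coeff i • (x ^ i * y ^ 0) := by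
    funext z
    rw [Polynomial.eval_eq_sum_range' (n := k + 1) (by omega)]
    simp [Finset.sum_apply]
  rw [this]
  refine Submodule.sum_mem _ (fun i hi => Submodule.smul_mem _ _ (mon_mem x y ?_))
  have := Finset.mem_range.1 hi
  omega

lemma poly_mem_y {ι : Type} (x y : ι → ℝ) (p : Polynomial ℝ) (k : ℕ) (hp : p.natDegree ≤ k) :
    (fun z => p.eval (y z)) ∈ mspan x y k := by
  have : (fun z => p.eval (y z)) = ∑ i ∈ Finset.range (k + 1), p.coeff i • (x ^ 0 * y ^ i) := by
    funext z
    rw [Polynomial.eval_eq_sum_range' (n := k + 1) (by omega)]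
    simp [Finset.sum_apply]
  rw [this]
  refine Submodule.sum_mem _ (fun i hi => Submodule.smul_mem _ _ (mon_mem x y ?_))
  have := Finset.mem_range.1 hi
  omega

/-- if the filtration stabilises, `x` has finite range -/
lemma finite_of_stab {ι : Type} (x y : ι → ℝ) (k : ℕ) (h : ∀ i j, i + j = k + 1 → x ^ i * y ^ j ∈ mspan x y k) :
    (Set.range x).Finite := by
  have hst : ∀ m i j, i + j = m → x ^ i * y ^ j ∈ mspan x y k := by
    intro m
    induction m with
    | zero => intro i j hij; exact mon_mem x y (by omega)
    | succ m ih =>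
      have key : ∀ f ∈ mspan x y k, x * f ∈ mspan x y k ∧ y * f ∈ mspan x y k := by
        have hgen : ∀ i j, i + j ≤ k + 1 → x ^ i * y ^ j ∈ mspan x y k := by
          intro i j hij
          rcases Nat.lt_or_ge (i + j) (k + 1) with h1 | h1
          · exact mon_mem x y (by omega)
          · exact h i j (by omega)
        intro f hf
        induction hf using Submodule.span_induction with
        | mem f h =>
          obtain ⟨i, j, hij, rfl⟩ := h
          constructor
          · have := hgen (i + 1) j (by omega)
            rwa [show x ^ (i + 1) * y ^ j = x * (x ^ i * y ^ j) by ring] at this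
          · have := hgen i (j + 1) (by omega)
            rwa [show x ^ i * y ^ (j + 1) = y * (x ^ i * y ^ j) by ring] at this
        | zero => simp
        | add f g _ _ h1 h2 =>
          exact ⟨by rw [mul_add]; exact Submodule.add_mem _ h1.1 h2.1, by rw [mul_add]; exact Submodule.add_mem _ h1.2 h2.2⟩
        | smul c f _ h =>
          exact ⟨by rw [mul_smul_comm]; exact Submodule.smul_mem _ c h.1, by rw [mul_smul_comm]; exact Submodule.smul_mem _ c h.2⟩
      intro i j hij
      rcases Nat.eq_zero_or_pos i with h0 | h0
      · obtain ⟨j, rfl⟩ : ∃ j', j = j' + 1 := ⟨j - 1, by omega⟩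
        have := (key _ (ih i j (by omega))).2
        rwa [show y * (x ^ i * y ^ j) = x ^ i * y ^ (j + 1) by ring] at this
      · obtain ⟨i, rfl⟩ : ∃ j', i = j' + 1 := ⟨i - 1, by omega⟩
        have := (key _ (ih i j (by omega))).1
        rwa [show x * (x ^ i * y ^ j) = x ^ (i + 1) * y ^ j by ring] at this
  have hfin : ({f | ∃ i j : ℕ, i + j ≤ k ∧ f = x ^ i * y ^ j} : Set (ι → ℝ)).Finite := by
    refine ((Set.finite_Iic k).prod (Set.finite_Iic k) |>.image (fun p : ℕ × ℕ => x ^ p.1 * y ^ p.2)).subset ?_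
    rintro f ⟨i, j, hij, rfl⟩
    exact ⟨(i, j), ⟨by simp; omega, by simp; omega⟩, rfl⟩
  have : FiniteDimensional ℝ (mspan x y k) := FiniteDimensional.span_of_finite ℝ hfin
  let f : ℕ → mspan x y k := fun m => ⟨x ^ m * y ^ 0, hst m m 0 rfl⟩
  have hnl : ¬ LinearIndependent ℝ f := by
    intro hl
    have := hl.finite
    exact not_finite ℕ
  rw [linearIndependent_iff'] at hnl
  push Not at hnl
  obtain ⟨s, c, hc, i, hi, hi0⟩ := hnl
  let p : Polynomial ℝ := ∑ m ∈ s, Polynomial.monomial m (c m)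
  have hp : p ≠ 0 := by
    intro h0
    apply hi0
    have := congrArg (fun q => Polynomial.coeff q i) h0
    simpa [p, Polynomial.finsetSum_coeff, Polynomial.coeff_monomial, hi] using this
  refine (p.roots.toFinset.finite_toSet).subset ?_
  rintro _ ⟨z, rfl⟩
  have := congrFun (congrArg Subtype.val hc) z
  simp [f, Finset.sum_apply] at this
  simp [hp, p, Polynomial.eval_finsetSum, this]

lemma grade_fin {ι : Type} (x y : ι → ℝ) (e : ℕ) (κ : ℝ) (hκ : 0 < κ)
    (h1 : x ^ (e + 2) - y ^ (e + 2) ∈ mspan x y (e + 1))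
    (h2 : x ^ (e + 1) - κ • y ^ (e + 1) ∈ mspan x y e)
    (h3 : κ ≠ 1 ∨ (κ = 1 ∧ ∑ i ∈ Finset.range (e + 2), x ^ i * y ^ (e + 1 - i) ∈ mspan x y e)) :
    (Set.range x).Finite := by
  have ha : x * y ^ (e + 1) - κ⁻¹ • y ^ (e + 2) ∈ mspan x y (e + 1) := by
    have h4 := mspan_mul x y (a := 1) (b := 0) h2
    have h5 := Submodule.smul_mem _ κ⁻¹ (Submodule.sub_mem _ h1 h4)
    convert h5 using 1
    funext z
    simp
    field_simp
    ring
  have hb : ∀ j, x ^ j * y ^ (e + 1) - κ⁻¹ ^ j • y ^ (e + 1 + j) ∈ mspan x y (e + j) := by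
    intro j
    induction j with
    | zero => simp
    | succ j ih =>
      have h4 := mspan_mul x y (a := 1) (b := 0) ih
      have h5 := Submodule.smul_mem _ (κ⁻¹ ^ j) (mspan_mul x y (a := 0) (b := j) ha)
      have h6 := Submodule.add_mem _ (mspan_mono x y (by omega : e + j + (1 + 0) ≤ e + (j + 1)) h4)
        (mspan_mono x y (by omega : e + 1 + (0 + j) ≤ e + (j + 1)) h5)
      convert h6 using 1
      funext z
      simp
      ring
  have hc : y ^ (2 * e + 2) ∈ mspan x y (2 * e + 1) := by
    rcases h3 with h3 | ⟨rfl, h3⟩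
    · have h4 := mspan_mul x y (a := 0) (b := e + 1) h2
      have h5 := hb (e + 1)
      have h6 := Submodule.sub_mem _ (mspan_mono x y (by omega : e + (e + 1) ≤ 2 * e + 1) h5)
        (mspan_mono x y (by omega : e + (0 + (e + 1)) ≤ 2 * e + 1) h4)
      have hne : κ - κ⁻¹ ^ (e + 1) ≠ 0 := by
        intro h0
        apply h3
        have : κ ^ (e + 2) = 1 := by
          have h7 : κ = κ⁻¹ ^ (e + 1) := by linarith
          calc κ ^ (e + 2) = κ * κ ^ (e + 1) := by ring
            _ = κ⁻¹ ^ (e + 1) * κ ^ (e + 1) := by rw [← h7]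
            _ = 1 := by rw [← mul_pow, inv_mul_cancel₀ hκ.ne', one_pow]
        exact (pow_eq_one_iff_of_nonneg hκ.le (by omega)).1 this
      have h7 := Submodule.smul_mem _ (κ - κ⁻¹ ^ (e + 1))⁻¹ h6
      convert h7 using 1
      funext z
      simp only [Pi.smul_apply, Pi.sub_apply, Pi.mul_apply, Pi.pow_apply, smul_eq_mul]
      rw [eq_inv_mul_iff_mul_eq₀ hne]
      ring
    · have h4 := mspan_mul x y (a := 0) (b := e + 1) h3
      have h5 : ∑ i ∈ Finset.range (e + 2), x ^ 0 * y ^ (e + 1 - i) * (x ^ i * y ^ (e + 1) - (1:ℝ)⁻¹ ^ i • y ^ (e + 1 + i)) ∈ mspan x y (2 * e + 1) := by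
        refine Submodule.sum_mem _ (fun i hi => ?_)
        have := Finset.mem_range.1 hi
        exact mspan_mono x y (by omega : e + i + (0 + (e + 1 - i)) ≤ 2 * e + 1) (mspan_mul x y (hb i))
      have h6 := Submodule.smul_mem _ ((e : ℝ) + 2)⁻¹ (Submodule.sub_mem _ (mspan_mono x y (by omega : e + (0 + (e + 1)) ≤ 2 * e + 1) h4) h5)
      convert h6 using 1
      rw [Finset.mul_sum, ← Finset.sum_sub_distrib]
      have : ∀ i ∈ Finset.range (e + 2), x ^ 0 * y ^ (e + 1) * (x ^ i * y ^ (e + 1 - i)) -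
        x ^ 0 * y ^ (e + 1 - i) * (x ^ i * y ^ (e + 1) - (1:ℝ)⁻¹ ^ i • y ^ (e + 1 + i)) = y ^ (2 * e + 2) := by
        intro i hi
        have := Finset.mem_range.1 hi
        have h8 : y ^ (2 * e + 2) = y ^ (e + 1 - i) * y ^ (e + 1 + i) := by
          rw [← pow_add]; congr 1; omega
        rw [h8]
        simp
        ring
      rw [Finset.sum_congr rfl this]
      funext z
      simp
      field_simp
  have hd : ∀ i j, i + j = 2 * e + 2 → e + 1 ≤ j → x ^ i * y ^ j ∈ mspan x y (2 * e + 1) := by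
    intro i j hij hj
    have h4 := mspan_mul x y (a := 0) (b := j - (e + 1)) (hb i)
    have h5 := Submodule.add_mem _ (mspan_mono x y (by omega : e + i + (0 + (j - (e + 1))) ≤ 2 * e + 1) h4)
      (Submodule.smul_mem _ (κ⁻¹ ^ i) hc)
    convert h5 using 1
    have h6 : y ^ j = y ^ (j - (e + 1)) * y ^ (e + 1) := by rw [← pow_add]; congr 1; omega
    have h7 : y ^ (2 * e + 2) = y ^ (j - (e + 1)) * y ^ (e + 1 + i) := by rw [← pow_add]; congr 1; omega
    rw [h6, h7]
    funext z
    simp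
    ring
  refine finite_of_stab x y (2 * e + 1) ?_
  intro i j hij
  rcases Nat.lt_or_ge j (e + 1) with hj | hj
  · have h4 := mspan_mul x y (a := i - (e + 2)) (b := j) h1
    have h5 := hd (i - (e + 2)) (j + (e + 2)) (by omega) (by omega)
    have h6 := Submodule.add_mem _ (mspan_mono x y (by omega : e + 1 + (i - (e + 2) + j) ≤ 2 * e + 1) h4) h5
    convert h6 using 1
    have h7 : x ^ i = x ^ (i - (e + 2)) * x ^ (e + 2) := by rw [← pow_add]; congr 1; omega
    rw [h7]
    ring
  · exact hd i j (by omega) hj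

/-- polynomial identity giving a leading-order relation -/
lemma lead_rel {ι : Type} (x y : ι → ℝ) (p q : Polynomial ℝ) (k : ℕ) (hp : p.natDegree ≤ k + 1) (hq : q.natDegree ≤ k + 1)
    (c : ℝ) (h : ∀ z, p.eval (x z) - q.eval (y z) = c) (hpc : p.coeff (k + 1) ≠ 0) :
    x ^ (k + 1) - (q.coeff (k + 1) / p.coeff (k + 1)) • y ^ (k + 1) ∈ mspan x y k := by
  have h1 := poly_mem_x x y (p - Polynomial.monomial (k + 1) (p.coeff (k + 1))) k (by
    rw [Polynomial.natDegree_le_iff_coeff_eq_zero]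
    intro N hN
    rcases eq_or_ne N (k + 1) with rfl | h0
    · simp
    · rw [Polynomial.coeff_sub, Polynomial.coeff_eq_zero_of_natDegree_lt (by omega), Polynomial.coeff_monomial_of_ne _ h0]; simp)
  have h2 := poly_mem_y x y (q - Polynomial.monomial (k + 1) (q.coeff (k + 1))) k (by
    rw [Polynomial.natDegree_le_iff_coeff_eq_zero]
    intro N hN
    rcases eq_or_ne N (k + 1) with rfl | h0
    · simp
    · rw [Polynomial.coeff_sub, Polynomial.coeff_eq_zero_of_natDegree_lt (by omega), Polynomial.coeff_monomial_of_ne _ h0]; simp)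
  have h3 := mon_mem x y (i := 0) (j := 0) (k := k) (by omega)
  have h4 := Submodule.smul_mem _ (p.coeff (k + 1))⁻¹ (Submodule.add_mem _ (Submodule.sub_mem _ h2 h1) (Submodule.smul_mem _ c h3))
  convert h4 using 1
  funext z
  have := h z
  simp
  field_simp
  linarith

/-- divided difference -/
lemma ddiff_mem {ι : Type} (x y : ι → ℝ) (p : Polynomial ℝ) (k : ℕ) (hp : p.natDegree ≤ k + 1) :
    ∃ f ∈ mspan x y k, (∀ z, f z * (x z - y z) = p.eval (x z) - p.eval (y z)) ∧
      f - p.coeff (k + 1) • ∑ i ∈ Finset.range (k + 1), x ^ i * y ^ (k - i) ∈ mspan x y (k - 1) := by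
  refine ⟨∑ m ∈ Finset.range (k + 2), p.coeff m • ∑ i ∈ Finset.range m, x ^ i * y ^ (m - 1 - i), ?_, ?_, ?_⟩
  · refine Submodule.sum_mem _ (fun m hm => Submodule.smul_mem _ _ (Submodule.sum_mem _ (fun i hi => mon_mem x y ?_)))
    have := Finset.mem_range.1 hm
    have := Finset.mem_range.1 hi
    omega
  · intro z
    rw [Polynomial.eval_eq_sum_range' (n := k + 2) (by omega), Polynomial.eval_eq_sum_range' (n := k + 2) (by omega),
      ← Finset.sum_sub_distrib]
    simp only [Finset.sum_apply, Pi.smul_apply, Pi.mul_apply, Pi.pow_apply, smul_eq_mul]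
    rw [Finset.sum_mul]
    refine Finset.sum_congr rfl (fun m _ => ?_)
    rw [mul_assoc, geom_sum₂_mul]
    ring
  · rw [Finset.sum_range_succ]
    simp only [Nat.add_sub_cancel, add_sub_cancel_right]
    refine Submodule.sum_mem _ (fun m hm => Submodule.smul_mem _ _ (Submodule.sum_mem _ (fun i hi => mon_mem x y ?_)))
    have := Finset.mem_range.1 hm
    have := Finset.mem_range.1 hi
    omega

structure Cvx (g : Polynomial ℝ) (J : Set ℝ) : Prop where
  ord : J.OrdConnected
  op : IsOpen J
  d1 : ∀ x ∈ J, 0 < g.derivative.eval x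
  d2 : ∀ x ∈ J, 0 < g.derivative.derivative.eval x

lemma pos_deriv_smono (p : Polynomial ℝ) (J : Set ℝ) (hJ : J.OrdConnected) (h : ∀ x ∈ J, 0 < p.derivative.eval x) :
    StrictMonoOn (fun x => p.eval x) J := by
  refine strictMonoOn_of_deriv_pos hJ.convex p.continuous.continuousOn ?_
  intro x hx
  rw [Polynomial.deriv]
  exact h x (interior_subset hx)

lemma Cvx.smono {g : Polynomial ℝ} {J : Set ℝ} (h : Cvx g J) : StrictMonoOn (fun x => g.eval x) J :=
  pos_deriv_smono g J h.ord h.d1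

lemma Cvx.smono1 {g : Polynomial ℝ} {J : Set ℝ} (h : Cvx g J) : StrictMonoOn (fun x => g.derivative.eval x) J :=
  pos_deriv_smono _ J h.ord h.d2

/-- increments of a convex function strictly increase -/
lemma Cvx.incr {g : Polynomial ℝ} {J : Set ℝ} (h : Cvx g J) {x x' s : ℝ} (hs : 0 < s) (hx : x ∈ J) (hxs : x' + s ∈ J)
    (hxx : x < x') : g.eval (x + s) - g.eval x < g.eval (x' + s) - g.eval x' := by
  have hin : ∀ z, x ≤ z → z ≤ x' + s → z ∈ J := fun z h1 h2 => h.ord.out hx hxs ⟨h1, h2⟩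
  have : StrictMonoOn (fun z => (g.comp (Polynomial.X + Polynomial.C s) - g).eval z) (Set.Icc x x') := by
    refine pos_deriv_smono _ _ Set.ordConnected_Icc ?_
    intro z hz
    simp only [Polynomial.derivative_sub, Polynomial.derivative_comp, Polynomial.derivative_add, Polynomial.derivative_X,
      Polynomial.derivative_C, Polynomial.eval_sub, Polynomial.eval_mul, Polynomial.eval_comp, Polynomial.eval_add,
      Polynomial.eval_X, Polynomial.eval_C, add_zero, Polynomial.eval_one, one_mul]
    have := h.smono1 (hin z hz.1 (by linarith [hz.2])) (hin (z + s) (by linarith [hz.1]) (by linarith [hz.2])) (by linarith)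
    simp at this
    simpa using this
  have := this (Set.left_mem_Icc.2 hxx.le) (Set.right_mem_Icc.2 hxx.le) hxx
  simpa using this

lemma shift_poly (g : Polynomial ℝ) (e : ℕ) (hd : g.natDegree = e + 2) (τ : ℝ) :
    ∃ p : Polynomial ℝ, p.natDegree ≤ e + 1 ∧ p.coeff (e + 1) = (e + 2) * τ * g.leadingCoeff ∧
      ∀ x, p.eval x = g.eval (x + τ) - g.eval x := by
  refine ⟨Polynomial.taylor τ g - g, ?_, ?_, ?_⟩
  · rw [Polynomial.natDegree_le_iff_coeff_eq_zero]
    intro N hN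
    rcases eq_or_ne N (e + 2) with rfl | h0
    · rw [Polynomial.coeff_sub, ← hd, sub_eq_zero]
      rw [Polynomial.coeff_taylor_natDegree, Polynomial.leadingCoeff]
    · rw [Polynomial.coeff_eq_zero_of_natDegree_lt]
      refine lt_of_le_of_lt (Polynomial.natDegree_sub_le _ _) ?_
      rw [Polynomial.natDegree_taylor]
      simp; omega
  · have hh : (Polynomial.hasseDeriv (e + 1) g) = Polynomial.C (g.coeff (e + 1)) + Polynomial.C ((e + 2) * g.coeff (e + 2)) * Polynomial.X := by
      ext n
      rw [Polynomial.hasseDeriv_coeff]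
      rcases n with _ | _ | n
      · simp
      · simp [add_comm 1 (e + 1), Polynomial.coeff_C]
        left
        ring
      · rw [Polynomial.coeff_eq_zero_of_natDegree_lt (by omega)]
        simp [Polynomial.coeff_X, Polynomial.coeff_C]
    rw [Polynomial.coeff_sub, Polynomial.taylor_coeff, hh, Polynomial.leadingCoeff, hd]
    simp
    ring
  · intro x
    simp [Polynomial.taylor_eval]

theorem nc {ι : Type} (g : Polynomial ℝ) (e : ℕ) (hd : g.natDegree = e + 2) (J : Set ℝ) (hJ : Cvx g J)
    (x y : ι → ℝ) (hinf : (Set.range x).Infinite) (τ1 τ2 C C' : ℝ) (hx : ∀ z, x z ∈ J) (hy : ∀ z, y z ∈ J)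
    (hx1 : ∀ z, x z + τ1 ∈ J) (hy1 : ∀ z, y z + τ2 ∈ J) (h1 : ∀ z, g.eval (x z) - g.eval (y z) = C)
    (h2 : ∀ z, g.eval (x z + τ1) - g.eval (y z + τ2) = C') : τ1 = τ2 ∧ (τ1 = 0 ∨ C = 0) := by
  -- two distinct points
  obtain ⟨a, b, hab⟩ : ∃ a b, x a < x b := by
    obtain ⟨_, ⟨a, rfl⟩, _, ⟨b, rfl⟩, hab⟩ := hinf.nontrivial
    rcases lt_or_gt_of_ne hab with h | h
    exacts [⟨a, b, h⟩, ⟨b, a, h⟩]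
  have hyab : y a < y b := by
    have := hJ.smono (hx a) (hx b) hab
    by_contra hle
    push Not at hle
    have h3 := hJ.smono.monotoneOn (hy b) (hy a) hle
    simp only at this h3
    linarith [h1 a, h1 b]
  -- sign of increments
  have sgn : ∀ τ u u' : ℝ, u ∈ J → u' ∈ J → u + τ ∈ J → u' + τ ∈ J → u < u' →
      (0 < τ → g.eval (u + τ) - g.eval u < g.eval (u' + τ) - g.eval u') ∧
      (τ < 0 → g.eval (u' + τ) - g.eval u' < g.eval (u + τ) - g.eval u) := by
    intro τ u u' h3 h4 h5 h6 h7
    refine ⟨fun h => hJ.incr h h3 h6 h7, fun h => ?_⟩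
    have := hJ.incr (s := -τ) (x := u + τ) (x' := u' + τ) (by linarith) h5 (by simpa using h4) (by linarith)
    simp at this
    linarith
  have sx := sgn τ1 (x a) (x b) (hx a) (hx b) (hx1 a) (hx1 b) hab
  have sy := sgn τ2 (y a) (y b) (hy a) (hy b) (hy1 a) (hy1 b) hyab
  have e1 := h1 a; have e2 := h1 b; have e3 := h2 a; have e4 := h2 b
  have hcase : (τ1 = 0 ∧ τ2 = 0) ∨ (0 < τ2 / τ1 ∧ τ1 ≠ 0) := by
    rcases lt_trichotomy τ1 0 with h | h | h <;> rcases lt_trichotomy τ2 0 with h' | h' | h'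
    · exact Or.inr ⟨div_pos_of_neg_of_neg h' h, h.ne⟩
    · have := sx.2 h; rw [h'] at e3 e4; simp at e3 e4; linarith
    · have := sx.2 h; have := sy.1 h'; linarith
    · have := sy.2 h'; rw [h] at e3 e4; simp at e3 e4; linarith
    · exact Or.inl ⟨h, h'⟩
    · have := sy.1 h'; rw [h] at e3 e4; simp at e3 e4; linarith
    · have := sx.1 h; have := sy.2 h'; linarith
    · have := sx.1 h; rw [h'] at e3 e4; simp at e3 e4; linarith
    · exact Or.inr ⟨div_pos h' h, h.ne'⟩
  rcases hcase with ⟨rfl, rfl⟩ | ⟨hκ, hτ⟩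
  · simp
  have hg0 : g.leadingCoeff ≠ 0 := by
    rw [Polynomial.leadingCoeff_ne_zero]
    rintro rfl
    simp at hd
  obtain ⟨p1, hp1, hp1c, hp1e⟩ := shift_poly g e hd τ1
  obtain ⟨p2, hp2, hp2c, hp2e⟩ := shift_poly g e hd τ2
  have r1 : x ^ (e + 2) - y ^ (e + 2) ∈ mspan x y (e + 1) := by
    have := lead_rel x y g g (e + 1) (by omega) (by omega) C h1 (by rw [show e + 1 + 1 = g.natDegree by omega]; exact hg0)
    rw [div_self (by rw [show e + 1 + 1 = g.natDegree by omega]; exact hg0)] at this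
    simpa using this
  have hne : p1.coeff (e + 1) ≠ 0 := by
    rw [hp1c]
    have : (e : ℝ) + 2 ≠ 0 := by positivity
    positivity
  have r2 : x ^ (e + 1) - (τ2 / τ1) • y ^ (e + 1) ∈ mspan x y e := by
    have := lead_rel x y p1 p2 e hp1 hp2 (C' - C) (by intro z; rw [hp1e, hp2e]; linarith [h1 z, h2 z]) hne
    have h3 : p2.coeff (e + 1) / p1.coeff (e + 1) = τ2 / τ1 := by
      rw [hp1c, hp2c]
      field_simp
    rwa [h3] at this
  by_contra hcon
  apply hinf
  by_cases hk : τ2 / τ1 = 1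
  swap
  · exact grade_fin x y e _ hκ r1 r2 (Or.inl hk)
  have hττ : τ2 = τ1 := by field_simp at hk; exact hk
  subst hττ
  have hC : C ≠ 0 := fun h0 => hcon ⟨rfl, Or.inr h0⟩
  refine grade_fin x y e _ hκ r1 r2 (Or.inr ⟨hk, ?_⟩)
  obtain ⟨f, _, hf2, hf3⟩ := ddiff_mem x y g (e + 1) (by omega)
  obtain ⟨k, hk1, hk2, _⟩ := ddiff_mem x y p1 e hp1
  have hxy : ∀ z, x z - y z ≠ 0 := by
    intro z h0
    apply hC
    rw [← h1 z, show x z = y z by linarith, sub_self]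
  have hC' : C' - C ≠ 0 := by
    intro h0
    have h3 := h1 a; have h4 := h2 a
    have hxne := hxy a
    have : ∀ u u' : ℝ, u ∈ J → u' ∈ J → u + τ2 ∈ J → u' + τ2 ∈ J → u < u' → g.eval (u + τ2) - g.eval u ≠ g.eval (u' + τ2) - g.eval u' := by
      intro u u' a1 a2 a3 a4 a5
      have s := sgn τ2 u u' a1 a2 a3 a4 a5
      rcases lt_or_gt_of_ne hτ with h | h
      · exact (s.2 h).ne'
      · exact (s.1 h).ne
    rcases lt_or_gt_of_ne hxne with h | h
    · exact this (x a) (y a) (hx a) (hy a) (hx1 a) (hy1 a) (by linarith) (by linarith)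
    · exact this (y a) (x a) (hy a) (hx a) (hy1 a) (hx1 a) (by linarith) (by linarith)
  have hfk : f = (C / (C' - C)) • k := by
    funext z
    have h3 := hf2 z; have h4 := hk2 z
    rw [h1 z] at h3
    rw [hp1e, hp1e, show g.eval (x z + τ2) - g.eval (x z) - (g.eval (y z + τ2) - g.eval (y z)) = C' - C by linarith [h1 z, h2 z]] at h4
    have hz := hxy z
    simp
    have h5 : f z = C / (x z - y z) := by field_simp; exact h3
    have h6 : k z = (C' - C) / (x z - y z) := by field_simp; exact h4
    rw [h5, h6]
    field_simp
  have h5 : g.coeff (e + 1 + 1) ≠ 0 := by rw [show e + 1 + 1 = g.natDegree by omega]; exact hg0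
  have h6 : f ∈ mspan x y e := by rw [hfk]; exact Submodule.smul_mem _ _ hk1
  have h7 := Submodule.smul_mem _ (g.coeff (e + 1 + 1))⁻¹ (Submodule.sub_mem _ h6 hf3)
  rw [sub_sub_cancel, smul_smul, inv_mul_cancel₀ h5, one_smul] at h7
  exact h7


/-- functions of the form polynomial in `v` of degree at most `N` times small powers of `a`, `b` -/
def uspan {ι : Type} (v a b : ι → ℝ) (m N : ℕ) : Submodule ℝ (ι → ℝ) :=
  Submodule.span ℝ {f | ∃ i j k : ℕ, i ≤ N ∧ j < m ∧ k < m ∧ f = v ^ i * a ^ j * b ^ k}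

lemma uspan_mono {ι : Type} (v a b : ι → ℝ) (m : ℕ) {N N' : ℕ} (h : N ≤ N') : uspan v a b m N ≤ uspan v a b m N' := by
  apply Submodule.span_mono
  rintro f ⟨i, j, k, hi, hj, hk, rfl⟩
  exact ⟨i, j, k, hi.trans h, hj, hk, rfl⟩

lemma umem {ι : Type} (v a b : ι → ℝ) {m N i j k : ℕ} (hi : i ≤ N) (hj : j < m) (hk : k < m) :
    v ^ i * a ^ j * b ^ k ∈ uspan v a b m N := Submodule.subset_span ⟨i, j, k, hi, hj, hk, rfl⟩

/-- to check that multiplication maps `uspan` to `uspan` it is enough to look at generators -/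
lemma uspan_map {ι : Type} (v a b : ι → ℝ) (m N N' : ℕ) (h : ι → ℝ)
    (hg : ∀ i j k, i ≤ N → j < m → k < m → h * (v ^ i * a ^ j * b ^ k) ∈ uspan v a b m N') :
    ∀ f ∈ uspan v a b m N, h * f ∈ uspan v a b m N' := by
  intro f hf
  induction hf using Submodule.span_induction with
  | mem f hf => obtain ⟨i, j, k, hi, hj, hk, rfl⟩ := hf; exact hg i j k hi hj hk
  | zero => simp
  | add f g _ _ h1 h2 => rw [mul_add]; exact Submodule.add_mem _ h1 h2
  | smul c f _ h => rw [mul_smul_comm]; exact Submodule.smul_mem _ c h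

lemma uspan_v {ι : Type} (v a b : ι → ℝ) (m N n : ℕ) : ∀ f ∈ uspan v a b m N, v ^ n * f ∈ uspan v a b m (N + n) := by
  refine uspan_map v a b m N _ _ (fun i j k hi hj hk => ?_)
  rw [show v ^ n * (v ^ i * a ^ j * b ^ k) = v ^ (i + n) * a ^ j * b ^ k by ring]
  exact umem v a b (by omega) hj hk

lemma uspan_lin {ι : Type} (v a b : ι → ℝ) (m N : ℕ) (l : ι → ℝ) (p q : ℝ) (hl : l = p • 1 + q • v) :
    ∀ f ∈ uspan v a b m N, l * f ∈ uspan v a b m (N + 1) := by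
  intro f hf
  rw [hl, add_mul, smul_mul_assoc, smul_mul_assoc, one_mul]
  refine Submodule.add_mem _ (Submodule.smul_mem _ _ (uspan_mono v a b m (by omega) hf)) (Submodule.smul_mem _ _ ?_)
  simpa using uspan_v v a b m N 1 f hf

/-- relation defining an algebraic function -/
def ARel {ι : Type} (v a l : ι → ℝ) (m D : ℕ) : Prop :=
  (∃ p q : ℝ, l = p • 1 + q • v) ∧ l * a ^ m ∈ Submodule.span ℝ {f | ∃ i j : ℕ, i ≤ D ∧ j < m ∧ f = v ^ i * a ^ j}

lemma uspan_comm {ι : Type} (v a b : ι → ℝ) (m N : ℕ) : uspan v a b m N = uspan v b a m N := by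
  unfold uspan
  congr 1
  ext f
  constructor
  · rintro ⟨i, j, k, hi, hj, hk, rfl⟩; exact ⟨i, k, j, hi, hk, hj, by ring⟩
  · rintro ⟨i, j, k, hi, hj, hk, rfl⟩; exact ⟨i, k, j, hi, hk, hj, by ring⟩

lemma uspan_a {ι : Type} (v a b l : ι → ℝ) (m D N : ℕ) (h : ARel v a l m D) :
    ∀ f ∈ uspan v a b m N, (l * a) * f ∈ uspan v a b m (N + D + 1) := by
  obtain ⟨⟨p, q, hl⟩, hr⟩ := h
  refine uspan_map v a b m N _ _ (fun i j k hi hj hk => ?_)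
  rcases Nat.lt_or_ge (j + 1) m with h1 | h1
  · have := uspan_lin v a b m N l p q hl _ (umem v a b hi h1 hk)
    rw [show l * (v ^ i * a ^ (j + 1) * b ^ k) = l * a * (v ^ i * a ^ j * b ^ k) by ring] at this
    exact uspan_mono v a b m (by omega) this
  · obtain rfl : m = j + 1 := by omega
    rw [show l * a * (v ^ i * a ^ j * b ^ k) = v ^ i * b ^ k * (l * a ^ (j + 1)) by ring]
    generalize l * a ^ (j + 1) = f at hr
    induction hr using Submodule.span_induction with
    | mem f hf =>
      obtain ⟨i', j', hi', hj', rfl⟩ := hf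
      rw [show v ^ i * b ^ k * (v ^ i' * a ^ j') = v ^ (i + i') * a ^ j' * b ^ k by ring]
      exact umem v a b (by omega) hj' hk
    | zero => simp
    | add f g _ _ h1 h2 => rw [mul_add]; exact Submodule.add_mem _ h1 h2
    | smul c f _ h => rw [mul_smul_comm]; exact Submodule.smul_mem _ c h

def MM {ι : Type} (v a b : ι → ℝ) (m c : ℕ) (L : ι → ℝ) (q : ℕ) (h : ι → ℝ) : Prop :=
  ∀ N, ∀ f ∈ uspan v a b m N, (L ^ q * h) * f ∈ uspan v a b m (N + c * q)

section MM
variable {ι : Type} {v a b L : ι → ℝ} {m c : ℕ}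

lemma MM.add {q : ℕ} {h h' : ι → ℝ} (h1 : MM v a b m c L q h) (h2 : MM v a b m c L q h') : MM v a b m c L q (h + h') := by
  intro N f hf
  rw [mul_add, add_mul]
  exact Submodule.add_mem _ (h1 N f hf) (h2 N f hf)

lemma MM.smul {q : ℕ} {h : ι → ℝ} (r : ℝ) (h1 : MM v a b m c L q h) : MM v a b m c L q (r • h) := by
  intro N f hf
  rw [mul_smul_comm, smul_mul_assoc]
  exact Submodule.smul_mem _ _ (h1 N f hf)

lemma MM.sub {q : ℕ} {h h' : ι → ℝ} (h1 : MM v a b m c L q h) (h2 : MM v a b m c L q h') : MM v a b m c L q (h - h') := by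
  have := h1.add (h2.smul (-1))
  rwa [neg_one_smul, ← sub_eq_add_neg] at this

lemma MM.mul {q q' : ℕ} {h h' : ι → ℝ} (h1 : MM v a b m c L q h) (h2 : MM v a b m c L q' h') :
    MM v a b m c L (q + q') (h * h') := by
  intro N f hf
  have := h1 _ _ (h2 N f hf)
  rw [show L ^ (q + q') * (h * h') * f = L ^ q * h * (L ^ q' * h' * f) by ring]
  exact uspan_mono v a b m (by rw [mul_add]; omega) this

lemma MM.zero_one : MM v a b m c L 0 1 := by
  intro N f hf
  simpa using hf

lemma MM.sum {α : Type} {s : Finset α} {q : ℕ} {h : α → ι → ℝ} (h1 : ∀ x ∈ s, MM v a b m c L q (h x)) :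
    MM v a b m c L q (∑ x ∈ s, h x) := by
  intro N f hf
  rw [Finset.mul_sum, Finset.sum_mul]
  exact Submodule.sum_mem _ (fun x hx => h1 x hx N f hf)

lemma MM.raise {q q' : ℕ} {h : ι → ℝ} (h1 : MM v a b m c L q h) (hL : MM v a b m c L 1 1) (hq : q ≤ q') :
    MM v a b m c L q' h := by
  obtain ⟨k, rfl⟩ := Nat.exists_eq_add_of_le hq
  clear hq
  induction k with
  | zero => exact h1
  | succ k ih => simpa [add_assoc] using ih.mul hL

lemma MM.pow {q : ℕ} {h : ι → ℝ} (h1 : MM v a b m c L q h) (k : ℕ) : MM v a b m c L (q * k) (h ^ k) := by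
  induction k with
  | zero => simpa using MM.zero_one
  | succ k ih => rw [pow_succ, mul_add, mul_one]; exact ih.mul h1

lemma MM.poly {h : ι → ℝ} (h1 : MM v a b m c L 1 h) (hL : MM v a b m c L 1 1) (p : Polynomial ℝ) (k : ℕ) (hp : p.natDegree ≤ k) :
    MM v a b m c L k (fun z => p.eval (h z)) := by
  have : (fun z => p.eval (h z)) = ∑ i ∈ Finset.range (k + 1), p.coeff i • h ^ i := by
    funext z
    rw [Polynomial.eval_eq_sum_range' (n := k + 1) (by omega)]
    simp [Finset.sum_apply]
  rw [this]
  refine MM.sum (fun i hi => MM.smul _ ?_)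
  have := Finset.mem_range.1 hi
  exact (h1.pow i).raise hL (by omega)

end MM

lemma MM_basic {ι : Type} (v a b l1 l2 : ι → ℝ) (m D : ℕ) (h1 : ARel v a l1 m D) (h2 : ARel v b l2 m D) :
    MM v a b m (D + 3) (l1 * l2) 1 1 ∧ MM v a b m (D + 3) (l1 * l2) 1 v ∧ MM v a b m (D + 3) (l1 * l2) 1 a ∧
    MM v a b m (D + 3) (l1 * l2) 1 b := by
  obtain ⟨p1, q1, hl1⟩ := h1.1
  obtain ⟨p2, q2, hl2⟩ := h2.1
  refine ⟨?_, ?_, ?_, ?_⟩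
  · intro N f hf
    have := uspan_lin v a b m _ l1 p1 q1 hl1 _ (uspan_lin v a b m N l2 p2 q2 hl2 f hf)
    rw [show (l1 * l2) ^ 1 * 1 * f = l1 * (l2 * f) by ring]
    exact uspan_mono v a b m (by omega) this
  · intro N f hf
    have := uspan_v v a b m _ 1 _ (uspan_lin v a b m _ l1 p1 q1 hl1 _ (uspan_lin v a b m N l2 p2 q2 hl2 f hf))
    rw [show (l1 * l2) ^ 1 * v * f = v ^ 1 * (l1 * (l2 * f)) by ring]
    exact uspan_mono v a b m (by omega) this
  · intro N f hf
    have := uspan_lin v a b m _ l2 p2 q2 hl2 _ (uspan_a v a b l1 m D N h1 f hf)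
    rw [show (l1 * l2) ^ 1 * a * f = l2 * (l1 * a * f) by ring]
    exact uspan_mono v a b m (by omega) this
  · intro N f hf
    rw [uspan_comm] at hf
    have h3 := uspan_a v b a l2 m D N h2 f hf
    rw [uspan_comm] at h3
    have := uspan_lin v a b m _ l1 p1 q1 hl1 _ h3
    rw [show (l1 * l2) ^ 1 * b * f = l1 * (l2 * b * f) by ring]
    exact uspan_mono v a b m (by omega) this

lemma uspan_finrank {ι : Type} (v a b : ι → ℝ) (m N : ℕ) :
    FiniteDimensional ℝ (uspan v a b m N) ∧ Module.finrank ℝ (uspan v a b m N) ≤ (N + 1) * (m * m) := by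
  classical
  let S : Finset (ι → ℝ) := (Finset.range (N + 1) ×ˢ (Finset.range m ×ˢ Finset.range m)).image
    (fun p => v ^ p.1 * a ^ p.2.1 * b ^ p.2.2)
  have hS : uspan v a b m N = Submodule.span ℝ (S : Set (ι → ℝ)) := by
    unfold uspan
    congr 1
    ext f
    simp only [S, Finset.coe_image, Set.mem_image, Finset.mem_coe, Finset.mem_product, Finset.mem_range]
    constructor
    · rintro ⟨i, j, k, hi, hj, hk, rfl⟩; exact ⟨(i, j, k), ⟨by omega, hj, hk⟩, rfl⟩
    · rintro ⟨⟨i, j, k⟩, ⟨hi, hj, hk⟩, rfl⟩; exact ⟨i, j, k, by simp at hi; omega, hj, hk, rfl⟩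
  rw [hS]
  refine ⟨inferInstance, (finrank_span_finset_le_card S).trans ?_⟩
  refine Finset.card_image_le.trans ?_
  simp

/-- elimination: bounded-degree polynomial relation -/
theorem elim {ι : Type} (v a b L H : ι → ℝ) (m c q : ℕ) (hm : 0 < m) (hL : ∀ z, L z ≠ 0)
    (hL1 : MM v a b m c L 1 1) (hH : MM v a b m c L q H) :
    ∃ (K : ℕ) (r : ℕ → Polynomial ℝ), 0 < K ∧ r 0 ≠ 0 ∧ (r 0).natDegree ≤ m ^ 4 * c * q ∧
      ∀ z, H z = 0 ∨ ∑ k ∈ Finset.range K, (r k).eval (v z) * H z ^ k = 0 := by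
  classical
  set K := m * m with hK
  set I := m ^ 4 * c * q with hI
  let F : Fin (I + 1) × Fin (K + 1) → uspan v a b m (c * (q * K) + I) := fun p =>
    ⟨v ^ (p.1 : ℕ) * (L ^ (q * K) * H ^ (p.2 : ℕ)), by
      have h1 : MM v a b m c L (q * K) (H ^ (p.2 : ℕ)) := (hH.pow p.2).raise hL1 (Nat.mul_le_mul_left _ (by omega))
      have h2 := h1 0 1 (by simpa using umem v a b (N := 0) (m := m) (i := 0) (j := 0) (k := 0) le_rfl hm hm)
      have h3 := uspan_v v a b m _ p.1 _ h2
      rw [mul_one] at h3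
      exact uspan_mono v a b m (by omega) h3⟩
  obtain ⟨hfd, hfr⟩ := uspan_finrank v a b m (c * (q * K) + I)
  have hnl : ¬ LinearIndependent ℝ F := by
    intro hl
    have h1 := hl.fintype_card_le_finrank
    have h2 := h1.trans hfr
    simp only [Fintype.card_prod, Fintype.card_fin] at h2
    rw [← hK] at h2
    have h3 : I = K * (c * (q * K)) := by rw [hI, hK]; ring
    nlinarith
  rw [Fintype.not_linearIndependent_iff] at hnl
  obtain ⟨w, hw, ⟨i0, k0⟩, hw0⟩ := hnl
  let r : ℕ → Polynomial ℝ := fun k => if h : k < K + 1 then ∑ i : Fin (I + 1), Polynomial.monomial (i : ℕ) (w (i, ⟨k, h⟩)) else 0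
  have hrd : ∀ k, (r k).natDegree ≤ I := by
    intro k
    by_cases h : k < K + 1
    · simp only [r, h, dif_pos]
      refine Polynomial.natDegree_sum_le_of_forall_le _ _ (fun i _ => ?_)
      exact (Polynomial.natDegree_monomial_le _).trans (by omega)
    · have : r k = 0 := dif_neg h
      simp [this]
  have hrel : ∀ z, ∑ k ∈ Finset.range (K + 1), (r k).eval (v z) * H z ^ k = 0 := by
    intro z
    have h1 := congrFun (congrArg Subtype.val hw) z
    simp only [F, AddSubmonoidClass.coe_finset_sum, Submodule.coe_smul, Finset.sum_apply, Pi.smul_apply, Pi.mul_apply,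
      Pi.pow_apply, smul_eq_mul, ZeroMemClass.coe_zero, Pi.zero_apply] at h1
    have h2 : L z ^ (q * K) * ∑ k ∈ Finset.range (K + 1), (r k).eval (v z) * H z ^ k = 0 := by
      rw [← h1, Fintype.sum_prod_type_right, Finset.mul_sum, Finset.sum_range]
      refine Finset.sum_congr rfl (fun k _ => ?_)
      simp only [r, k.2, dif_pos, Polynomial.eval_finsetSum, Polynomial.eval_monomial]
      rw [Finset.sum_mul, Finset.mul_sum]
      refine Finset.sum_congr rfl (fun i _ => ?_)
      ring
    exact (mul_eq_zero.1 h2).resolve_left (pow_ne_zero _ (hL z))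
  have hex : ∃ k, r k ≠ 0 := by
    refine ⟨k0, fun h0 => hw0 ?_⟩
    have := congrArg (fun p => Polynomial.coeff p (i0 : ℕ)) h0
    simp only [r, k0.2, dif_pos, Polynomial.finsetSum_coeff, Polynomial.coeff_monomial, Polynomial.coeff_zero] at this
    rw [Finset.sum_eq_single i0] at this
    · simpa using this
    · intro i _ hi
      rw [if_neg]
      exact fun h => hi (Fin.ext h)
    · simp
  let j := Nat.find hex
  have hj : r j ≠ 0 := Nat.find_spec hex
  have hjm : ∀ k < j, r k = 0 := fun k hk => by simpa using Nat.find_min hex hk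
  have hjK : j < K + 1 := by
    by_contra h
    exact hj (dif_neg h)
  refine ⟨K + 1 - j, fun k => r (j + k), by omega, by simpa using hj, by simpa using hrd j, fun z => ?_⟩
  by_cases hz : H z = 0
  · exact Or.inl hz
  right
  have h1 := hrel z
  rw [← Finset.sum_range_add_sum_Ico _ hjK.le, Finset.sum_eq_zero (s := Finset.range j), zero_add, Finset.sum_Ico_eq_sum_range] at h1
  · have h2 : H z ^ j * ∑ k ∈ Finset.range (K + 1 - j), (r (j + k)).eval (v z) * H z ^ k = 0 := by
      rw [← h1, Finset.mul_sum]
      refine Finset.sum_congr rfl (fun k _ => ?_)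
      rw [pow_add]; ring
    exact (mul_eq_zero.1 h2).resolve_left (pow_ne_zero _ hz)
  · intro k hk
    rw [hjm k (Finset.mem_range.1 hk)]; simp

lemma xpow_mem {ι : Type} (v a X : ι → ℝ) (p q : ℝ) (hX : X = p • 1 + q • v) (m D i j : ℕ) (hi : i ≤ D) (hj : j < m) :
    a ^ j * X ^ i ∈ Submodule.span ℝ {f | ∃ i j : ℕ, i ≤ D ∧ j < m ∧ f = v ^ i * a ^ j} := by
  have : a ^ j * X ^ i = ∑ k ∈ Finset.range (i + 1), (q ^ k * p ^ (i - k) * (i.choose k)) • (v ^ k * a ^ j) := by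
    rw [hX, add_comm, add_pow, Finset.mul_sum]
    refine Finset.sum_congr rfl (fun k _ => ?_)
    funext z
    simp
    ring
  rw [this]
  refine Submodule.sum_mem _ (fun k hk => Submodule.smul_mem _ _ (Submodule.subset_span ⟨k, j, ?_, hj, rfl⟩))
  have := Finset.mem_range.1 hk
  omega

lemma arel_of {ι : Type} (g : Polynomial ℝ) (e : ℕ) (hd : g.natDegree = e + 2) (v a X Y : ι → ℝ) (p q p' q' : ℝ)
    (hX : X = p • 1 + q • v) (hY : Y = p' • 1 + q' • v) (h : ∀ z, g.eval (a z + X z) - g.eval (a z) = Y z) :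
    ARel v a X (e + 1) (e + 2) := by
  refine ⟨⟨p, q, hX⟩, ?_⟩
  set S := Submodule.span ℝ {f : ι → ℝ | ∃ i j : ℕ, i ≤ e + 2 ∧ j < e + 1 ∧ f = v ^ i * a ^ j} with hS
  have hg0 : g.coeff (e + 2) ≠ 0 := by
    rw [← hd]
    have : g ≠ 0 := by rintro rfl; simp at hd
    simpa using this
  have h1 : ∀ n ≤ e + 1, (a + X) ^ n - a ^ n ∈ S := by
    intro n hn
    rw [add_pow, Finset.sum_range_succ]
    simp only [Nat.sub_self, pow_zero, mul_one, Nat.choose_self, Nat.cast_one, add_sub_cancel_right]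
    refine Submodule.sum_mem _ (fun k hk => ?_)
    have := Finset.mem_range.1 hk
    rw [mul_comm, ← nsmul_eq_mul, ← Nat.cast_smul_eq_nsmul ℝ]
    exact Submodule.smul_mem _ _ (xpow_mem v a X p q hX _ _ _ _ (by omega) (by omega))
  have h2 : (a + X) ^ (e + 2) - a ^ (e + 2) - ((e : ℝ) + 2) • (X * a ^ (e + 1)) ∈ S := by
    rw [add_pow, Finset.sum_range_succ, Finset.sum_range_succ]
    have : ∑ x ∈ Finset.range (e + 1), a ^ x * X ^ (e + 2 - x) * ((e + 2).choose x : ι → ℝ) ∈ S := by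
      refine Submodule.sum_mem _ (fun k hk => ?_)
      have := Finset.mem_range.1 hk
      rw [mul_comm, ← nsmul_eq_mul, ← Nat.cast_smul_eq_nsmul ℝ]
      exact Submodule.smul_mem _ _ (xpow_mem v a X p q hX _ _ _ _ (by omega) (by omega))
    convert this using 1
    have h3 : (e + 2).choose (e + 1) = e + 2 := Nat.choose_succ_self_right (e + 1)
    rw [h3]
    funext z
    simp [show e + 2 - (e + 1) = 1 by omega]
    ring
  have h3 : Y ∈ S := by
    rw [hY]
    refine Submodule.add_mem _ (Submodule.smul_mem _ _ (Submodule.subset_span ⟨0, 0, by omega, by omega, by simp⟩))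
      (Submodule.smul_mem _ _ (Submodule.subset_span ⟨1, 0, by omega, by omega, by simp⟩))
  have h4 : ∑ n ∈ Finset.range (e + 2), g.coeff n • ((a + X) ^ n - a ^ n) ∈ S := by
    refine Submodule.sum_mem _ (fun n hn => Submodule.smul_mem _ _ (h1 n ?_))
    have := Finset.mem_range.1 hn
    omega
  have h5 := Submodule.smul_mem _ (g.coeff (e + 2) * ((e : ℝ) + 2))⁻¹
    (Submodule.sub_mem _ (Submodule.sub_mem _ h3 h4) (Submodule.smul_mem _ (g.coeff (e + 2)) h2))
  convert h5 using 1
  funext z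
  have h6 := h z
  rw [Polynomial.eval_eq_sum_range' (n := e + 3) (by omega), Polynomial.eval_eq_sum_range' (n := e + 3) (by omega),
    Finset.sum_range_succ, Finset.sum_range_succ (n := e + 2)] at h6
  have h7 : (∑ n ∈ Finset.range (e + 2), g.coeff n • ((a + X) ^ n - a ^ n)) z =
     ∑ x ∈ Finset.range (e + 2), g.coeff x * (a z + X z) ^ x - ∑ x ∈ Finset.range (e + 2), g.coeff x * a z ^ x := by
    rw [← Finset.sum_sub_distrib, Finset.sum_apply]
    refine Finset.sum_congr rfl (fun i _ => ?_)
    simp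
    ring
  simp only [Pi.smul_apply, Pi.sub_apply, h7, smul_eq_mul, Pi.mul_apply, Pi.pow_apply, Pi.add_apply]
  have h8 : (e : ℝ) + 2 ≠ 0 := by positivity
  field_simp
  linarith


lemma inv1 (f f' : ℝ → ℝ) (I : Set ℝ) (hI : IsOpen I) (hf : ∀ x ∈ I, HasStrictDerivAt f (f' x) x)
    (h0 : ∀ x ∈ I, f' x ≠ 0) (hinj : Set.InjOn f I) :
    (∀ x ∈ I, HasStrictDerivAt (Function.invFunOn f I) (f' x)⁻¹ (f x)) ∧ IsOpen (f '' I) := by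
  constructor
  · intro x hx
    have h1 := (hf x hx).to_localInverse (h0 x hx)
    refine h1.congr_of_eventuallyEq ?_
    have hc : Filter.Tendsto ((hf x hx).localInverse f (f' x) x (h0 x hx)) (nhds (f x)) (nhds x) := by
      have := h1.hasDerivAt.continuousAt
      have h2 : (hf x hx).localInverse f (f' x) x (h0 x hx) (f x) = x :=
        HasStrictFDerivAt.localInverse_apply_image (hf := (hf x hx).hasStrictFDerivAt_equiv (h0 x hx))
      unfold ContinuousAt at this
      rwa [h2] at this
    have h3 : ∀ᶠ y in nhds (f x), f ((hf x hx).localInverse f (f' x) x (h0 x hx) y) = y :=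
      HasStrictFDerivAt.eventually_right_inverse (hf := (hf x hx).hasStrictFDerivAt_equiv (h0 x hx))
    filter_upwards [h3, hc (hI.mem_nhds hx)] with y hy1 hy2
    have : Function.invFunOn f I (f ((hf x hx).localInverse f (f' x) x (h0 x hx) y)) = (hf x hx).localInverse f (f' x) x (h0 x hx) y :=
      hinj.leftInvOn_invFunOn hy2
    rw [hy1] at this
    exact this.symm
  · rw [isOpen_iff_mem_nhds]
    rintro _ ⟨x, hx, rfl⟩
    rw [← (hf x hx).map_nhds_eq (h0 x hx)]
    exact Filter.image_mem_map (hI.mem_nhds hx)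

/-- bound for the number of cuts -/
def kdeg (e : ℕ) : ℕ := (e + 1) ^ 4 * (e + 2 + 3) * (e + 1 + (e + 1))

lemma zeros_dich (g : Polynomial ℝ) (e : ℕ) (hd : g.natDegree = e + 2) (V : Set ℝ)
    (a1 a2 X1 X2 Y1 Y2 : ℝ → ℝ) (p1 q1 p1' q1' p2 q2 p2' q2' : ℝ)
    (hX1 : ∀ v, X1 v = p1 + q1 * v) (hY1 : ∀ v, Y1 v = p1' + q1' * v)
    (hX2 : ∀ v, X2 v = p2 + q2 * v) (hY2 : ∀ v, Y2 v = p2' + q2' * v)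
    (hX10 : ∀ v ∈ V, X1 v ≠ 0) (hX20 : ∀ v ∈ V, X2 v ≠ 0)
    (h1 : ∀ v ∈ V, g.eval (a1 v + X1 v) - g.eval (a1 v) = Y1 v)
    (h2 : ∀ v ∈ V, g.eval (a2 v + X2 v) - g.eval (a2 v) = Y2 v)
    (hc1 : ContinuousOn a1 V) (hc2 : ContinuousOn a2 V) (H : ℝ → ℝ)
    (hH : ∀ v, H v = g.derivative.eval (a1 v) * g.derivative.eval (a2 v + X2 v) -
      g.derivative.eval (a2 v) * g.derivative.eval (a1 v + X1 v)) :
    ∃ Z : Finset ℝ, Z.card ≤ kdeg e ∧ ∀ v v', Set.Icc v v' ⊆ V → (∀ z ∈ Z, ¬ (v ≤ z ∧ z ≤ v')) →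
      (∀ w ∈ Set.Icc v v', H w = 0) ∨ (∀ w ∈ Set.Icc v v', H w ≠ 0) := by
  let r : (ℝ → ℝ) → (V → ℝ) := fun f z => f z
  have hx1 : r X1 = p1 • 1 + q1 • r id := by funext z; simp [r, hX1]
  have hx2 : r X2 = p2 • 1 + q2 • r id := by funext z; simp [r, hX2]
  have hy1 : r Y1 = p1' • 1 + q1' • r id := by funext z; simp [r, hY1]
  have hy2 : r Y2 = p2' • 1 + q2' • r id := by funext z; simp [r, hY2]
  have A1 : ARel (r id) (r a1) (r X1) (e + 1) (e + 2) := arel_of g e hd _ _ _ _ _ _ _ _ hx1 hy1 (fun z => h1 z z.2)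
  have A2 : ARel (r id) (r a2) (r X2) (e + 1) (e + 2) := arel_of g e hd _ _ _ _ _ _ _ _ hx2 hy2 (fun z => h2 z z.2)
  obtain ⟨m1, mv, ma, mb⟩ := MM_basic _ _ _ _ _ _ _ A1 A2
  have mx1 : MM (r id) (r a1) (r a2) (e + 1) (e + 2 + 3) (r X1 * r X2) 1 (r X1) := by
    have := (m1.smul p1).add (mv.smul q1)
    rwa [← hx1] at this
  have mx2 : MM (r id) (r a1) (r a2) (e + 1) (e + 2 + 3) (r X1 * r X2) 1 (r X2) := by
    have := (m1.smul p2).add (mv.smul q2)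
    rwa [← hx2] at this
  have hgd : g.derivative.natDegree ≤ e + 1 := (Polynomial.natDegree_derivative_le g).trans (by omega)
  have mH : MM (r id) (r a1) (r a2) (e + 1) (e + 2 + 3) (r X1 * r X2) (e + 1 + (e + 1)) (r H) := by
    have t1 := ma.poly m1 g.derivative _ hgd
    have t2 := mb.poly m1 g.derivative _ hgd
    have t3 := (ma.add mx1).poly m1 g.derivative _ hgd
    have t4 := (mb.add mx2).poly m1 g.derivative _ hgd
    have := (t1.mul t4).sub (t2.mul t3)
    convert this using 1
    funext z
    simp [r, hH]
  obtain ⟨K, ρ, hK0, hρ0, hρd, hρ⟩ := elim (r id) (r a1) (r a2) (r X1 * r X2) (r H) _ _ _ (by omega : 0 < e + 1) (fun z => mul_ne_zero (hX10 z z.2) (hX20 z z.2)) m1 mH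
  refine ⟨(ρ 0).roots.toFinset, ?_, ?_⟩
  · refine (Multiset.toFinset_card_le _).trans ((Polynomial.card_roots' _).trans hρd)
  · intro v v' hsub hZ
    have hcH : ContinuousOn H V := by
      have : H = fun v => g.derivative.eval (a1 v) * g.derivative.eval (a2 v + X2 v) -
        g.derivative.eval (a2 v) * g.derivative.eval (a1 v + X1 v) := funext hH
      rw [this]
      have cX1 : ContinuousOn X1 V := by rw [show X1 = fun v => p1 + q1 * v from funext hX1]; fun_prop
      have cX2 : ContinuousOn X2 V := by rw [show X2 = fun v => p2 + q2 * v from funext hX2]; fun_prop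
      have cg : Continuous (fun x => g.derivative.eval x) := g.derivative.continuous
      exact ((cg.comp_continuousOn hc1).mul (cg.comp_continuousOn (hc2.add cX2))).sub
        ((cg.comp_continuousOn hc2).mul (cg.comp_continuousOn (hc1.add cX1)))
    have hcI := hcH.mono hsub
    let F : ℝ → ℝ := fun w => ∑ k ∈ Finset.range K, (ρ k).eval w * H w ^ k
    have hcF : ContinuousOn F (Set.Icc v v') := by
      refine continuousOn_finset_sum _ (fun k _ => ?_)
      exact ((ρ k).continuous.continuousOn).mul (hcI.pow k)
    have hor : ∀ w ∈ Set.Icc v v', H w = 0 ∨ F w = 0 := fun w hw => hρ ⟨w, hsub hw⟩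
    have hnot : ∀ w ∈ Set.Icc v v', ¬ (H w = 0 ∧ F w = 0) := by
      rintro w hw ⟨e1, e2⟩
      have : (ρ 0).eval w = 0 := by
        simp only [F, e1] at e2
        rcases K with _ | K
        · omega
        · rw [Finset.sum_range_succ'] at e2
          simpa using e2
      exact hZ w (by simp [hρ0, this]) hw
    have hpre : IsPreconnected (Set.Icc v v') := isPreconnected_Icc
    by_contra hcon
    push Not at hcon
    obtain ⟨⟨x, hx, hx0⟩, ⟨y, hy, hy0⟩⟩ := hcon
    rw [isPreconnected_closed_iff] at hpre
    have c1 := hcI.preimage_isClosed_of_isClosed isClosed_Icc (isClosed_singleton (x := (0:ℝ)))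
    have c2 := hcF.preimage_isClosed_of_isClosed isClosed_Icc (isClosed_singleton (x := (0:ℝ)))
    obtain ⟨w, hw, hw1, hw2⟩ := hpre _ _ c1 c2 (fun w hw => (hor w hw).imp (fun h => ⟨hw, h⟩) (fun h => ⟨hw, h⟩))
      ⟨y, hy, hy, hy0⟩ ⟨x, hx, hx, (hor x hx).resolve_left hx0⟩
    exact hnot w hw ⟨hw1.2, hw2.2⟩

/-- generic pair lemma -/
lemma alg_pair (g : Polynomial ℝ) (e : ℕ) (hd : g.natDegree = e + 2) (V : Set ℝ) (hV : V.OrdConnected)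
    (a1 a2 X1 X2 Y1 Y2 : ℝ → ℝ) (p1 q1 p1' q1' p2 q2 p2' q2' : ℝ)
    (hX1 : ∀ v, X1 v = p1 + q1 * v) (hY1 : ∀ v, Y1 v = p1' + q1' * v)
    (hX2 : ∀ v, X2 v = p2 + q2 * v) (hY2 : ∀ v, Y2 v = p2' + q2' * v)
    (hX10 : ∀ v ∈ V, X1 v ≠ 0) (hX20 : ∀ v ∈ V, X2 v ≠ 0)
    (h1 : ∀ v ∈ V, g.eval (a1 v + X1 v) - g.eval (a1 v) = Y1 v)
    (h2 : ∀ v ∈ V, g.eval (a2 v + X2 v) - g.eval (a2 v) = Y2 v)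
    (hc1 : ContinuousOn a1 V) (hc2 : ContinuousOn a2 V) (H : ℝ → ℝ)
    (hH : ∀ v, H v = g.derivative.eval (a1 v) * g.derivative.eval (a2 v + X2 v) -
      g.derivative.eval (a2 v) * g.derivative.eval (a1 v + X1 v))
    (Ψ : ℝ → ℝ) (hΨ : ∀ v ∈ V, ∃ D, HasDerivAt Ψ D v ∧ (D = 0 ↔ H v = 0))
    (hnc : ∀ v v', v < v' → Set.Icc v v' ⊆ V → (∀ w ∈ Set.Icc v v', Ψ w = Ψ v) → False) :
    ∃ Z : Finset ℝ, Z.card ≤ kdeg e ∧ ∀ v v', v < v' → v ∈ V → v' ∈ V → (∀ z ∈ Z, ¬ (v ≤ z ∧ z ≤ v')) →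
      Ψ v ≠ Ψ v' := by
  obtain ⟨Z, hZ, hZ'⟩ := zeros_dich g e hd V a1 a2 X1 X2 Y1 Y2 p1 q1 p1' q1' p2 q2 p2' q2' hX1 hY1 hX2 hY2
    hX10 hX20 h1 h2 hc1 hc2 H hH
  refine ⟨Z, hZ, fun v v' hvv hv hv' hz heq => ?_⟩
  have hsub : Set.Icc v v' ⊆ V := hV.out hv hv'
  have hcont : ContinuousOn Ψ (Set.Icc v v') := by
    intro w hw
    obtain ⟨D, hD, _⟩ := hΨ w (hsub hw)
    exact hD.continuousAt.continuousWithinAt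
  rcases hZ' v v' hsub hz with h | h
  · refine hnc v v' hvv hsub (fun w hw => ?_)
    rcases hw.1.eq_or_lt with h0 | h0
    · rw [h0]
    by_contra hne
    obtain ⟨ξ, hξ, hξ'⟩ := exists_deriv_eq_slope Ψ h0 (hcont.mono (Set.Icc_subset_Icc_right hw.2)) (by
      intro u hu
      obtain ⟨D, hD, _⟩ := hΨ u (hsub ⟨hu.1.le, hu.2.le.trans hw.2⟩)
      exact hD.differentiableAt.differentiableWithinAt)
    have hm : ξ ∈ Set.Icc v v' := ⟨hξ.1.le, hξ.2.le.trans hw.2⟩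
    obtain ⟨D, hD, hD0⟩ := hΨ ξ (hsub hm)
    rw [hD.deriv, hD0.2 (h ξ hm), eq_comm, div_eq_zero_iff] at hξ'
    rcases hξ' with h3 | h3
    · exact hne (by linarith)
    · linarith
  · obtain ⟨ξ, hξ, hξ'⟩ := exists_deriv_eq_zero hvv hcont heq
    have hm : ξ ∈ Set.Icc v v' := ⟨hξ.1.le, hξ.2.le⟩
    obtain ⟨D, hD, hD0⟩ := hΨ ξ (hsub hm)
    rw [hD.deriv] at hξ'
    exact h ξ hm (hD0.1 hξ')


lemma range_inf_of_inj {v v' : ℝ} (h : v < v') (x : ℝ → ℝ) (hx : Set.InjOn x (Set.Icc v v')) :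
    (Set.range (fun z : Set.Icc v v' => x z)).Infinite := by
  have : Set.range (fun z : Set.Icc v v' => x z) = x '' Set.Icc v v' := by
    rw [Set.image_eq_range]
  rw [this]
  exact (Set.infinite_image_iff hx).2 (Set.Icc_infinite h)

theorem good_fwd (g : Polynomial ℝ) (e : ℕ) (hd : g.natDegree = e + 2) (J : Set ℝ) (hJ : Cvx g J) :
    Good J (fun x => g.eval x) (kdeg e) := by
  refine ⟨hJ.smono, hJ.ord, ?_, ?_⟩
  · intro t t' s hs htt h1 h2
    rcases htt.eq_or_lt with rfl | h
    · exact le_rfl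
    · have := hJ.incr (x := t - s) (x' := t' - s) hs h1 (by simpa using h2) (by linarith)
      simp at this
      exact this.le
  set I : ℝ → Set ℝ := fun s => {t | t ∈ J ∧ t - s ∈ J} with hI
  set f : ℝ → ℝ → ℝ := fun s t => g.eval (t - s) - g.eval t with hf
  set φ : ℝ → ℝ → ℝ := fun s => Function.invFunOn (f s) (I s) with hφ
  have hIo : ∀ s, IsOpen (I s) := fun s => hJ.op.inter (hJ.op.preimage (continuous_id.sub continuous_const))
  have hIc : ∀ s, (I s).OrdConnected := by
    intro s
    refine ⟨fun a ha b hb z hz => ⟨hJ.ord.out ha.1 hb.1 hz, hJ.ord.out ha.2 hb.2 ⟨?_, ?_⟩⟩⟩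
    · linarith [hz.1]
    · linarith [hz.2]
  have hfd : ∀ s, ∀ t, HasStrictDerivAt (f s) (g.derivative.eval (t - s) - g.derivative.eval t) t := by
    intro s t
    have h1 : HasStrictDerivAt (fun t => g.eval (t - s)) (g.derivative.eval (t - s) * 1) t :=
      HasStrictDerivAt.comp (h := fun x => x - s) (h₂ := fun x => g.eval x) t (g.hasStrictDerivAt (t - s)) ((hasStrictDerivAt_id t).sub_const s)
    rw [mul_one] at h1
    exact h1.sub (g.hasStrictDerivAt t)
  have hneg : ∀ s, 0 < s → ∀ t ∈ I s, g.derivative.eval (t - s) - g.derivative.eval t < 0 := by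
    intro s hs t ht
    have := hJ.smono1 ht.2 ht.1 (by linarith)
    simp only at this
    linarith
  have hinj : ∀ s, 0 < s → Set.InjOn (f s) (I s) := by
    intro s hs
    have : StrictAntiOn (f s) (I s) := by
      intro a ha b hb hab
      have := hJ.incr (x := a - s) (x' := b - s) hs ha.2 (by simpa using hb.1) (by linarith)
      simp at this
      simp only [hf]
      linarith
    exact this.injOn
  have hinv := fun (s : ℝ) (hs : 0 < s) => inv1 (f s) _ (I s) (hIo s) (fun t _ => hfd s t) (fun t ht => (hneg s hs t ht).ne) (hinj s hs)
  have hφm : ∀ s, ∀ v ∈ f s '' I s, φ s v ∈ I s ∧ f s (φ s v) = v := by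
    intro s v hv
    exact ⟨Function.invFunOn_mem hv, Function.invFunOn_eq hv⟩
  have hφd : ∀ s, 0 < s → ∀ v ∈ f s '' I s, HasDerivAt (φ s) (g.derivative.eval (φ s v - s) - g.derivative.eval (φ s v))⁻¹ v := by
    intro s hs v hv
    have := ((hinv s hs).1 _ (hφm s v hv).1).hasDerivAt
    rwa [(hφm s v hv).2] at this
  have hVo : ∀ s, 0 < s → (f s '' I s).OrdConnected := by
    intro s hs
    have h1 : IsPreconnected (I s) := (hIc s).isPreconnected
    have : ContinuousOn (f s) (I s) := fun t _ => (hfd s t).hasDerivAt.continuousAt.continuousWithinAt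
    exact (h1.image _ this).ordConnected
  refine ⟨fun s v => g.eval (φ s v), fun s => f s '' I s, ?_, ?_, ?_⟩
  · intro s1 hs1 s2 hs2 δ1 δ2 hne
    rw [Set.mem_Ioi] at hs1 hs2
    let V : Set ℝ := {v | v - δ1 ∈ f s1 '' I s1 ∧ v - δ2 ∈ f s2 '' I s2}
    have hVc : V.OrdConnected := by
      refine ⟨fun a ha b hb z hz => ⟨(hVo s1 hs1).out ha.1 hb.1 ⟨?_, ?_⟩, (hVo s2 hs2).out ha.2 hb.2 ⟨?_, ?_⟩⟩⟩ <;> linarith [hz.1, hz.2]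
    have dφ : ∀ s δ v, 0 < s → v - δ ∈ f s '' I s → HasDerivAt (fun v => φ s (v - δ))
        (g.derivative.eval (φ s (v - δ) - s) - g.derivative.eval (φ s (v - δ)))⁻¹ v := by
      intro s δ v hs hv
      exact (hφd s hs (v - δ) hv).comp_sub_const v δ
    obtain ⟨Z, hZ, hZ'⟩ := alg_pair g e hd V hVc (fun v => φ s1 (v - δ1) - s1) (fun v => φ s2 (v - δ2) - s2)
      (fun _ => s1) (fun _ => s2) (fun v => - (v - δ1)) (fun v => - (v - δ2)) s1 0 δ1 (-1) s2 0 δ2 (-1)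
      (by intro v; ring) (by intro v; ring) (by intro v; ring) (by intro v; ring)
      (fun _ _ => hs1.ne') (fun _ _ => hs2.ne')
      (by
        intro v hv
        have := (hφm s1 _ hv.1).2
        simp only [hf] at this
        simp only [sub_add_cancel]
        linarith)
      (by
        intro v hv
        have := (hφm s2 _ hv.2).2
        simp only [hf] at this
        simp only [sub_add_cancel]
        linarith)
      (fun v hv => ((dφ s1 δ1 v hs1 hv.1).continuousAt.sub continuousAt_const).continuousWithinAt)
      (fun v hv => ((dφ s2 δ2 v hs2 hv.2).continuousAt.sub continuousAt_const).continuousWithinAt)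
      _ (fun _ => rfl) (fun v => g.eval (φ s1 (v - δ1)) - g.eval (φ s2 (v - δ2)))
      (by
        intro v hv
        have d1 := (g.hasDerivAt (φ s1 (v - δ1))).comp v (dφ s1 δ1 v hs1 hv.1)
        have d2 := (g.hasDerivAt (φ s2 (v - δ2))).comp v (dφ s2 δ2 v hs2 hv.2)
        refine ⟨_, d1.sub d2, ?_⟩
        have n1 := (hneg s1 hs1 _ (hφm s1 _ hv.1).1).ne
        have n2 := (hneg s2 hs2 _ (hφm s2 _ hv.2).1).ne
        simp only [sub_add_cancel]
        rw [sub_eq_zero, sub_eq_zero, ← div_eq_mul_inv, ← div_eq_mul_inv, div_eq_div_iff n1 n2]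
        constructor <;> intro h <;> linarith)
      (by
        intro v v' hvv hsub hcon
        have hinf := range_inf_of_inj hvv (fun v => φ s1 (v - δ1)) (by
          intro a ha b hb hab
          simp only at hab
          have e1 := (hφm s1 _ (hsub ha).1).2
          have e2 := (hφm s1 _ (hsub hb).1).2
          rw [hab] at e1
          linarith)
        have key := nc g e hd J hJ (fun z : Set.Icc v v' => φ s1 (z - δ1)) (fun z : Set.Icc v v' => φ s2 (z - δ2)) hinf
          (-s1) (-s2) (g.eval (φ s1 (v - δ1)) - g.eval (φ s2 (v - δ2)))
          (g.eval (φ s1 (v - δ1)) - g.eval (φ s2 (v - δ2)) + δ2 - δ1)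
          (fun z => (hφm s1 _ (hsub z.2).1).1.1) (fun z => (hφm s2 _ (hsub z.2).2).1.1)
          (fun z => by have := (hφm s1 _ (hsub z.2).1).1.2; rwa [sub_eq_add_neg] at this)
          (fun z => by have := (hφm s2 _ (hsub z.2).2).1.2; rwa [sub_eq_add_neg] at this)
          (fun z => hcon z z.2)
          (fun z => by
            have e0 := hcon z z.2
            have e1 := (hφm s1 _ (hsub z.2).1).2
            have e2 := (hφm s2 _ (hsub z.2).2).2
            simp only [hf, sub_eq_add_neg] at e0 e1 e2 ⊢
            linarith)
        obtain ⟨k1, k2⟩ := key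
        have hss : s1 = s2 := by linarith
        subst hss
        have k3 := k2.resolve_left (by linarith)
        have hm : v ∈ Set.Icc v v' := ⟨le_rfl, hvv.le⟩
        have e1 := hφm s1 _ (hsub hm).1
        have e2 := hφm s1 _ (hsub hm).2
        have e3 : φ s1 (v - δ1) = φ s1 (v - δ2) := hJ.smono.injOn e1.1.1 e2.1.1 (by linarith)
        have e4 := e1.2
        rw [e3, e2.2] at e4
        exact hne (by rw [show δ1 = δ2 by linarith]))
    refine ⟨Z, hZ, fun v v' hvv a1 a2 a3 a4 hz => hZ' v v' hvv ⟨a1, a3⟩ ⟨a2, a4⟩ hz⟩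
  · intro s hs
    refine ⟨hVo s hs, fun v hv => ?_⟩
    exact (g.continuous.continuousAt.comp (hφd s hs v hv).continuousAt).continuousWithinAt
  · intro s t hs ht hts
    have hm : t ∈ I s := ⟨ht, hts⟩
    refine ⟨⟨t, hm, rfl⟩, ?_⟩
    have : φ s (f s t) = t := (hinj s hs).leftInvOn_invFunOn hm
    show g.eval (φ s (f s t)) = g.eval t
    rw [this]


lemma Cvx.gap {g : Polynomial ℝ} {J : Set ℝ} (h : Cvx g J) {x y x' y' s : ℝ} (hs : 0 < s) (hx : x ∈ J) (hy : y ∈ J)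
    (hx' : x' ∈ J) (hy' : y' ∈ J) (hxx : x < x') (h1 : g.eval y = g.eval x + s) (h2 : g.eval y' = g.eval x' + s) :
    y' - x' < y - x := by
  by_contra hle
  push Not at hle
  have hxy : x < y := (h.smono.lt_iff_lt hx hy).1 (by linarith)
  have hm : x' + (y - x) ∈ J := h.ord.out hx' hy' ⟨by linarith, by linarith⟩
  have h3 := h.incr (s := y - x) (by linarith) hx hm hxx
  have h4 := h.smono.monotoneOn hm hy' (by linarith)
  simp only [add_sub_cancel] at h3 h4
  linarith

theorem good_inv (g : Polynomial ℝ) (e : ℕ) (hd : g.natDegree = e + 2) (J : Set ℝ) (hJ : Cvx g J) :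
    Good {t | -t ∈ (fun x => g.eval x) '' J} (fun t => - Function.invFunOn (fun x => g.eval x) J (-t)) (kdeg e) := by
  set G : Set ℝ := (fun x => g.eval x) '' J with hG
  set γ := Function.invFunOn (fun x => g.eval x) J with hγ
  obtain ⟨hγd, hGo⟩ := inv1 (fun x => g.eval x) (fun x => g.derivative.eval x) J hJ.op (fun x _ => g.hasStrictDerivAt x)
    (fun x hx => (hJ.d1 x hx).ne') hJ.smono.injOn
  have hγm : ∀ u ∈ G, γ u ∈ J ∧ g.eval (γ u) = u := fun u hu => ⟨Function.invFunOn_mem hu, Function.invFunOn_eq (f := fun x => g.eval x) hu⟩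
  have hγg : ∀ x ∈ J, γ (g.eval x) = x := fun x hx => hJ.smono.injOn.leftInvOn_invFunOn hx
  have hGc : G.OrdConnected := (hJ.ord.isPreconnected.image _ g.continuous.continuousOn).ordConnected
  have hγs : ∀ u ∈ G, ∀ u' ∈ G, u < u' → γ u < γ u' := by
    intro u hu u' hu' huu
    refine (hJ.smono.lt_iff_lt (hγm u hu).1 (hγm u' hu').1).1 ?_
    simp only [(hγm u hu).2, (hγm u' hu').2]
    exact huu
  refine ⟨?_, ?_, ?_, ?_⟩
  · intro t ht t' ht' htt
    have := hγs _ ht' _ ht (by linarith : -t' < -t)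
    simp only
    linarith
  · refine ⟨fun a ha b hb z hz => ?_⟩
    exact hGc.out hb ha ⟨by linarith [hz.2], by linarith [hz.1]⟩
  · intro t t' s hs htt h1 h2
    rcases htt.eq_or_lt with rfl | h
    · exact le_rfl
    rw [Set.mem_ofPred_eq] at h1 h2
    have m1 : -t ∈ G := hGc.out h2 h1 ⟨by linarith, by linarith⟩
    have m2 : -(t' - s) ∈ G := hGc.out h2 h1 ⟨by linarith, by linarith⟩
    have := hJ.gap (x := γ (-t')) (y := γ (-(t' - s))) (x' := γ (-t)) (y' := γ (-(t - s))) hs (hγm _ h2).1 (hγm _ m2).1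
      (hγm _ m1).1 (hγm _ h1).1 (hγs _ h2 _ m1 (by linarith)) (by rw [(hγm _ h2).2, (hγm _ m2).2]; ring)
      (by rw [(hγm _ m1).2, (hγm _ h1).2]; ring)
    linarith
  set I : ℝ → Set ℝ := fun s => {x | x ∈ J ∧ g.eval x + s ∈ G} with hI
  set f : ℝ → ℝ → ℝ := fun s x => x - γ (g.eval x + s) with hf
  set φ : ℝ → ℝ → ℝ := fun s => Function.invFunOn (f s) (I s) with hφ
  have hIo : ∀ s, IsOpen (I s) := fun s => hJ.op.inter (hGo.preimage (g.continuous.add continuous_const))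
  have hIc : ∀ s, (I s).OrdConnected := by
    intro s
    refine ⟨fun a ha b hb z hz => ?_⟩
    have hzJ := hJ.ord.out ha.1 hb.1 hz
    refine ⟨hzJ, hGc.out ha.2 hb.2 ⟨?_, ?_⟩⟩
    · have := hJ.smono.monotoneOn ha.1 hzJ hz.1
      linarith
    · have := hJ.smono.monotoneOn hzJ hb.1 hz.2
      linarith
  have hfd : ∀ s, ∀ x ∈ I s, HasStrictDerivAt (f s) (1 - (g.derivative.eval (γ (g.eval x + s)))⁻¹ * g.derivative.eval x) x := by
    intro s x hx
    have h1 := hγd (γ (g.eval x + s)) (hγm _ hx.2).1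
    simp only [(hγm _ hx.2).2] at h1
    have h2 : HasStrictDerivAt (fun x => γ (g.eval x + s)) _ x :=
      HasStrictDerivAt.comp (h := fun x => g.eval x + s) (h₂ := γ) x h1 ((g.hasStrictDerivAt x).add_const s)
    exact (hasStrictDerivAt_id x).sub h2
  have hne0 : ∀ s, 0 < s → ∀ x ∈ I s, (1 - (g.derivative.eval (γ (g.eval x + s)))⁻¹ * g.derivative.eval x) ≠ 0 := by
    intro s hs x hx h0
    have hy := hγm _ hx.2
    have hlt : x < γ (g.eval x + s) := (hJ.smono.lt_iff_lt hx.1 hy.1).1 (by simp only [hy.2]; linarith)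
    have h1 := hJ.smono1 hx.1 hy.1 hlt
    have h2 := hJ.d1 _ hy.1
    simp only at h1
    field_simp at h0
    linarith
  have hinj : ∀ s, 0 < s → Set.InjOn (f s) (I s) := by
    intro s hs
    have : StrictMonoOn (f s) (I s) := by
      intro a ha b hb hab
      have := hJ.gap hs ha.1 (hγm _ ha.2).1 hb.1 (hγm _ hb.2).1 hab (hγm _ ha.2).2 (hγm _ hb.2).2
      simp only [hf]
      linarith
    exact this.injOn
  have hinv := fun (s : ℝ) (hs : 0 < s) => inv1 (f s) _ (I s) (hIo s) (fun t ht => hfd s t ht) (fun t ht => (hne0 s hs t ht)) (hinj s hs)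
  have hφm : ∀ s, ∀ v ∈ f s '' I s, φ s v ∈ I s ∧ f s (φ s v) = v := by
    intro s v hv
    exact ⟨Function.invFunOn_mem hv, Function.invFunOn_eq hv⟩
  have hφd : ∀ s, 0 < s → ∀ v ∈ f s '' I s, HasDerivAt (φ s) (1 - (g.derivative.eval (φ s v - v))⁻¹ * g.derivative.eval (φ s v))⁻¹ v := by
    intro s hs v hv
    have := ((hinv s hs).1 _ (hφm s v hv).1).hasDerivAt
    rw [(hφm s v hv).2] at this
    have h3 : γ (g.eval (φ s v) + s) = φ s v - v := by
      have := (hφm s v hv).2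
      simp only [hf] at this
      linarith
    rwa [h3] at this
  have hy : ∀ s, ∀ v ∈ f s '' I s, φ s v - v ∈ J ∧ g.eval (φ s v - v) = g.eval (φ s v) + s := by
    intro s v hv
    have h3 : γ (g.eval (φ s v) + s) = φ s v - v := by
      have := (hφm s v hv).2
      simp only [hf] at this
      linarith
    rw [← h3]
    exact hγm _ (hφm s v hv).1.2
  have hVo : ∀ s, 0 < s → (f s '' I s).OrdConnected := by
    intro s hs
    have h1 : IsPreconnected (I s) := (hIc s).isPreconnected
    have : ContinuousOn (f s) (I s) := fun t ht => (hfd s t ht).hasDerivAt.continuousAt.continuousWithinAt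
    exact (h1.image _ this).ordConnected
  refine ⟨fun s v => - φ s v, fun s => f s '' I s, ?_, ?_, ?_⟩
  · intro s1 hs1 s2 hs2 δ1 δ2 hne
    rw [Set.mem_Ioi] at hs1 hs2
    let V : Set ℝ := {v | v - δ1 ∈ f s1 '' I s1 ∧ v - δ2 ∈ f s2 '' I s2}
    have hVc : V.OrdConnected := by
      refine ⟨fun a ha b hb z hz => ⟨(hVo s1 hs1).out ha.1 hb.1 ⟨?_, ?_⟩, (hVo s2 hs2).out ha.2 hb.2 ⟨?_, ?_⟩⟩⟩ <;> linarith [hz.1, hz.2]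
    have dφ : ∀ s δ v, 0 < s → v - δ ∈ f s '' I s → HasDerivAt (fun v => φ s (v - δ))
        (1 - (g.derivative.eval (φ s (v - δ) - (v - δ)))⁻¹ * g.derivative.eval (φ s (v - δ)))⁻¹ v := by
      intro s δ v hs hv
      exact (hφd s hs (v - δ) hv).comp_sub_const v δ
    have hX : ∀ s δ v, 0 < s → v - δ ∈ f s '' I s → -(v - δ) ≠ 0 := by
      intro s δ v hs hv h0
      have := (hy s _ hv).2
      rw [show v - δ = 0 by linarith, sub_zero] at this
      linarith
    have hne1 : ∀ s δ v, 0 < s → v - δ ∈ f s '' I s →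
        (1 - (g.derivative.eval (φ s (v - δ) - (v - δ)))⁻¹ * g.derivative.eval (φ s (v - δ))) ≠ 0 ∧
         g.derivative.eval (φ s (v - δ) - (v - δ)) ≠ 0 := by
      intro s δ v hs hv
      refine ⟨?_, (hJ.d1 _ (hy s _ hv).1).ne'⟩
      have h3 : γ (g.eval (φ s (v - δ)) + s) = φ s (v - δ) - (v - δ) := by
        have := (hφm s _ hv).2
        simp only [hf] at this
        linarith
      have := hne0 s hs _ (hφm s _ hv).1
      rwa [h3] at this
    obtain ⟨Z, hZ, hZ'⟩ := alg_pair g e hd V hVc (fun v => φ s1 (v - δ1)) (fun v => φ s2 (v - δ2))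
      (fun v => - (v - δ1)) (fun v => - (v - δ2)) (fun _ => s1) (fun _ => s2) δ1 (-1) s1 0 δ2 (-1) s2 0
      (by intro v; ring) (by intro v; ring) (by intro v; ring) (by intro v; ring)
      (fun v hv => hX s1 δ1 v hs1 hv.1) (fun v hv => hX s2 δ2 v hs2 hv.2)
      (by
        intro v hv
        have := (hy s1 _ hv.1).2
        rw [sub_eq_add_neg] at this
        linarith)
      (by
        intro v hv
        have := (hy s2 _ hv.2).2
        rw [sub_eq_add_neg] at this
        linarith)
      (fun v hv => (dφ s1 δ1 v hs1 hv.1).continuousAt.continuousWithinAt)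
      (fun v hv => (dφ s2 δ2 v hs2 hv.2).continuousAt.continuousWithinAt)
      _ (fun _ => rfl) (fun v => - φ s1 (v - δ1) - - φ s2 (v - δ2))
      (by
        intro v hv
        refine ⟨_, (dφ s1 δ1 v hs1 hv.1).neg.sub (dφ s2 δ2 v hs2 hv.2).neg, ?_⟩
        have n1 := hne1 s1 δ1 v hs1 hv.1
        have n2 := hne1 s2 δ2 v hs2 hv.2
        have m1 := n1.2
        have m2 := n2.2
        simp only [← sub_eq_add_neg]
        rw [sub_eq_zero, neg_inj, inv_inj, sub_right_inj, sub_eq_zero, inv_mul_eq_div, inv_mul_eq_div, div_eq_div_iff m1 m2])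
      (by
        intro v v' hvv hsub hcon
        have hdiff : ∀ w ∈ Set.Icc v v', φ s2 (w - δ2) = φ s1 (w - δ1) - (φ s1 (v - δ1) - φ s2 (v - δ2)) := by
          intro w hw
          have := hcon w hw
          linarith
        have hinf := range_inf_of_inj hvv (fun v => φ s1 (v - δ1) - (v - δ1)) (by
          intro a ha b hb hab
          simp only at hab
          have e1 := (hy s1 _ (hsub ha).1).2
          have e2 := (hy s1 _ (hsub hb).1).2
          rw [hab] at e1
          have e3 : φ s1 (a - δ1) = φ s1 (b - δ1) :=
            hJ.smono.injOn (hφm s1 _ (hsub ha).1).1.1 (hφm s1 _ (hsub hb).1).1.1 (by linarith)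
          linarith)
        have key := nc g e hd J hJ (fun z : Set.Icc v v' => φ s1 (z - δ1) - (z - δ1)) (fun z : Set.Icc v v' => φ s1 (z - δ1)) hinf
          (δ2 - δ1 - (φ s1 (v - δ1) - φ s2 (v - δ2))) (-(φ s1 (v - δ1) - φ s2 (v - δ2))) s1 s2
          (fun z => (hy s1 _ (hsub z.2).1).1) (fun z => (hφm s1 _ (hsub z.2).1).1.1)
          (fun z => by
            have := (hy s2 _ (hsub z.2).2).1
            rw [hdiff z z.2] at this
            convert this using 1
            ring)
          (fun z => by
            have := (hφm s2 _ (hsub z.2).2).1.1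
            rw [hdiff z z.2] at this
            convert this using 1; ring)
          (fun z => by linarith [(hy s1 _ (hsub z.2).1).2])
          (fun z => by
            have e1 := (hy s2 _ (hsub z.2).2).2
            rw [hdiff z z.2] at e1
            have e2 : φ s1 (z - δ1) - (z - δ1) + (δ2 - δ1 - (φ s1 (v - δ1) - φ s2 (v - δ2))) =
              φ s1 (z - δ1) - (φ s1 (v - δ1) - φ s2 (v - δ2)) - (z - δ2) := by ring
            rw [e2, e1, ← sub_eq_add_neg]
            ring)
        obtain ⟨k1, k2⟩ := key
        have k3 := k2.resolve_right hs1.ne'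
        have hm : v ∈ Set.Icc v v' := ⟨le_rfl, hvv.le⟩
        have hδ : δ1 = δ2 := by linarith
        have hφφ : φ s1 (v - δ1) = φ s2 (v - δ2) := by linarith
        have e1 := (hy s1 _ (hsub hm).1).2
        have e2 := (hy s2 _ (hsub hm).2).2
        rw [hφφ, hδ] at e1
        exact hne (by rw [hδ, show s1 = s2 by linarith]))
    refine ⟨Z, hZ, fun v v' hvv a1 a2 a3 a4 hz => hZ' v v' hvv ⟨a1, a3⟩ ⟨a2, a4⟩ hz⟩
  · intro s hs
    refine ⟨hVo s hs, fun v hv => ?_⟩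
    exact (hφd s hs v hv).continuousAt.neg.continuousWithinAt
  · intro s t hs ht hts
    rw [Set.mem_ofPred_eq] at ht hts
    have hx := hγm _ ht
    have hm : γ (-t) ∈ I s := ⟨hx.1, by rw [hx.2]; convert hts using 1; ring⟩
    have hv : - γ (-(t - s)) - - γ (-t) = f s (γ (-t)) := by
      simp only [hf, hx.2]
      rw [show -(t - s) = -t + s by ring]
      ring
    refine ⟨?_, ?_⟩
    · simp only [hv]
      exact ⟨_, hm, rfl⟩
    · simp only [hv]
      have : φ s (f s (γ (-t))) = γ (-t) := (hinj s hs).leftInvOn_invFunOn hm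
      rw [this]


lemma opt_real (q A b a3 : ℝ) (hq : 0 < q) (hA : 0 < A) (hb : 0 < b) (ha : 0 < a3)
    (h : ∀ r : ℕ, 0 < r → 3 * q / 4 ≤ A * b * r + a3 / (b * r) ^ 2) :
    q ≤ 8 * A * b ∨ q ^ 3 ≤ 128 * A ^ 2 * a3 := by
  by_cases hc : q ≤ 8 * A * b
  · exact Or.inl hc
  right
  push Not at hc
  have hAb : 0 < A * b := mul_pos hA hb
  set x := q / (4 * (A * b)) with hx
  have hx2 : 2 ≤ x := by
    rw [hx, le_div_iff₀ (by positivity)]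
    linarith
  have hr0 : 0 < ⌊x⌋₊ := Nat.floor_pos.2 (by linarith)
  have h1 := h ⌊x⌋₊ hr0
  have hr1 : (⌊x⌋₊ : ℝ) ≤ x := Nat.floor_le (by linarith)
  have hr2 : x / 2 ≤ (⌊x⌋₊ : ℝ) := by
    have := Nat.lt_floor_add_one x
    linarith
  have hxq : A * b * x = q / 4 := by
    rw [hx]; field_simp
  have h2 : A * b * (⌊x⌋₊ : ℝ) ≤ q / 4 := by
    rw [← hxq]; gcongr
  have h3 : q / 2 ≤ a3 / (b * (⌊x⌋₊ : ℝ)) ^ 2 := by linarith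
  have h4 : a3 / (b * (⌊x⌋₊ : ℝ)) ^ 2 ≤ a3 / (b * (x / 2)) ^ 2 := by
    gcongr
  have h5 : b * (x / 2) = q / (8 * A) := by
    rw [hx]; field_simp; ring
  rw [h5] at h4
  have h6 : a3 / (q / (8 * A)) ^ 2 = 64 * A ^ 2 * a3 / q ^ 2 := by
    field_simp; ring
  rw [h6] at h4
  have h7 := h3.trans h4
  rw [div_le_div_iff₀ (by norm_num) (by positivity)] at h7
  nlinarith

lemma opt_pieces (q p d d' y lg A a3 Λ b n G M τ t Δ τD τP r : ℝ) (hbR : 0 < b) (hnR : 0 < n) (hGR : 0 < G) (hMR : 0 < M)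
    (hyR : 0 < y) (hlg0 : 0 < lg) (hq0 : 0 < q) (hp0 : 0 < p) (hd0 : 0 < d) (hd'0 : 0 < d') (hrR : 0 < r) (ht : 0 ≤ t) (hΔ0 : 0 ≤ Δ)
    (hτD : 0 ≤ τD) (hτP : 0 ≤ τP) (hΛ1 : 2 ^ 40 ≤ Λ) (hΛ2 : t + 1 ≤ Λ) (hc1 : Λ ^ 2 * Δ * p ^ 2 < q * b) (hc2 : Λ * p < q)
    (hdd : d ≤ 2 * d') (hdd' : d' ≤ d) (htau : τ * b * n ≤ 512 * G * y * M) (hA : A = 8192 * lg * G * y ^ 2 * M / (n * d))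
    (hA0 : 0 < A) (ha3 : a3 = 8 * (t + 1) * d * p ^ 2) (e4r : τD ≤ 2 * d' / b) (e5r : τP ≤ 2 * p / b)
    (h2 : d' * q * r ^ 2 ≤ 2 * (d' * p * (2 * (t * Δ * τP) + 1) * r ^ 2 +
        lg * (y * τ * ((2 * b) * (2 * b))) * r ^ 3 + (t + 1) * (τD * τP * (d' * p)))) :
    3 * q / 4 ≤ A * b * r + a3 / (b * r) ^ 2 := by
  have hΛ0 : 0 < Λ := by linarith [show (0 : ℝ) < 2 ^ 40 by norm_num]
  -- bound pieces
  have f1 : d' * p * (2 * (t * Δ * τP) + 1) * r ^ 2 ≤ d' * r ^ 2 * (q / 8) := by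
    have g1 : 64 * (t * Δ * p ^ 2) ≤ q * b := by
      have : (64 : ℝ) * t ≤ Λ ^ 2 := by
        have : (64 : ℝ) ≤ Λ := by linarith
        nlinarith
      have h3 : 64 * t * (Δ * p ^ 2) ≤ Λ ^ 2 * (Δ * p ^ 2) := by gcongr
      linarith
    have g2 : 2 * (t * Δ * τP) * p ≤ q / 16 := by
      have : 2 * (t * Δ * τP) * p ≤ 2 * (t * Δ * (2 * p / b)) * p := by gcongr
      refine this.trans ?_
      rw [show 2 * (t * Δ * (2 * p / b)) * p = 4 * (t * Δ * p ^ 2) / b by ring, div_le_iff₀ hbR]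
      linarith
    have g3 : p ≤ q / 16 := by
      have : (16:ℝ) * p ≤ Λ * p := by
        have : (16:ℝ) ≤ Λ := by linarith
        gcongr
      linarith
    have : p * (2 * (t * Δ * τP) + 1) ≤ q / 8 := by linarith
    calc d' * p * (2 * (t * Δ * τP) + 1) * r ^ 2 = d' * r ^ 2 * (p * (2 * (t * Δ * τP) + 1)) := by ring
      _ ≤ _ := by gcongr
  have f2 : lg * (y * τ * ((2 * b) * (2 * b))) * r ^ 3 ≤ d' * r ^ 2 * (A * b * r / 2) := by
    have g1 : y * τ * ((2 * b) * (2 * b)) * n ≤ 4 * y * b * (512 * G * y * M) := by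
      have : 4 * y * b * (τ * b * n) ≤ 4 * y * b * (512 * G * y * M) := by gcongr
      linarith
    have g2 : A * d' ≥ 4096 * lg * G * y ^ 2 * M / n := by
      rw [hA, ge_iff_le, div_mul_eq_mul_div, div_le_div_iff₀ hnR (by positivity)]
      have : 4096 * lg * G * y ^ 2 * M * n * d ≤ 4096 * lg * G * y ^ 2 * M * n * (2 * d') := by gcongr
      linarith
    have g3 : lg * (y * τ * ((2 * b) * (2 * b))) ≤ A * d' * b / 2 := by
      have : y * τ * ((2 * b) * (2 * b)) ≤ 4 * y * b * (512 * G * y * M) / n := by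
        rw [le_div_iff₀ hnR]; exact g1
      calc lg * (y * τ * ((2 * b) * (2 * b))) ≤ lg * (4 * y * b * (512 * G * y * M) / n) := by gcongr
        _ = (4096 * lg * G * y ^ 2 * M / n) * b / 2 := by ring
        _ ≤ A * d' * b / 2 := by gcongr
    calc lg * (y * τ * ((2 * b) * (2 * b))) * r ^ 3 ≤ (A * d' * b / 2) * r ^ 3 := by gcongr
      _ = _ := by ring
  have f3 : (t + 1) * (τD * τP * (d' * p)) ≤ d' * r ^ 2 * (a3 / (b * r) ^ 2 / 2) := by
    have : (t + 1) * (τD * τP * (d' * p)) ≤ (t + 1) * ((2 * d' / b) * (2 * p / b) * (d' * p)) := by gcongr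
    refine this.trans ?_
    have : d' * r ^ 2 * (a3 / (b * r) ^ 2 / 2) = d' * (4 * (t + 1) * d * p ^ 2) / b ^ 2 := by
      rw [ha3]; field_simp; ring
    rw [this, show (t + 1) * ((2 * d' / b) * (2 * p / b) * (d' * p)) = d' * (4 * (t + 1) * d' * p ^ 2) / b ^ 2 by ring]
    gcongr
  have h3 : d' * r ^ 2 * q ≤ d' * r ^ 2 * (q / 4 + A * b * r + a3 / (b * r) ^ 2) := by linarith
  have h4 := le_of_mul_le_mul_left h3 (by positivity)
  linarith

set_option maxHeartbeats 1000000 in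
theorem HT_opt (D : Set ℝ) (e : ℝ → ℝ) (t : ℕ) (hg : Good D e t) (T C Y : Finset ℝ)
    (hT : ∀ t ∈ T, t ∈ D) (hY : ∀ t ∈ T, ∀ c ∈ C, e t + c ∈ Y) (M κ τ b G n : ℕ) (hκ0 : 0 < κ) (hτ : 0 < τ) (hb : 0 < b)
    (hTn : T.card = n) (hCn : C.card = n) (hn : 0 < n) (hM0 : 0 < M)
    (hN1 : 256 * G * Y.card * M ≤ n * (τ * b)) (hκb : κ * b ≤ 4 * M) (hN : τ * b * n ≤ 512 * G * Y.card * M) (hGpos : 0 < G)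
    (P : Finset ℝ) (hP : ∀ s ∈ P, 0 < s)
    (Q : Finset (ℝ × ℝ)) (hQ : ∀ q ∈ Q, q.1 ∈ TStar T C Y e M (τ * b) G ∧ q.2 ∈ T ∧
      rk T q.2 / M = rk T q.1 / M ∧ q.1 - q.2 ∈ P)
    (𝒟 : Finset (ℝ × ℝ)) (h𝒟 : ∀ p ∈ 𝒟, p.1 ∈ C ∧ p.2 ∈ C ∧ rk C p.2 / κ = rk C p.1 / κ)
    (h𝒟c : κ * n ≤ 4 * G * 𝒟.card) (Df : Finset ℝ) (hDf : ∀ p ∈ 𝒟, p.2 - p.1 ∈ Df)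
    (hbP : b ≤ P.card) (hbD : 2 * b ≤ 𝒟.card) (Λ : ℝ) (hΛ1 : 2 ^ 40 ≤ Λ) (hΛ2 : (t : ℝ) + 1 ≤ Λ)
    (hΛ3 : 10 * ((Nat.log 2 (Y.card ^ 2) : ℝ) + 1) ≤ Λ) :
    (∃ Δ : ℕ, Δ ≤ Df.card ∧ Δ * n ≤ 2 * Y.card * τ ∧ (Q.card : ℝ) * b ≤ Λ ^ 2 * Δ * (P.card : ℝ) ^ 2) ∨
    (Q.card : ℝ) ≤ Λ * P.card ∨
    (Q.card : ℝ) * n * 𝒟.card ≤ Λ ^ 2 * G * (Y.card : ℝ) ^ 2 * M * b ∨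
    (Q.card : ℝ) ^ 3 * n ^ 2 * 𝒟.card ≤ Λ ^ 4 * (G : ℝ) ^ 2 * (Y.card : ℝ) ^ 4 * M ^ 2 * (P.card : ℝ) ^ 2 := by
  have hκ : 64 * G * κ * Y.card ≤ C.card * τ := by
    rw [hCn]
    have h1 : 64 * G * Y.card * (κ * b) ≤ 64 * G * Y.card * (4 * M) := Nat.mul_le_mul_left _ hκb
    have h2 : (64 * G * κ * Y.card) * b ≤ (n * τ) * b := by nlinarith
    exact Nat.le_of_mul_le_mul_right h2 hb
  obtain ⟨𝒟', Δ, hsub, hcard, hΔ1, hΔ2, hmain⟩ := HT_main D e t hg T C Y hT hY M κ τ b G hκ0 hτ hb hκ hGpos P hP Q hQ 𝒟 h𝒟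
    (by rw [hCn]; exact h𝒟c) Df hDf
  by_cases hc1 : (Q.card : ℝ) * b ≤ Λ ^ 2 * Δ * (P.card : ℝ) ^ 2
  · exact Or.inl ⟨Δ, hΔ1, by rw [← hTn]; exact hΔ2, hc1⟩
  right
  by_cases hc2 : (Q.card : ℝ) ≤ Λ * P.card
  · exact Or.inl hc2
  right
  push Not at hc1 hc2
  have hYpos : 0 < Y.card := by
    have h1 : T.Nonempty := Finset.card_pos.1 (by omega)
    have h2 : C.Nonempty := Finset.card_pos.1 (by omega)
    obtain ⟨a, ha⟩ := h1
    obtain ⟨c, hc⟩ := h2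
    exact Finset.card_pos.2 ⟨_, hY a ha c hc⟩
  have hle' : 𝒟'.card ≤ 𝒟.card := Finset.card_le_card hsub
  have hbD' : b ≤ 𝒟'.card := by omega
  set q : ℝ := (Q.card : ℝ) with hq
  set p : ℝ := (P.card : ℝ) with hp
  set d : ℝ := (𝒟.card : ℝ) with hd
  set y : ℝ := (Y.card : ℝ) with hy
  set lg : ℝ := 10 * ((Nat.log 2 (Y.card ^ 2) : ℝ) + 1) with hlg
  have hbR : (0 : ℝ) < b := by exact_mod_cast hb
  have hpb : (b : ℝ) ≤ p := by rw [hp]; exact_mod_cast hbP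
  have hd'b : (b : ℝ) ≤ (𝒟'.card : ℝ) := by exact_mod_cast hbD'
  have hdd : d ≤ 2 * (𝒟'.card : ℝ) := by rw [hd]; exact_mod_cast hcard
  have hdd' : (𝒟'.card : ℝ) ≤ d := by rw [hd]; exact_mod_cast hle'
  have hd0 : 0 < d := by linarith
  have hp0 : 0 < p := by linarith
  have hΛ0 : 0 < Λ := by linarith [show (0 : ℝ) < 2 ^ 40 by norm_num]
  have hq0 : 0 < q := lt_of_le_of_lt (by positivity) hc2
  have hnR : (0 : ℝ) < n := by exact_mod_cast hn
  have hGR : (0 : ℝ) < G := by exact_mod_cast hGpos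
  have hMR : (0 : ℝ) < M := by exact_mod_cast hM0
  have hyR : 0 < y := by rw [hy]; exact_mod_cast hYpos
  have hlg0 : 0 < lg := by positivity
  have htau : (τ : ℝ) * b * n ≤ 512 * G * y * M := by rw [hy]; exact_mod_cast hN
  set A : ℝ := 8192 * lg * G * y ^ 2 * M / (n * d) with hA
  have hA0 : 0 < A := by positivity
  set a3 : ℝ := 8 * (t + 1) * d * p ^ 2 with ha3
  have ha30 : 0 < a3 := by positivity
  have key : ∀ r : ℕ, 0 < r → 3 * q / 4 ≤ A * b * r + a3 / (b * r) ^ 2 := by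
    intro r hr
    have hrR : (0 : ℝ) < r := by exact_mod_cast hr
    have h0 := hmain (𝒟'.card / b + 1) (P.card / b + 1) r (Nat.succ_pos _) (Nat.succ_pos _) hr
    have e1 : 𝒟'.card / (𝒟'.card / b + 1) ≤ b := by
      refine Nat.div_le_of_le_mul ?_
      have h1 := Nat.div_add_mod 𝒟'.card b
      have h2 := Nat.mod_lt 𝒟'.card hb
      nlinarith
    have e2 : P.card / (P.card / b + 1) ≤ b := by
      refine Nat.div_le_of_le_mul ?_
      have h1 := Nat.div_add_mod P.card b
      have h2 := Nat.mod_lt P.card hb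
      nlinarith
    have e3 : (b + 𝒟'.card / (𝒟'.card / b + 1)) * (b + P.card / (P.card / b + 1)) ≤ (2 * b) * (2 * b) :=
      Nat.mul_le_mul (by linarith) (by linarith)
    have e4 : (𝒟'.card / b + 1) * b ≤ 2 * 𝒟'.card := by
      have := Nat.div_mul_le_self 𝒟'.card b
      nlinarith
    have e5 : (P.card / b + 1) * b ≤ 2 * P.card := by
      have := Nat.div_mul_le_self P.card b
      nlinarith
    have e4r : (((𝒟'.card / b + 1 : ℕ)) : ℝ) ≤ 2 * (𝒟'.card : ℝ) / b := by
      rw [le_div_iff₀ hbR]; exact_mod_cast e4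
    have e5r : (((P.card / b + 1 : ℕ)) : ℝ) ≤ 2 * p / b := by
      rw [le_div_iff₀ hbR]; rw [hp]; exact_mod_cast e5
    set τD := 𝒟'.card / b + 1
    set τP := P.card / b + 1
    have h1 : 𝒟'.card * Q.card * r ^ 2 ≤ 2 * (𝒟'.card * P.card * (2 * (t * Δ * τP) + 1) * r ^ 2 +
        10 * (Nat.log 2 (Y.card ^ 2) + 1) * (Y.card * τ * ((2 * b) * (2 * b))) * r ^ 3
        + (t + 1) * (τD * τP * (𝒟'.card * P.card))) := by
      refine h0.trans ?_
      gcongr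
    have h2 : (𝒟'.card : ℝ) * q * r ^ 2 ≤ 2 * (𝒟'.card * p * (2 * (t * Δ * τP) + 1) * r ^ 2 +
        lg * (y * τ * ((2 * b) * (2 * b))) * r ^ 3
        + (t + 1) * (τD * τP * (𝒟'.card * p))) := by
      rw [hlg, hq, hp, hy]
      exact_mod_cast h1
    exact opt_pieces q p d 𝒟'.card y lg A a3 Λ b n G M τ t Δ τD τP r hbR hnR hGR hMR hyR hlg0 hq0 hp0 hd0 (by linarith) hrR
      (by positivity) (by positivity) (by positivity) (by positivity) hΛ1 hΛ2 hc1 hc2 hdd hdd' htau hA hA0 ha3 e4r e5r h2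
  rcases opt_real q A b a3 hq0 hA0 hbR ha30 key with h | h
  · left
    have : q * (n * d) ≤ 8 * A * b * (n * d) := by gcongr
    have h2 : 8 * A * b * (n * d) = 65536 * lg * G * y ^ 2 * M * b := by
      rw [hA]; field_simp; ring
    rw [h2] at this
    have h3 : 65536 * lg * (G * y ^ 2 * M * b) ≤ Λ * Λ * (G * y ^ 2 * M * b) := by
      have : (65536 : ℝ) ≤ Λ := by linarith
      gcongr
    nlinarith
  · right
    have : q ^ 3 * (n ^ 2 * d) ≤ 128 * A ^ 2 * a3 * (n ^ 2 * d) := by gcongr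
    have h2 : 128 * A ^ 2 * a3 * (n ^ 2 * d) = 2 ^ 36 * lg ^ 2 * (t + 1) * (G ^ 2 * y ^ 4 * M ^ 2 * p ^ 2) := by
      rw [hA, ha3]; field_simp; ring
    rw [h2] at this
    have h3 : 2 ^ 36 * lg ^ 2 * ((t:ℝ) + 1) * (G ^ 2 * y ^ 4 * M ^ 2 * p ^ 2) ≤ Λ * Λ ^ 2 * Λ * (G ^ 2 * y ^ 4 * M ^ 2 * p ^ 2) := by
      have : (2 ^ 36 : ℝ) ≤ Λ := by linarith
      gcongr
    calc q ^ 3 * n ^ 2 * d = q ^ 3 * (n ^ 2 * d) := by ring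
      _ ≤ _ := this.trans h3
      _ = _ := by ring


lemma cs_key {α β : Type} [DecidableEq α] [DecidableEq β] (S : Finset α) (K : Finset β) (φ : α → β) (hφ : ∀ x ∈ S, φ x ∈ K) :
    S.card ^ 2 ≤ K.card * ((S ×ˢ S).filter (fun q => φ q.1 = φ q.2)).card := by
  have h1 : S.card = ∑ k ∈ K, (S.filter (fun x => φ x = k)).card := Finset.card_eq_sum_card_fiberwise hφ
  have h2 : ((S ×ˢ S).filter (fun q => φ q.1 = φ q.2)).card = ∑ k ∈ K, (S.filter (fun x => φ x = k)).card ^ 2 := by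
    rw [Finset.card_eq_sum_card_fiberwise (f := fun q => φ q.1) (t := K)]
    · refine Finset.sum_congr rfl fun k hk => ?_
      rw [sq, ← Finset.card_product]
      congr 1
      ext q
      simp only [Finset.mem_filter, Finset.mem_product]
      constructor
      · rintro ⟨⟨⟨a, b⟩, c⟩, d⟩
        exact ⟨⟨a, d⟩, b, by rw [← c]; exact d⟩
      · rintro ⟨⟨a, b⟩, c, d⟩
        exact ⟨⟨⟨a, c⟩, by rw [b, d]⟩, b⟩
    · intro q hq
      simp only [Finset.coe_filter, Finset.mem_product, Set.mem_ofPred_eq] at hq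
      exact hφ _ hq.1.1
  rw [h2, h1]
  exact sq_sum_le_card_mul_sum_sq

/-- weight of a difference -/
noncomputable def wt (B : Finset ℝ) (bb : ℝ → ℕ) (s : ℝ) : ℕ := (B.filter (fun x => x + s ∈ B ∧ bb (x + s) = bb x)).card

noncomputable def nearQ (T : Finset ℝ) (tb : ℝ → ℕ) (P : Finset ℝ) : Finset (ℝ × ℝ) :=
  (T ×ˢ T).filter (fun q => tb q.2 = tb q.1 ∧ q.1 - q.2 ∈ P)

lemma card_nearQ (T : Finset ℝ) (tb : ℝ → ℕ) (P : Finset ℝ) : (nearQ T tb P).card = ∑ s ∈ P, wt T tb s := by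
  rw [Finset.card_eq_sum_card_fiberwise (f := fun q => q.1 - q.2) (t := P)]
  · refine Finset.sum_congr rfl fun s hs => ?_
    refine Finset.card_bij (fun q _ => q.2) ?_ ?_ ?_
    · intro q hq
      simp only [nearQ, Finset.mem_filter, Finset.mem_product] at hq ⊢
      have : q.2 + s = q.1 := by linarith [hq.2]
      rw [this]
      exact ⟨hq.1.1.2, hq.1.1.1, hq.1.2.1.symm⟩
    · intro q hq q' hq' h
      have h1 := (Finset.mem_filter.1 hq).2
      have h2 := (Finset.mem_filter.1 hq').2
      exact Prod.ext (by linarith) h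
    · intro x hx
      simp only [Finset.mem_filter] at hx
      refine ⟨(x + s, x), ?_, rfl⟩
      simp only [nearQ, Finset.mem_filter, Finset.mem_product, add_sub_cancel_left]
      exact ⟨⟨⟨hx.2.1, hx.1⟩, hx.2.2.symm, hs⟩, trivial⟩
  · intro q hq
    exact (Finset.mem_filter.1 hq).2.2

lemma card_nearQ_le (T : Finset ℝ) (tb : ℝ → ℕ) (P : Finset ℝ) (M : ℕ) (hM : ∀ h, (T.filter (fun t => tb t = h)).card ≤ M) :
    (nearQ T tb P).card ≤ T.card * M := by
  have : nearQ T tb P ⊆ (T ×ˢ T).filter (fun q => tb q.2 = tb q.1) := by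
    intro q hq
    simp only [nearQ, Finset.mem_filter] at hq ⊢
    exact ⟨hq.1, hq.2.1⟩
  refine (Finset.card_le_card this).trans ?_
  refine Finset.card_le_mul_card_image_of_maps_to (f := fun q => q.1) (t := T) ?_ _ ?_ |>.trans (le_of_eq (mul_comm _ _))
  · intro q hq
    exact (Finset.mem_product.1 (Finset.mem_filter.1 hq).1).1
  · intro a ha
    refine le_trans ?_ (hM (tb a))
    refine Finset.card_le_card_of_injOn (fun q => q.2) ?_ ?_
    · intro q hq
      simp only [Finset.coe_filter, Finset.mem_filter, Finset.mem_product, Set.mem_ofPred_eq] at hq ⊢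
      refine ⟨hq.1.1.2, ?_⟩
      rw [hq.1.2, hq.2]
    · intro q hq q' hq' h
      simp only [Finset.coe_filter, Finset.mem_filter, Finset.mem_product, Set.mem_ofPred_eq] at hq hq'
      exact Prod.ext (by rw [hq.2, hq'.2]) h

lemma energy (T B Z : Finset ℝ) (tb bb : ℝ → ℕ) (htb : ∀ x y, x ≤ y → tb x ≤ tb y) (hbb : ∀ x y, x ≤ y → bb x ≤ bb y)
    (I J : ℕ) (hI : ∀ t ∈ T, tb t ≤ I) (hJ : ∀ b ∈ B, bb b ≤ J) (hZ : ∀ t ∈ T, ∀ b ∈ B, t + b ∈ Z) :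
    (T.card * B.card) ^ 2 ≤ Z.card * (I + J + 1) * (T.card * B.card +
      2 * ∑ q ∈ (T ×ˢ T).filter (fun q => tb q.2 = tb q.1 ∧ q.2 < q.1), wt B bb (q.1 - q.2)) := by
  classical
  have h1 := cs_key (T ×ˢ B) (Z ×ˢ Finset.range (I + J + 1)) (fun x => (x.1 + x.2, tb x.1 + (J - bb x.2))) (by
    intro x hx
    rw [Finset.mem_product] at hx ⊢
    refine ⟨hZ _ hx.1 _ hx.2, ?_⟩
    rw [Finset.mem_range]
    have := hI _ hx.1
    simp only
    omega)
  rw [Finset.card_product, Finset.card_product, Finset.card_range] at h1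
  refine h1.trans ?_
  refine Nat.mul_le_mul_left _ ?_
  set Eall := ((T ×ˢ B) ×ˢ T ×ˢ B).filter (fun q => (q.1.1 + q.1.2, tb q.1.1 + (J - bb q.1.2)) = (q.2.1 + q.2.2, tb q.2.1 + (J - bb q.2.2))) with hE
  have hmem : ∀ q ∈ Eall, q.1.1 ∈ T ∧ q.1.2 ∈ B ∧ q.2.1 ∈ T ∧ q.2.2 ∈ B ∧ q.1.1 + q.1.2 = q.2.1 + q.2.2 ∧ tb q.1.1 = tb q.2.1 ∧
      bb q.1.2 = bb q.2.2 := by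
    intro q hq
    simp only [hE, Finset.mem_filter, Finset.mem_product, Prod.mk.injEq] at hq
    obtain ⟨⟨⟨a, b⟩, c, d⟩, e, f⟩ := hq
    refine ⟨a, b, c, d, e, ?_⟩
    have j1 := hJ _ b
    have j2 := hJ _ d
    rcases le_total q.1.1 q.2.1 with h | h
    · have := htb _ _ h
      have := hbb q.2.2 q.1.2 (by linarith)
      omega
    · have := htb _ _ h
      have := hbb q.1.2 q.2.2 (by linarith)
      omega
  let E0 := Eall.filter (fun q => q.1.1 = q.2.1)
  let E1 := Eall.filter (fun q => q.2.1 < q.1.1)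
  let E2 := Eall.filter (fun q => q.1.1 < q.2.1)
  have hsplit : Eall ⊆ E0 ∪ (E1 ∪ E2) := by
    intro q hq
    simp only [E0, E1, E2, Finset.mem_union, Finset.mem_filter]
    rcases lt_trichotomy q.1.1 q.2.1 with h | h | h
    · exact Or.inr (Or.inr ⟨hq, h⟩)
    · exact Or.inl ⟨hq, h⟩
    · exact Or.inr (Or.inl ⟨hq, h⟩)
  have hE0 : E0.card ≤ T.card * B.card := by
    rw [← Finset.card_product]
    refine Finset.card_le_card_of_injOn (fun q => q.1) ?_ ?_
    · intro q hq
      have hq := Finset.mem_filter.1 hq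
      have := hmem q hq.1
      exact Finset.mem_product.2 ⟨this.1, this.2.1⟩
    · intro q hq q' hq' h
      have hq := Finset.mem_filter.1 hq
      have hq' := Finset.mem_filter.1 hq'
      have a := (hmem q hq.1).2.2.2.2.1
      have a' := (hmem q' hq'.1).2.2.2.2.1
      simp only at h
      refine Prod.ext h (Prod.ext ?_ ?_)
      · rw [← hq.2, ← hq'.2, h]
      · have b := hq.2
        have b' := hq'.2
        rw [h] at a b
        linarith
  have hgen : ∀ E : Finset ((ℝ × ℝ) × ℝ × ℝ), (∀ q ∈ E, q.1.1 ∈ T ∧ q.1.2 ∈ B ∧ q.2.1 ∈ T ∧ q.2.2 ∈ B ∧ q.1.1 + q.1.2 = q.2.1 + q.2.2 ∧ tb q.1.1 = tb q.2.1 ∧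
      bb q.1.2 = bb q.2.2 ∧ q.2.1 < q.1.1) → E.card ≤ ∑ q ∈ (T ×ˢ T).filter (fun q => tb q.2 = tb q.1 ∧ q.2 < q.1), wt B bb (q.1 - q.2) := by
    intro E hEE
    rw [Finset.card_eq_sum_card_fiberwise (f := fun q => (q.1.1, q.2.1)) (t := (T ×ˢ T).filter (fun q => tb q.2 = tb q.1 ∧ q.2 < q.1))]
    · refine Finset.sum_le_sum fun s hs => ?_
      refine Finset.card_le_card_of_injOn (fun q => q.1.2) ?_ ?_
      · intro q hq
        have hq := Finset.mem_filter.1 hq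
        have h2 := hEE q hq.1
        rw [← hq.2]
        have : q.1.2 + (q.1.1 - q.2.1) = q.2.2 := by linarith [h2.2.2.2.2.1]
        simp only [Finset.coe_filter, Set.mem_ofPred_eq, this]
        exact ⟨h2.2.1, h2.2.2.2.1, h2.2.2.2.2.2.2.1.symm⟩
      · intro q hq q' hq' h
        have hq := Finset.mem_filter.1 hq
        have hq' := Finset.mem_filter.1 hq'
        have h2 := hEE q hq.1
        have h2' := hEE q' hq'.1
        have e1 := hq.2.trans hq'.2.symm
        simp only [Prod.mk.injEq] at e1 h
        refine Prod.ext (Prod.ext e1.1 h) (Prod.ext e1.2 ?_)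
        linarith [h2.2.2.2.2.1, h2'.2.2.2.2.1]
    · intro q hq
      have h2 := hEE q hq
      simp only [Finset.coe_filter, Set.mem_ofPred_eq, Finset.mem_product]
      exact ⟨⟨h2.1, h2.2.2.1⟩, h2.2.2.2.2.2.1.symm, h2.2.2.2.2.2.2.2⟩
  have hE1 := hgen E1 (by
    intro q hq
    have hq := Finset.mem_filter.1 hq
    have := hmem q hq.1
    exact ⟨this.1, this.2.1, this.2.2.1, this.2.2.2.1, this.2.2.2.2.1, this.2.2.2.2.2.1, this.2.2.2.2.2.2, hq.2⟩)
  have hE2 := hgen (E2.map (Equiv.prodComm _ _).toEmbedding) (by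
    intro q hq
    rw [Finset.mem_map] at hq
    obtain ⟨q', hq', rfl⟩ := hq
    have hq := Finset.mem_filter.1 hq'
    have := hmem q' hq.1
    exact ⟨this.2.2.1, this.2.2.2.1, this.1, this.2.1, this.2.2.2.2.1.symm, this.2.2.2.2.2.1.symm, this.2.2.2.2.2.2.symm, hq.2⟩)
  rw [Finset.card_map] at hE2
  have hc := (Finset.card_le_card hsplit).trans ((Finset.card_union_le _ _).trans (Nat.add_le_add_left (Finset.card_union_le _ _) _))
  omega

lemma wt_le (B : Finset ℝ) (bb : ℝ → ℕ) (s : ℝ) : wt B bb s ≤ B.card := Finset.card_le_card (Finset.filter_subset _ _)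

theorem level (T B Z : Finset ℝ) (tb bb : ℝ → ℕ) (htb : ∀ x y, x ≤ y → tb x ≤ tb y) (hbb : ∀ x y, x ≤ y → bb x ≤ bb y)
    (I J : ℕ) (hI : ∀ t ∈ T, tb t ≤ I) (hJ : ∀ b ∈ B, bb b ≤ J) (hZ : ∀ t ∈ T, ∀ b ∈ B, t + b ∈ Z)
    (hbig : Z.card * (I + J + 1) * (T.card * B.card) * 2 < (T.card * B.card) ^ 2) :
    ∃ (W : ℕ) (P : Finset ℝ), 0 < W ∧ W ≤ B.card ∧ P.Nonempty ∧ (∀ s ∈ P, 0 < s ∧ W ≤ wt B bb s ∧ wt B bb s ≤ 2 * W) ∧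
      (T.card * B.card) ^ 2 ≤ 8 * (Z.card * (I + J + 1)) * ((Nat.log 2 B.card + 1) * ((nearQ T tb P).card * W)) := by
  classical
  have h1 := energy T B Z tb bb htb hbb I J hI hJ hZ
  set Qa := (T ×ˢ T).filter (fun q => tb q.2 = tb q.1 ∧ q.2 < q.1) with hQa
  set w : ℝ × ℝ → ℕ := fun q => wt B bb (q.1 - q.2) with hw
  set Qp := Qa.filter (fun q => w q ≠ 0) with hQp
  have h2 : ∑ q ∈ Qa, w q = ∑ q ∈ Qp, w q := (Finset.sum_filter_ne_zero (s := Qa) (f := w)).symm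
  have h3 : ∑ q ∈ Qp, w q = ∑ j ∈ Finset.range (Nat.log 2 B.card + 1), ∑ q ∈ Qp.filter (fun q => Nat.log 2 (w q) = j), w q := by
    rw [Finset.sum_fiberwise_of_maps_to]
    intro q hq
    rw [Finset.mem_range]
    have := Nat.log_mono_right (b := 2) (wt_le B bb (q.1 - q.2))
    simp only [hw]
    omega
  obtain ⟨j, hj, hj2⟩ := Finset.exists_max_image (Finset.range (Nat.log 2 B.card + 1))
    (fun j => ∑ q ∈ Qp.filter (fun q => Nat.log 2 (w q) = j), w q) ⟨0, by simp⟩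
  have h4 : ∑ q ∈ Qp, w q ≤ (Nat.log 2 B.card + 1) * ∑ q ∈ Qp.filter (fun q => Nat.log 2 (w q) = j), w q := by
    rw [h3]
    have := Finset.sum_le_card_nsmul _ _ _ hj2
    rwa [Finset.card_range, smul_eq_mul] at this
  set Qj := Qp.filter (fun q => Nat.log 2 (w q) = j) with hQj
  have hmem : ∀ q ∈ Qj, q.1 ∈ T ∧ q.2 ∈ T ∧ tb q.2 = tb q.1 ∧ q.2 < q.1 ∧ 2 ^ j ≤ w q ∧ w q < 2 * 2 ^ j := by
    intro q hq
    have a1 := Finset.mem_filter.1 hq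
    have a2 := Finset.mem_filter.1 a1.1
    have a3 := Finset.mem_filter.1 a2.1
    have a4 := Finset.mem_product.1 a3.1
    refine ⟨a4.1, a4.2, a3.2.1, a3.2.2, ?_, ?_⟩
    · rw [← a1.2]
      exact Nat.pow_log_le_self 2 a2.2
    · rw [← a1.2, mul_comm, ← pow_succ]
      exact Nat.lt_pow_succ_log_self (by norm_num) _
  have h5 : ∑ q ∈ Qj, w q ≤ Qj.card * (2 * 2 ^ j) := by
    have := Finset.sum_le_card_nsmul Qj w (2 * 2 ^ j) (fun q hq => (hmem q hq).2.2.2.2.2.le)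
    rwa [smul_eq_mul] at this
  set X := T.card * B.card with hX
  set V := Z.card * (I + J + 1) with hV
  set lg := Nat.log 2 B.card + 1
  have h6 : Qj ⊆ nearQ T tb (Qj.image (fun q => q.1 - q.2)) := by
    intro q hq
    have := hmem q hq
    simp only [nearQ, Finset.mem_filter, Finset.mem_product]
    exact ⟨⟨this.1, this.2.1⟩, this.2.2.1, Finset.mem_image_of_mem _ hq⟩
  have h7 := Finset.card_le_card h6
  rw [h2] at h1
  have h8 : X ^ 2 ≤ 4 * (V * ∑ q ∈ Qp, w q) := by nlinarith
  have h9 : ∑ q ∈ Qp, w q ≤ lg * ((nearQ T tb (Qj.image (fun q => q.1 - q.2))).card * (2 * 2 ^ j)) :=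
    h4.trans (Nat.mul_le_mul_left _ (h5.trans (Nat.mul_le_mul_right _ h7)))
  have hX2 : 0 < X ^ 2 := by omega
  have hQne : Qj.Nonempty := by
    by_contra hc
    rw [Finset.not_nonempty_iff_eq_empty] at hc
    rw [hc, Finset.sum_empty, mul_zero] at h4
    have : ∑ q ∈ Qp, w q = 0 := by omega
    rw [this] at h8
    omega
  refine ⟨2 ^ j, Qj.image (fun q => q.1 - q.2), by positivity, ?_, hQne.image _, ?_, ?_⟩
  · obtain ⟨q, hq⟩ := hQne
    exact (hmem q hq).2.2.2.2.1.trans (wt_le _ _ _)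
  · intro s hs
    obtain ⟨q, hq, rfl⟩ := Finset.mem_image.1 hs
    have := hmem q hq
    exact ⟨by linarith [this.2.2.2.1], this.2.2.2.2.1, this.2.2.2.2.2.le⟩
  · calc X ^ 2 ≤ 4 * (V * ∑ q ∈ Qp, w q) := h8
      _ ≤ 4 * (V * (lg * ((nearQ T tb (Qj.image (fun q => q.1 - q.2))).card * (2 * 2 ^ j)))) := by gcongr
      _ = _ := by ring

lemma top_subset (P : Finset ℝ) (f : ℝ → ℕ) (k : ℕ) (hk : k ≤ P.card) (hk0 : 0 < k) :
    ∃ P' ⊆ P, P'.card = k ∧ k * ∑ s ∈ P, f s ≤ P.card * ∑ s ∈ P', f s := by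
  classical
  obtain ⟨m, hm⟩ := Nat.exists_eq_add_of_le hk
  induction m generalizing P with
  | zero => exact ⟨P, subset_rfl, by omega, by rw [hm]; simp⟩
  | succ m ih =>
    have hne : P.Nonempty := Finset.card_pos.1 (by omega)
    obtain ⟨x, hx, hmin⟩ := Finset.exists_min_image P f hne
    have hc : (P.erase x).card = P.card - 1 := Finset.card_erase_of_mem hx
    obtain ⟨P', h1, h2, h3⟩ := ih (P.erase x) (by omega) (by omega)
    refine ⟨P', h1.trans (Finset.erase_subset _ _), h2, ?_⟩
    have h4 : f x + ∑ s ∈ P.erase x, f s = ∑ s ∈ P, f s := Finset.add_sum_erase P f hx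
    have h5 : (P.erase x).card * f x ≤ ∑ s ∈ P.erase x, f s := by
      have := Finset.card_nsmul_le_sum (P.erase x) f (f x) (fun s hs => hmin s (Finset.mem_of_mem_erase hs))
      rwa [smul_eq_mul] at this
    set a := (P.erase x).card with ha
    set σ := ∑ s ∈ P.erase x, f s
    have ha1 : P.card = a + 1 := by omega
    have ha0 : 0 < a := by omega
    rw [← h4, ha1]
    refine Nat.le_of_mul_le_mul_left ?_ ha0
    have h6 : k * (a * f x) ≤ k * σ := Nat.mul_le_mul_left _ h5
    have h7 : (a + 1) * (k * σ) ≤ (a + 1) * (a * ∑ s ∈ P', f s) := Nat.mul_le_mul_left _ h3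
    nlinarith


set_option maxHeartbeats 1000000 in
theorem BS_main (B P : Finset ℝ) (n M κ W : ℕ) (hn : B.card = n) (hκ : 0 < κ) (hκM : κ ≤ M) (hWn : W ≤ n)
    (hP : ∀ s ∈ P, 0 < s ∧ W ≤ (B.filter (fun x => x + s ∈ B ∧ rk B (x + s) < rk B x + M)).card) :
    ∃ (𝒟 : Finset (ℝ × ℝ)) (H : Finset ℝ), (∀ p ∈ 𝒟, p.1 ∈ B ∧ p.2 ∈ B ∧ rk B p.2 / κ = rk B p.1 / κ ∧ p.2 - p.1 ∈ H) ∧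
      H.card * W ^ 2 ≤ 8 * n ^ 2 * κ ∧ (P.card * W) ^ 2 * κ ≤ 8 * n * M ^ 2 * 𝒟.card := by
  classical
  have hM : 0 < M := by omega
  set p := P.card with hp
  set σ := p * κ / M + 1 with hσ
  have hσ0 : 0 < σ := Nat.succ_pos _
  set blk : ℝ → ℕ := fun x => rk B x / κ with hblk
  set ch : ℝ → ℕ := fun s => rk P s / σ with hch
  set Ω := (B ×ˢ P).filter (fun o => o.1 + o.2 ∈ B ∧ rk B (o.1 + o.2) < rk B o.1 + M) with hΩ
  have hΩm : ∀ o ∈ Ω, o.1 ∈ B ∧ o.2 ∈ P ∧ o.1 + o.2 ∈ B ∧ rk B (o.1 + o.2) < rk B o.1 + M := by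
    intro o ho
    have := Finset.mem_filter.1 ho
    exact ⟨(Finset.mem_product.1 this.1).1, (Finset.mem_product.1 this.1).2, this.2⟩
  have hΩc : p * W ≤ Ω.card := by
    rw [Finset.card_eq_sum_card_fiberwise (f := fun o => o.2) (t := P) (fun o ho => (hΩm o ho).2.1), ← smul_eq_mul]
    refine Finset.card_nsmul_le_sum _ _ _ fun s hs => (hP s hs).2.trans ?_
    refine Finset.card_le_card_of_injOn (fun x => (x, s)) ?_ ?_
    · intro x hx
      simp only [Finset.coe_filter, Set.mem_ofPred_eq, hΩ, Finset.mem_filter, Finset.mem_product] at hx ⊢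
      exact ⟨⟨⟨hx.1, hs⟩, hx.2⟩, trivial⟩
    · intro x _ y _ h
      exact (Prod.mk.inj h).1
  -- number of keys
  have hv : p / σ ≤ M / κ := by
    rw [Nat.le_div_iff_mul_le hκ]
    by_contra hc
    push Not at hc
    have h1 := Nat.div_mul_le_self p σ
    have h2 : p * κ < σ * M := by
      rw [hσ]
      have := Nat.div_add_mod (p * κ) M
      have := Nat.mod_lt (p * κ) hM
      nlinarith
    have h3 : σ * M < σ * (p / σ * κ) := Nat.mul_lt_mul_of_pos_left hc hσ0
    nlinarith
  set R := 2 * (M / κ) + 2 with hR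
  have hRκ : R * κ ≤ 4 * M := by
    have := Nat.div_mul_le_self M κ
    rw [hR]
    nlinarith
  have hblkd : ∀ o ∈ Ω, blk o.1 ≤ blk (o.1 + o.2) ∧ blk (o.1 + o.2) ≤ blk o.1 + M / κ + 1 := by
    intro o ho
    have h := hΩm o ho
    constructor
    · exact Nat.div_le_div_right (rk_mono B (by linarith [(hP _ h.2.1).1]))
    · simp only [hblk]
      have h1 := Nat.div_add_mod (rk B o.1) κ
      have h2 := Nat.mod_lt (rk B o.1) hκ
      have h3 := Nat.div_add_mod M κ
      have h4 := Nat.mod_lt M hκ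
      rw [← Nat.lt_succ_iff, Nat.div_lt_iff_lt_mul hκ, Nat.succ_eq_add_one]
      have := h.2.2.2
      nlinarith
  have hcs := cs_key Ω (B ×ˢ Finset.range R) (fun o => (o.1, ch o.2 + (blk (o.1 + o.2) - blk o.1))) (by
    intro o ho
    have h := hΩm o ho
    have h2 := hblkd o ho
    refine Finset.mem_product.2 ⟨h.1, Finset.mem_range.2 ?_⟩
    have h3 : ch o.2 ≤ M / κ := (Nat.div_le_div_right (rk_le P o.2)).trans hv
    simp only
    omega)
  set X := (Ω ×ˢ Ω).filter (fun q => (q.1.1, ch q.1.2 + (blk (q.1.1 + q.1.2) - blk q.1.1)) =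
    (q.2.1, ch q.2.2 + (blk (q.2.1 + q.2.2) - blk q.2.1))) with hX
  have hXm : ∀ q ∈ X, q.1 ∈ Ω ∧ q.2 ∈ Ω ∧ q.1.1 = q.2.1 ∧ ch q.1.2 = ch q.2.2 ∧ blk (q.1.1 + q.1.2) = blk (q.2.1 + q.2.2) := by
    intro q hq
    obtain ⟨h1, h2⟩ := Finset.mem_filter.1 hq
    obtain ⟨h3, h4⟩ := Finset.mem_product.1 h1
    obtain ⟨e1, e2⟩ := Prod.mk.inj h2
    refine ⟨h3, h4, e1, ?_⟩
    have b1 := hblkd _ h3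
    have b2 := hblkd _ h4
    rw [← e1] at e2 b2 ⊢
    rcases le_total q.1.2 q.2.2 with h | h
    · have c1 : ch q.1.2 ≤ ch q.2.2 := Nat.div_le_div_right (rk_mono P h)
      have c2 : blk (q.1.1 + q.1.2) ≤ blk (q.1.1 + q.2.2) := Nat.div_le_div_right (rk_mono B (by linarith))
      omega
    · have c1 : ch q.2.2 ≤ ch q.1.2 := Nat.div_le_div_right (rk_mono P h)
      have c2 : blk (q.1.1 + q.2.2) ≤ blk (q.1.1 + q.1.2) := Nat.div_le_div_right (rk_mono B (by linarith))
      omega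
  rw [Finset.card_product, Finset.card_range, hn] at hcs
  have hX1 : (p * W) ^ 2 * κ ≤ 4 * n * M * X.card := by
    have h1 : (p * W) ^ 2 ≤ Ω.card ^ 2 := Nat.pow_le_pow_left hΩc 2
    calc (p * W) ^ 2 * κ ≤ n * R * X.card * κ := Nat.mul_le_mul_right _ (h1.trans hcs)
      _ = n * X.card * (R * κ) := by ring
      _ ≤ n * X.card * (4 * M) := Nat.mul_le_mul_left _ hRκ
      _ = _ := by ring
  -- popular differences
  let Df : Finset ℝ := (B ×ˢ B).image (fun q => q.1 - q.2)
  let H := Df.filter (fun δ => W ^ 2 ≤ 8 * n * wt B blk δ)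
  have hH : H.card * W ^ 2 ≤ 8 * n ^ 2 * κ := by
    have h1 : ∑ δ ∈ H, wt B blk δ ≤ n * κ := by
      rw [← card_nearQ, ← hn]
      exact card_nearQ_le B blk H κ (fun h => rk_block_card B κ hκ h)
    have h2 : H.card * W ^ 2 ≤ ∑ δ ∈ H, 8 * n * wt B blk δ := by
      rw [← smul_eq_mul]
      exact Finset.card_nsmul_le_sum _ _ _ fun δ hδ => (Finset.mem_filter.1 hδ).2
    rw [← Finset.mul_sum] at h2
    calc _ ≤ _ := h2
      _ ≤ 8 * n * (n * κ) := Nat.mul_le_mul_left _ h1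
      _ = _ := by ring
  let Xg := X.filter (fun q => q.2.2 - q.1.2 ∈ H)
  let Xb := X.filter (fun q => ¬ (q.2.2 - q.1.2 ∈ H))
  have hXs : Xg.card + Xb.card = X.card := Finset.card_filter_add_card_filter_not _
  have hXb : Xb.card * (8 * n * M) ≤ (p * W) ^ 2 * κ := by
    let PP := (P ×ˢ P).filter (fun u => ch u.2 = ch u.1 ∧ u.2 ≠ u.1)
    have hPP : PP.card ≤ p * (σ - 1) := by
      have : PP.card ≤ (σ - 1) * P.card := by
        refine Finset.card_le_mul_card_image_of_maps_to (f := fun q => q.1) (t := P) ?_ _ ?_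
        · intro q hq
          exact (Finset.mem_product.1 (Finset.mem_filter.1 hq).1).1
        · intro a ha
          have h1 : ((P.filter (fun x => ch x = ch a)).erase a).card ≤ σ - 1 := by
            have ham : a ∈ P.filter (fun x => ch x = ch a) := Finset.mem_filter.2 ⟨ha, rfl⟩
            rw [Finset.card_erase_of_mem ham]
            exact Nat.sub_le_sub_right (rk_block_card P σ hσ0 _) 1
          refine le_trans ?_ h1
          refine Finset.card_le_card_of_injOn (fun q => q.2) ?_ ?_
          · intro q hq
            obtain ⟨h2, h3⟩ := Finset.mem_filter.1 hq
            obtain ⟨h4, h5⟩ := Finset.mem_filter.1 h2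
            have h6 := Finset.mem_product.1 h4
            rw [← h3]
            exact Finset.mem_erase.2 ⟨h5.2, Finset.mem_filter.2 ⟨h6.2, h5.1⟩⟩
          · intro q hq q' hq' h
            have a1 := (Finset.mem_filter.1 hq).2
            have a2 := (Finset.mem_filter.1 hq').2
            exact Prod.ext (a1.trans a2.symm) h
      rwa [mul_comm] at this
    have hmaps : ∀ q ∈ Xb, (q.1.2, q.2.2) ∈ PP := by
      intro q hq
      obtain ⟨h1, h2⟩ := Finset.mem_filter.1 hq
      have h3 := hXm q h1
      have m1 := hΩm _ h3.1
      have m2 := hΩm _ h3.2.1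
      refine Finset.mem_filter.2 ⟨Finset.mem_product.2 ⟨m1.2.1, m2.2.1⟩, h3.2.2.2.1.symm, ?_⟩
      intro heq
      simp only at heq
      apply h2
      rw [heq, sub_self]
      refine Finset.mem_filter.2 ⟨Finset.mem_image.2 ⟨(q.1.1, q.1.1), Finset.mem_product.2 ⟨m1.1, m1.1⟩, by simp⟩, ?_⟩
      have : wt B blk 0 = n := by
        rw [← hn]
        unfold wt
        congr 1
        simp
      rw [this]
      nlinarith
    have hfib : Xb.card * (8 * n) ≤ PP.card * W ^ 2 := by
      rw [Finset.card_eq_sum_card_fiberwise hmaps, Finset.sum_mul, ← smul_eq_mul (a := PP.card)]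
      refine Finset.sum_le_card_nsmul _ _ _ fun u hu => ?_
      by_cases hne : (Xb.filter (fun q => (q.1.2, q.2.2) = u)).Nonempty
      · obtain ⟨q0, hq0⟩ := hne
        obtain ⟨h1, h2⟩ := Finset.mem_filter.1 hq0
        obtain ⟨h3, h4⟩ := Finset.mem_filter.1 h1
        have h5 : (Xb.filter (fun q => (q.1.2, q.2.2) = u)).card ≤ wt B blk (u.2 - u.1) := by
          refine Finset.card_le_card_of_injOn (fun q => q.1.1 + u.1) ?_ ?_
          · intro q hq
            obtain ⟨g1, g2⟩ := Finset.mem_filter.1 hq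
            have g3 := hXm q (Finset.mem_filter.1 g1).1
            have m1 := hΩm _ g3.1
            have m2 := hΩm _ g3.2.1
            rw [← g2]
            have : q.1.1 + q.1.2 + (q.2.2 - q.1.2) = q.2.1 + q.2.2 := by rw [g3.2.2.1]; ring
            simp only [Finset.coe_filter, Set.mem_ofPred_eq, this]
            exact ⟨m1.2.2.1, m2.2.2.1, g3.2.2.2.2.symm⟩
          · intro q hq q' hq' h
            obtain ⟨g1, g2⟩ := Finset.mem_filter.1 hq
            obtain ⟨g1', g2'⟩ := Finset.mem_filter.1 hq'
            have g3 := hXm q (Finset.mem_filter.1 g1).1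
            have g3' := hXm q' (Finset.mem_filter.1 g1').1
            have e := g2.trans g2'.symm
            simp only [Prod.mk.injEq] at e
            simp only [add_left_inj] at h
            exact Prod.ext (Prod.ext h e.1) (Prod.ext (by rw [← g3.2.2.1, ← g3'.2.2.1, h]) e.2)
        have h6 : ¬ (W ^ 2 ≤ 8 * n * wt B blk (u.2 - u.1)) := by
          intro hW2
          apply h4
          rw [← h2] at hW2
          have g3 := hXm q0 h3
          have m1 := hΩm _ g3.1
          have m2 := hΩm _ g3.2.1
          refine Finset.mem_filter.2 ⟨Finset.mem_image.2 ⟨(q0.2.1 + q0.2.2, q0.1.1 + q0.1.2), Finset.mem_product.2 ⟨m2.2.2.1, m1.2.2.1⟩, ?_⟩, hW2⟩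
          simp only
          rw [g3.2.2.1]
          ring
        push Not at h6
        calc _ ≤ wt B blk (u.2 - u.1) * (8 * n) := Nat.mul_le_mul_right _ h5
          _ ≤ W ^ 2 := by linarith
      · rw [Finset.not_nonempty_iff_eq_empty] at hne
        rw [hne]
        simp
    calc Xb.card * (8 * n * M) = (Xb.card * (8 * n)) * M := by ring
      _ ≤ (p * (σ - 1)) * W ^ 2 * M := Nat.mul_le_mul_right _ (hfib.trans (Nat.mul_le_mul_right _ hPP))
      _ = p * W ^ 2 * (p * κ / M * M) := by rw [hσ, Nat.add_sub_cancel]; ring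
      _ ≤ p * W ^ 2 * (p * κ) := Nat.mul_le_mul_left _ (Nat.div_mul_le_self _ _)
      _ = _ := by ring
  let φ : (ℝ × ℝ) × ℝ × ℝ → ℝ × ℝ := fun q => (q.1.1 + q.1.2, q.2.1 + q.2.2)
  have hfib2 : Xg.card ≤ M * (Xg.image φ).card := by
    refine Finset.card_le_mul_card_image_of_maps_to (f := φ) (fun q hq => Finset.mem_image_of_mem _ hq) _ ?_
    intro c hc
    have : (Xg.filter (fun q => φ q = c)).card ≤ (Finset.Ico (rk B c.1 + 1 - M) (rk B c.1 + 1)).card := by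
      refine Finset.card_le_card_of_injOn (fun q => rk B q.1.1) ?_ ?_
      · intro q hq
        obtain ⟨g1, g2⟩ := Finset.mem_filter.1 hq
        have g3 := hXm q (Finset.mem_filter.1 g1).1
        have m1 := hΩm _ g3.1
        rw [← g2]
        simp only [φ, Finset.coe_Ico, Set.mem_Ico]
        have := rk_mono B (show q.1.1 ≤ q.1.1 + q.1.2 by linarith [(hP _ m1.2.1).1])
        omega
      · intro q hq q' hq' h
        obtain ⟨g1, g2⟩ := Finset.mem_filter.1 hq
        obtain ⟨g1', g2'⟩ := Finset.mem_filter.1 hq'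
        have g3 := hXm q (Finset.mem_filter.1 g1).1
        have g3' := hXm q' (Finset.mem_filter.1 g1').1
        have m1 := hΩm _ g3.1
        have m1' := hΩm _ g3'.1
        simp only at h
        have hb : q.1.1 = q'.1.1 := by
          rcases lt_trichotomy q.1.1 q'.1.1 with h1 | h1 | h1
          · have := rk_lt B m1.1 h1
            omega
          · exact h1
          · have := rk_lt B m1'.1 h1
            omega
        have e := g2.trans g2'.symm
        simp only [φ, Prod.mk.injEq] at e
        have hb2 : q.2.1 = q'.2.1 := by rw [← g3.2.2.1, ← g3'.2.2.1, hb]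
        exact Prod.ext (Prod.ext hb (by linarith [e.1])) (Prod.ext hb2 (by linarith [e.2]))
    refine this.trans ?_
    rw [Nat.card_Ico]
    omega
  refine ⟨Xg.image φ, H, ?_, hH, ?_⟩
  · intro c hc
    obtain ⟨q, hq, rfl⟩ := Finset.mem_image.1 hc
    obtain ⟨g1, g2⟩ := Finset.mem_filter.1 hq
    have g3 := hXm q g1
    have m1 := hΩm _ g3.1
    have m2 := hΩm _ g3.2.1
    refine ⟨m1.2.2.1, m2.2.2.1, g3.2.2.2.2.symm, ?_⟩
    have : (φ q).2 - (φ q).1 = q.2.2 - q.1.2 := by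
      simp only [φ]
      rw [g3.2.2.1]
      ring
    rw [this]
    exact g2
  · have h1 : 4 * n * M * Xg.card ≤ 4 * n * M * (M * (Xg.image φ).card) := Nat.mul_le_mul_left _ hfib2
    rw [← hXs] at hX1
    linarith


lemma pow2_near (x : ℝ) (hx : 0 ≤ x) : ∃ i : ℕ, x ≤ Real.log ((2 ^ i : ℕ) : ℝ) ∧ Real.log ((2 ^ i : ℕ) : ℝ) ≤ x + 1 ∧ (x = 0 → i = 0) := by
  have h2 : 0 < Real.log 2 := Real.log_pos (by norm_num)
  have h3 : Real.log 2 ≤ 1 := by linarith [Real.log_two_lt_d9]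
  refine ⟨⌈x / Real.log 2⌉₊, ?_, ?_, ?_⟩
  · push_cast
    rw [Real.log_pow, ← div_le_iff₀ h2]
    exact Nat.le_ceil _
  · push_cast
    rw [Real.log_pow]
    have := (Nat.ceil_lt_add_one (div_nonneg hx h2.le)).le
    calc _ ≤ (x / Real.log 2 + 1) * Real.log 2 := by gcongr
      _ = x + Real.log 2 := by field_simp
      _ ≤ _ := by linarith
  · intro h
    rw [h]
    simp

lemma pow2_setup (n y G M : ℕ) (hn : 0 < n) (hy : n ≤ y) (hG : 0 < G) (hM : 0 < M) :
    ∃ j : ℕ, 256 * G * y * M ≤ n * 2 ^ j ∧ 2 ^ j * n ≤ 512 * G * y * M := by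
  have hex : ∃ j : ℕ, 256 * G * y * M ≤ n * 2 ^ j := by
    refine ⟨256 * G * y * M, ?_⟩
    have := (Nat.lt_two_pow_self (n := 256 * G * y * M)).le
    exact this.trans (Nat.le_mul_of_pos_left _ hn)
  classical
  refine ⟨Nat.find hex, Nat.find_spec hex, ?_⟩
  rcases Nat.eq_zero_or_pos (Nat.find hex) with h | h
  · rw [h]
    have h1 : 1 * y * 1 ≤ G * y * M := Nat.mul_le_mul (Nat.mul_le_mul hG le_rfl) hM
    nlinarith
  · obtain ⟨m, hm⟩ := Nat.exists_eq_succ_of_ne_zero h.ne'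
    have := Nat.find_min hex (m := m) (by omega)
    rw [hm, Nat.succ_eq_add_one, pow_succ]
    push Not at this
    nlinarith

lemma log3 {a b : ℝ} (ha : 0 < a) (h : a ≤ b) : Real.log a ≤ Real.log b := Real.log_le_log ha h

set_option maxHeartbeats 1000000 in
theorem HT_log (D : Set ℝ) (e : ℝ → ℝ) (t : ℕ) (hg : Good D e t) (T C Y : Finset ℝ)
    (hT : ∀ t ∈ T, t ∈ D) (hY : ∀ t ∈ T, ∀ c ∈ C, e t + c ∈ Y) (M κ i j G n : ℕ) (hκ0 : 0 < κ)
    (hTn : T.card = n) (hCn : C.card = n) (hn : 0 < n) (hM0 : 0 < M)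
    (hN1 : 256 * G * Y.card * M ≤ n * 2 ^ j) (hN : 2 ^ j * n ≤ 512 * G * Y.card * M)
    (hκb : κ * 2 ^ i ≤ 4 * M) (hGpos : 0 < G)
    (P : Finset ℝ) (hP : ∀ s ∈ P, 0 < s)
    (hQ0 : 0 < (nearQ (TStar T C Y e M (2 ^ j) G) (fun t => rk T t / M) P).card)
    (𝒟 : Finset (ℝ × ℝ)) (h𝒟 : ∀ p ∈ 𝒟, p.1 ∈ C ∧ p.2 ∈ C ∧ rk C p.2 / κ = rk C p.1 / κ)
    (h𝒟c : κ * n ≤ 4 * G * 𝒟.card) (Df : Finset ℝ) (hDf : ∀ p ∈ 𝒟, p.2 - p.1 ∈ Df)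
    (hbP : 2 ^ i ≤ P.card) (hbD : 2 * 2 ^ i ≤ 𝒟.card) (Λ : ℝ) (hΛ1 : 2 ^ 40 ≤ Λ) (hΛ2 : (t : ℝ) + 1 ≤ Λ)
    (hΛ3 : 10 * ((Nat.log 2 (Y.card ^ 2) : ℝ) + 1) ≤ Λ)
    (lq lp ld ln lG ly lM lb lDf lam : ℝ) (elq : lq = Real.log (nearQ (TStar T C Y e M (2 ^ j) G) (fun t => rk T t / M) P).card)
    (elp : lp = Real.log P.card) (eld : ld = Real.log 𝒟.card) (eln : ln = Real.log n) (elG : lG = Real.log G)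
    (ely : ly = Real.log Y.card) (elM : lM = Real.log M) (elb : lb = Real.log ((2 ^ i : ℕ) : ℝ)) (elDf : lDf = Real.log Df.card)
    (elam : lam = Real.log Λ) :
    (lq + lb ≤ 2 * lam + lDf + 2 * lp ∧ lq + 2 * lb + 2 * ln ≤ 3 * lam + lG + 2 * ly + lM + 2 * lp) ∨
    lq ≤ lam + lp ∨ lq + ln + ld ≤ 2 * lam + lG + 2 * ly + lM + lb ∨
    3 * lq + 2 * ln + ld ≤ 4 * lam + 2 * lG + 4 * ly + 2 * lM + 2 * lp := by
  have hyn : n ≤ Y.card := by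
    obtain ⟨a, ha⟩ : T.Nonempty := Finset.card_pos.1 (by omega)
    rw [← hCn]
    exact Finset.card_le_card_of_injOn (fun c => e a + c) (fun c hc => hY a ha c hc) (fun c _ c' _ h => by simpa using h)
  have hij : i ≤ j := by
    have h1 : 2 ^ i ≤ 2 ^ j := by
      have a1 : 2 ^ i ≤ κ * 2 ^ i := Nat.le_mul_of_pos_left _ hκ0
      have a2 : 1 * n * M ≤ G * Y.card * M := Nat.mul_le_mul (Nat.mul_le_mul hGpos hyn) le_rfl
      have a3 : n * (4 * M) ≤ n * 2 ^ j := by nlinarith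
      have a4 := Nat.le_of_mul_le_mul_left a3 hn
      omega
    exact (Nat.pow_le_pow_iff_right (by norm_num)).1 h1
  have hτb : 2 ^ (j - i) * 2 ^ i = 2 ^ j := by rw [← pow_add]; congr 1; omega
  have h := HT_opt D e t hg T C Y hT hY M κ (2 ^ (j - i)) (2 ^ i) G n hκ0 (by positivity) (by positivity) hTn hCn hn hM0
    (by rw [hτb]; exact hN1) hκb (by rw [hτb]; exact hN) hGpos P hP (nearQ (TStar T C Y e M (2 ^ j) G) (fun t => rk T t / M) P)
    (by
      intro q hq
      obtain ⟨h1, h2, h3⟩ := Finset.mem_filter.1 hq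
      obtain ⟨h4, h5⟩ := Finset.mem_product.1 h1
      rw [hτb]
      exact ⟨h4, (Finset.mem_filter.1 h5).1, h2, h3⟩) 𝒟 h𝒟 h𝒟c Df hDf hbP hbD Λ hΛ1 hΛ2 hΛ3
  have hτn : ((2 ^ (j - i) : ℕ) : ℝ) * ((2 ^ i : ℕ) : ℝ) * n ≤ 512 * G * Y.card * M := by
    rw [← hτb] at hN
    exact_mod_cast hN
  have hb0 : (0 : ℝ) < ((2 ^ i : ℕ) : ℝ) := by positivity
  have hτ0 : (0 : ℝ) < ((2 ^ (j - i) : ℕ) : ℝ) := by positivity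
  have hp0 : (0 : ℝ) < P.card := by
    have : 0 < P.card := lt_of_lt_of_le (by positivity) hbP
    exact_mod_cast this
  have hd0 : (0 : ℝ) < 𝒟.card := by
    have : 0 < 𝒟.card := lt_of_lt_of_le (by positivity) hbD
    exact_mod_cast this
  have hq0 : (0 : ℝ) < (nearQ (TStar T C Y e M (2 ^ j) G) (fun t => rk T t / M) P).card := by exact_mod_cast hQ0
  have hn0 : (0 : ℝ) < n := by exact_mod_cast hn
  have hG0 : (0 : ℝ) < G := by exact_mod_cast hGpos
  have hM0' : (0 : ℝ) < M := by exact_mod_cast hM0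
  have hy0 : (0 : ℝ) < Y.card := by
    have : 0 < Y.card := by omega
    exact_mod_cast this
  have hL0 : 0 < Λ := by linarith [show (0 : ℝ) < 2 ^ 40 by norm_num]
  have hΔ : ∀ Δ : ℕ, Δ * n ≤ 2 * Y.card * 2 ^ (j - i) → (Δ : ℝ) * n ≤ 2 * Y.card * ((2 ^ (j - i) : ℕ) : ℝ) := by
    intro Δ h
    exact_mod_cast h
  generalize ((nearQ (TStar T C Y e M (2 ^ j) G) (fun t => rk T t / M) P).card : ℝ) = q at *
  generalize ((2 ^ i : ℕ) : ℝ) = b at *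
  generalize ((2 ^ (j - i) : ℕ) : ℝ) = τ at *
  have hDfc : ∀ Δ : ℕ, Δ ≤ Df.card → (Δ : ℝ) ≤ (Df.card : ℝ) := fun Δ h => by exact_mod_cast h
  generalize (P.card : ℝ) = p at *
  generalize (𝒟.card : ℝ) = d at *
  generalize (Y.card : ℝ) = y at *
  generalize (Df.card : ℝ) = df at *
  generalize (n : ℝ) = n' at *
  generalize (G : ℝ) = G' at *
  generalize (M : ℝ) = M' at *
  rcases h with ⟨Δ, h1, h2, h3⟩ | h | h | h
  · left
    have h1' := hDfc Δ h1
    have h2' := hΔ Δ h2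
    have hΔ0 : (0 : ℝ) < Δ := by
      rcases Nat.eq_zero_or_pos Δ with h0 | h0
      · rw [h0] at h3
        have : 0 < q * b := by positivity
        norm_num at h3
        linarith
      · exact_mod_cast h0
    generalize (Δ : ℝ) = δ at *
    have g1 := log3 hΔ0 h1'
    have g3 := log3 (by positivity) h3
    rw [Real.log_mul (by positivity) (by positivity), Real.log_mul (by positivity) (by positivity),
      Real.log_mul (by positivity) (by positivity), Real.log_pow, Real.log_pow] at g3
    push_cast at g3
    have g4 : δ * n' * (b * n') ≤ 1024 * G' * y ^ 2 * M' := by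
      calc δ * n' * (b * n') ≤ 2 * y * τ * (b * n') := by gcongr
        _ = 2 * y * (τ * b * n') := by ring
        _ ≤ 2 * y * (512 * G' * y * M') := by gcongr
        _ = _ := by ring
    have g5 : δ * n' * (b * n') ≤ Λ * G' * y ^ 2 * M' := by
      refine g4.trans ?_
      have : (1024 : ℝ) ≤ Λ := by linarith
      gcongr
    have g6 := log3 (by positivity) g5
    rw [Real.log_mul (by positivity) (by positivity), Real.log_mul (by positivity) (by positivity),
      Real.log_mul (by positivity) (by positivity), Real.log_mul (by positivity) (by positivity),
      Real.log_mul (by positivity) (by positivity), Real.log_mul (by positivity) (by positivity), Real.log_pow] at g6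
    push_cast at g6
    subst elq elp eld eln elG ely elM elb elDf elam
    constructor <;> linarith
  · right; left
    have g := log3 hq0 h
    rw [Real.log_mul (by positivity) (by positivity)] at g
    subst elq elp eld eln elG ely elM elb elDf elam
    linarith
  · right; right; left
    have g := log3 (by positivity) h
    rw [Real.log_mul (by positivity) (by positivity), Real.log_mul (by positivity) (by positivity),
      Real.log_mul (by positivity) (by positivity), Real.log_mul (by positivity) (by positivity),
      Real.log_mul (by positivity) (by positivity), Real.log_mul (by positivity) (by positivity), Real.log_pow, Real.log_pow] at g
    push_cast at g
    subst elq elp eld eln elG ely elM elb elDf elam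
    linarith
  · right; right; right
    have g := log3 (by positivity) h
    rw [Real.log_mul (by positivity) (by positivity), Real.log_mul (by positivity) (by positivity),
      Real.log_mul (by positivity) (by positivity), Real.log_mul (by positivity) (by positivity),
      Real.log_mul (by positivity) (by positivity), Real.log_mul (by positivity) (by positivity)] at g
    simp only [Real.log_pow] at g
    push_cast at g
    subst elq elp eld eln elG ely elM elb elDf elam
    linarith


lemma level_size (n M I Z S1 S2 : ℕ) (hn : 0 < n) (hI : I * M ≤ n) (hMn : M ≤ n) (hZ : 12 * Z ≤ n * M)
    (h1 : 3 * n ≤ 4 * S1) (h2 : 3 * n ≤ 4 * S2) :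
    4 * (Z * (I + I + 1)) ≤ n ^ 2 ∧ Z * (I + I + 1) * (S1 * S2) * 2 < (S1 * S2) ^ 2 := by
  have e1 : 12 * Z * (I + I + 1) ≤ 3 * n ^ 2 := by
    calc 12 * Z * (I + I + 1) ≤ n * M * (I + I + 1) := Nat.mul_le_mul_right _ hZ
      _ = n * (2 * (I * M) + M) := by ring
      _ ≤ n * (2 * n + n) := Nat.mul_le_mul_left _ (by omega)
      _ = _ := by ring
  have e0 : 4 * (Z * (I + I + 1)) ≤ n ^ 2 := by nlinarith
  refine ⟨e0, ?_⟩
  have e2 : 9 * n ^ 2 ≤ 16 * (S1 * S2) := by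
    calc 9 * n ^ 2 = (3 * n) * (3 * n) := by ring
      _ ≤ (4 * S1) * (4 * S2) := Nat.mul_le_mul h1 h2
      _ = _ := by ring
  have hn2 : 0 < n ^ 2 := by positivity
  have e3 : Z * (I + I + 1) * 2 < S1 * S2 := by omega
  have : 0 < S1 * S2 := by omega
  calc _ = (Z * (I + I + 1) * 2) * (S1 * S2) := by ring
    _ < (S1 * S2) * (S1 * S2) := Nat.mul_lt_mul_of_pos_right e3 this
    _ = _ := by ring

lemma div_mono_rk (T : Finset ℝ) (M : ℕ) (x y : ℝ) (h : x ≤ y) : rk T x / M ≤ rk T y / M :=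
  Nat.div_le_div_right (rk_mono T h)

theorem level_log (T B S1 S2 Z : Finset ℝ) (n M : ℕ) (hT : T.card = n) (hB : B.card = n) (hS1 : S1 ⊆ T) (hS2 : S2 ⊆ B)
    (h1 : 3 * n ≤ 4 * S1.card) (h2 : 3 * n ≤ 4 * S2.card) (hn : 0 < n) (hM : 0 < M) (hMn : M ≤ n) (hZc : 12 * Z.card ≤ n * M)
    (hZ : ∀ t ∈ S1, ∀ b ∈ S2, t + b ∈ Z) (Λ : ℝ) (hΛ : 10 * ((Nat.log 2 n : ℝ) + 1) ≤ Λ) :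
    ∃ (W : ℕ) (P : Finset ℝ), 0 < W ∧ W ≤ n ∧ P.Nonempty ∧
      (∀ s ∈ P, 0 < s ∧ W ≤ wt S2 (fun b => rk B b / M) s ∧ wt S2 (fun b => rk B b / M) s ≤ 2 * W) ∧
      0 < (nearQ S1 (fun t => rk T t / M) P).card ∧
      (n : ℝ) ^ 2 ≤ Λ * ((nearQ S1 (fun t => rk T t / M) P).card * W) ∧ P.card * W ≤ n * M := by
  have hI : n / M * M ≤ n := Nat.div_mul_le_self _ _
  obtain ⟨e1, e2⟩ := level_size n M (n / M) Z.card S1.card S2.card hn hI hMn hZc h1 h2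
  obtain ⟨W, P, w0, w1, w2, w3, w4⟩ := level S1 S2 Z (fun t => rk T t / M) (fun b => rk B b / M) (div_mono_rk T M) (div_mono_rk B M)
    (n / M) (n / M) (fun t _ => by rw [← hT]; exact Nat.div_le_div_right (rk_le T t))
    (fun t _ => by rw [← hB]; exact Nat.div_le_div_right (rk_le B t)) hZ e2
  have hc2 : S2.card ≤ n := hB ▸ Finset.card_le_card hS2
  refine ⟨W, P, w0, w1.trans hc2, w2, w3, ?_⟩
  have hlog : Nat.log 2 S2.card ≤ Nat.log 2 n := Nat.log_mono_right hc2
  set q := (nearQ S1 (fun t => rk T t / M) P).card with hq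
  have hpos : 0 < (S1.card * S2.card) ^ 2 := by
    have : 0 < S1.card := by omega
    have : 0 < S2.card := by omega
    positivity
  have key : 81 * n ^ 2 ≤ 512 * ((Nat.log 2 n + 1) * (q * W)) := by
    have a1 : (9 * n ^ 2) ^ 2 ≤ (16 * (S1.card * S2.card)) ^ 2 := by
      apply Nat.pow_le_pow_left
      calc 9 * n ^ 2 = (3 * n) * (3 * n) := by ring
        _ ≤ (4 * S1.card) * (4 * S2.card) := Nat.mul_le_mul h1 h2
        _ = _ := by ring
    have a2 : n ^ 2 * (81 * n ^ 2) ≤ n ^ 2 * (512 * ((Nat.log 2 n + 1) * (q * W))) := by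
      calc n ^ 2 * (81 * n ^ 2) = (9 * n ^ 2) ^ 2 := by ring
        _ ≤ (16 * (S1.card * S2.card)) ^ 2 := a1
        _ = 256 * (S1.card * S2.card) ^ 2 := by ring
        _ ≤ 256 * (8 * (Z.card * (n / M + n / M + 1)) * ((Nat.log 2 S2.card + 1) * (q * W))) := Nat.mul_le_mul_left _ w4
        _ = 512 * (4 * (Z.card * (n / M + n / M + 1))) * ((Nat.log 2 S2.card + 1) * (q * W)) := by ring
        _ ≤ 512 * n ^ 2 * ((Nat.log 2 n + 1) * (q * W)) := by gcongr
        _ = _ := by ring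
    exact Nat.le_of_mul_le_mul_left a2 (by positivity)
  refine ⟨?_, ?_, ?_⟩
  · rcases Nat.eq_zero_or_pos q with h | h
    · rw [h] at key
      have : 0 < n ^ 2 := by positivity
      omega
    · exact h
  · have k' : (81 : ℝ) * (n : ℝ) ^ 2 ≤ 512 * (((Nat.log 2 n : ℝ) + 1) * (q * W)) := by exact_mod_cast key
    have : (0 : ℝ) ≤ (q : ℝ) * W := by positivity
    have := mul_le_mul_of_nonneg_right hΛ this
    nlinarith
  · have c1 : P.card * W ≤ ∑ s ∈ P, wt S2 (fun b => rk B b / M) s := by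
      rw [← smul_eq_mul]
      exact Finset.card_nsmul_le_sum _ _ _ (fun s hs => (w3 s hs).2.1)
    rw [← card_nearQ] at c1
    refine c1.trans ((card_nearQ_le S2 _ P M ?_).trans (Nat.mul_le_mul_right _ hc2))
    intro h
    refine le_trans (Finset.card_le_card ?_) (rk_block_card B M hM h)
    exact Finset.filter_subset_filter _ hS2

/-- all pairs in a block -/
lemma block_pairs (C : Finset ℝ) (n κ : ℕ) (hC : C.card = n) (hκ : 0 < κ) (hκn : κ ≤ n) :
    ∃ (𝒟 : Finset (ℝ × ℝ)), (∀ p ∈ 𝒟, p.1 ∈ C ∧ p.2 ∈ C ∧ rk C p.2 / κ = rk C p.1 / κ) ∧ n * κ ≤ 2 * 𝒟.card := by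
  classical
  refine ⟨(C ×ˢ C).filter (fun q => rk C q.1 / κ = rk C q.2 / κ), ?_, ?_⟩
  · intro p hp
    obtain ⟨h1, h2⟩ := Finset.mem_filter.1 hp
    obtain ⟨h3, h4⟩ := Finset.mem_product.1 h1
    exact ⟨h3, h4, h2.symm⟩
  · have := cs_key C (Finset.range (n / κ + 1)) (fun x => rk C x / κ) (by
      intro x _
      rw [Finset.mem_range, Nat.lt_succ_iff, ← hC]
      exact Nat.div_le_div_right (rk_le C x))
    rw [Finset.card_range, hC] at this
    set d := ((C ×ˢ C).filter (fun q => rk C q.1 / κ = rk C q.2 / κ)).card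
    have h1 : (n / κ + 1) * κ ≤ 2 * n := by
      have := Nat.div_mul_le_self n κ
      rw [add_mul]; omega
    have h2 : n * (n * κ) ≤ n * (2 * d) := by
      calc n * (n * κ) = n ^ 2 * κ := by ring
        _ ≤ (n / κ + 1) * d * κ := Nat.mul_le_mul_right _ this
        _ = ((n / κ + 1) * κ) * d := by ring
        _ ≤ 2 * n * d := Nat.mul_le_mul_right _ h1
        _ = _ := by ring
    exact Nat.le_of_mul_le_mul_left h2 (by omega)


theorem T1_step (D : Set ℝ) (e : ℝ → ℝ) (t : ℕ) (hg : Good D e t) (T C Y : Finset ℝ)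
    (hT : ∀ t ∈ T, t ∈ D) (hY : ∀ t ∈ T, ∀ c ∈ C, e t + c ∈ Y) (M i j n : ℕ)
    (hTn : T.card = n) (hCn : C.card = n) (hn : 0 < n) (hM0 : 0 < M) (hMn : 16 * M ≤ n)
    (hN1 : 256 * 1 * Y.card * M ≤ n * 2 ^ j) (hN : 2 ^ j * n ≤ 512 * 1 * Y.card * M)
    (hib : 2 ^ i ≤ 4 * M)
    (P : Finset ℝ) (hP : ∀ s ∈ P, 0 < s)
    (hQ0 : 0 < (nearQ (TStar T C Y e M (2 ^ j) 1) (fun t => rk T t / M) P).card)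
    (hbP : 2 ^ i ≤ P.card) (Λ : ℝ) (hΛ1 : 2 ^ 40 ≤ Λ) (hΛ2 : (t : ℝ) + 1 ≤ Λ)
    (hΛ3 : 10 * ((Nat.log 2 (Y.card ^ 2) : ℝ) + 1) ≤ Λ)
    (lq lp ln ly lM lb lam : ℝ) (elq : lq = Real.log (nearQ (TStar T C Y e M (2 ^ j) 1) (fun t => rk T t / M) P).card)
    (elp : lp = Real.log P.card) (eln : ln = Real.log n)
    (ely : ly = Real.log Y.card) (elM : lM = Real.log M) (elb : lb = Real.log ((2 ^ i : ℕ) : ℝ))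
    (elam : lam = Real.log Λ) :
    (lq + 2 * lb + 2 * ln ≤ 3 * lam + 2 * ly + lM + 2 * lp) ∨
    lq ≤ lam + lp ∨ lq + 2 * ln ≤ 2 * lam + 2 * ly + 2 * lb ∨
    3 * lq + 3 * ln ≤ 4 * lam + 4 * ly + lM + 2 * lp + lb := by
  classical
  have hb0 : 0 < 2 ^ i := by positivity
  set κ := 4 * M / 2 ^ i with hκ
  have hκ0 : 0 < κ := Nat.div_pos hib hb0
  have hκb : κ * 2 ^ i ≤ 4 * M := Nat.div_mul_le_self _ _
  have hκ2 : 2 * M ≤ κ * 2 ^ i := by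
    have h1 : 4 * M < (κ + 1) * 2 ^ i := by
      have := Nat.lt_mul_div_succ (4 * M) hb0
      rw [mul_comm (2 ^ i)] at this
      exact this
    have h2 : (κ + 1) * 2 ^ i ≤ 2 * κ * 2 ^ i := Nat.mul_le_mul_right _ (by omega)
    rw [mul_assoc] at h2
    omega
  have hκM : κ ≤ 4 * M := Nat.div_le_self _ _
  obtain ⟨𝒟, d1, d2⟩ := block_pairs C n κ hCn hκ0 (by omega)
  have d3 : n * M ≤ 𝒟.card * 2 ^ i := by
    have := Nat.mul_le_mul_left n hκ2
    have := Nat.mul_le_mul_right (2 ^ i) d2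
    nlinarith
  have d4 : 2 * 2 ^ i ≤ 𝒟.card := by
    have : n * 1 ≤ n * κ := Nat.mul_le_mul_left _ hκ0
    omega
  have h := HT_log D e t hg T C Y hT hY M κ i j 1 n hκ0 hTn hCn hn hM0 hN1 hN hκb one_pos P hP hQ0 𝒟 d1 (by linarith)
    (𝒟.image (fun p => p.2 - p.1)) (fun p hp => Finset.mem_image_of_mem (fun p : ℝ × ℝ => p.2 - p.1) hp) hbP d4 Λ hΛ1 hΛ2 hΛ3 lq lp _ ln _ ly lM lb _ lam elq elp rfl
    eln rfl ely elM elb rfl elam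
  have hd0 : (0 : ℝ) < 𝒟.card := by
    have : 0 < 𝒟.card := by omega
    exact_mod_cast this
  have hn0 : (0 : ℝ) < n := by exact_mod_cast hn
  have hM0' : (0 : ℝ) < M := by exact_mod_cast hM0
  have hb0' : (0 : ℝ) < ((2 ^ i : ℕ) : ℝ) := by positivity
  have d5 : (n : ℝ) * M ≤ 𝒟.card * ((2 ^ i : ℕ) : ℝ) := by exact_mod_cast d3
  have d6 := log3 (by positivity) d5
  rw [Real.log_mul (by positivity) (by positivity), Real.log_mul (by positivity) (by positivity)] at d6
  rw [← eln, ← elM, ← elb] at d6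
  have : Real.log ((1 : ℕ) : ℝ) = 0 := by simp
  rw [this] at h
  rcases h with h | h | h | h
  · left; linarith [h.2]
  · right; left; exact h
  · right; right; left; linarith
  · right; right; right; linarith

lemma M_setup (n z : ℕ) (hn : 0 < n) (hz : n ≤ z) : ∃ M, 0 < M ∧ 12 * z ≤ n * M ∧ n * M ≤ 13 * z := by
  refine ⟨12 * z / n + 1, Nat.succ_pos _, ?_, ?_⟩
  · exact (Nat.lt_mul_div_succ _ hn).le
  · have := Nat.mul_div_le (12 * z) n
    rw [mul_add]; omega

lemma lam_ge {Λ lam : ℝ} (h : 2 ^ 40 ≤ Λ) (e : lam = Real.log Λ) : 20 ≤ lam := by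
  have h1 : Real.log ((2 : ℝ) ^ 40) ≤ Real.log Λ := log3 (by positivity) h
  rw [Real.log_pow] at h1
  have := Real.log_two_gt_d9
  push_cast at h1
  linarith

lemma log_le_of_lam {Λ lam : ℝ} (h : 2 ^ 40 ≤ Λ) (e : lam = Real.log Λ) (a b : ℝ) (ha : 0 < a) (hb : 0 < b) (hab : a ≤ 2 ^ 40 * b) :
    Real.log a ≤ lam + Real.log b := by
  have : a ≤ Λ * b := hab.trans (mul_le_mul_of_nonneg_right h hb.le)
  have h0 : 0 < Λ := lt_of_lt_of_le (by norm_num) h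
  have := log3 ha this
  rw [Real.log_mul h0.ne' hb.ne'] at this
  rw [e]; exact this

set_option maxHeartbeats 1000000 in
theorem T1 (D : Set ℝ) (e : ℝ → ℝ) (t : ℕ) (hg : Good D e t) (T C Y B Z : Finset ℝ)
    (hT : ∀ t ∈ T, t ∈ D) (hY : ∀ t ∈ T, ∀ c ∈ C, e t + c ∈ Y) (hZ : ∀ t ∈ T, ∀ b ∈ B, t + b ∈ Z) (n : ℕ)
    (hTn : T.card = n) (hCn : C.card = n) (hBn : B.card = n) (hn : 0 < n)
    (Λ : ℝ) (hΛ1 : 2 ^ 40 ≤ Λ) (hΛ2 : (t : ℝ) + 1 ≤ Λ)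
    (hΛ3 : 10 * ((Nat.log 2 (Y.card ^ 2) : ℝ) + 1) ≤ Λ)
    (N y z lam : ℝ) (eN : N = Real.log n) (ey : y = Real.log Y.card) (ez : z = Real.log Z.card) (el : lam = Real.log Λ)
    (h1 : 2 * y + z + 50 * lam ≤ 4 * N) (h2 : 2 * y + 50 * lam ≤ 3 * N) (h3 : z + 50 * lam ≤ 2 * N) :
    ∃ (M W : ℕ) (P : Finset ℝ), 0 < M ∧ 16 * M ≤ n ∧ 0 < W ∧ W ≤ n ∧ P.Nonempty ∧
      (∀ s ∈ P, 0 < s ∧ W ≤ wt B (fun b => rk B b / M) s) ∧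
      ∃ (lM w p : ℝ), lM = Real.log M ∧ w = Real.log W ∧ p = Real.log P.card ∧
      z ≤ N + lM ∧ N + lM ≤ z + lam ∧ p + w ≤ N + lM ∧ 0 ≤ w ∧ w ≤ N ∧
      (25 * N ≤ 6 * p + 7 * w + 10 * y + 3 * z + 50 * lam ∨ 9 * N ≤ 3 * z + 4 * y + 50 * lam ∨ 14 * N ≤ 5 * z + 6 * y + 50 * lam ∨
        4 * N ≤ w + 2 * y + 50 * lam ∨ 10 * N ≤ 2 * p + 3 * w + 4 * y + z + 50 * lam) := by
  have hlam := lam_ge hΛ1 el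
  have hyn : n ≤ Y.card := by
    obtain ⟨a, ha⟩ : T.Nonempty := Finset.card_pos.1 (by omega)
    rw [← hCn]
    exact Finset.card_le_card_of_injOn (fun c => e a + c) (fun c hc => hY a ha c hc) (fun c _ c' _ h => by simpa using h)
  have hzn : n ≤ Z.card := by
    obtain ⟨a, ha⟩ : T.Nonempty := Finset.card_pos.1 (by omega)
    rw [← hBn]
    exact Finset.card_le_card_of_injOn (fun c => a + c) (fun c hc => hZ a ha c hc) (fun c _ c' _ h => by simpa using h)
  have hn0 : (0 : ℝ) < n := by exact_mod_cast hn
  have hz0 : (0 : ℝ) < Z.card := by exact_mod_cast (by omega : 0 < Z.card)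
  obtain ⟨M, hM0, hM1, hM2⟩ := M_setup n Z.card hn hzn
  have hM0' : (0 : ℝ) < M := by exact_mod_cast hM0
  obtain ⟨lM, elM⟩ : ∃ lM, lM = Real.log M := ⟨_, rfl⟩
  have hMa : z ≤ N + lM := by
    have : (Z.card : ℝ) ≤ n * M := by
      have : Z.card ≤ n * M := by omega
      exact_mod_cast this
    have := log3 hz0 this
    rw [Real.log_mul (by positivity) (by positivity)] at this
    rw [eN, ez, elM]; exact this
  have hMb : N + lM ≤ z + lam := by
    have : (n : ℝ) * M ≤ 13 * Z.card := by exact_mod_cast hM2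
    have := log_le_of_lam hΛ1 el (n * M) Z.card (by positivity) hz0 (this.trans (by gcongr; norm_num))
    rw [Real.log_mul (by positivity) (by positivity)] at this
    rw [eN, ez, elM]; linarith
  have hMn : 16 * M ≤ n := by
    have : Real.log (16 * M) ≤ Real.log n := by
      have := log_le_of_lam hΛ1 el (16 * M) M (by positivity) hM0' (by gcongr; norm_num)
      rw [← eN]; rw [← elM] at this
      linarith
    have := (Real.log_le_log_iff (by positivity) hn0).1 this
    exact_mod_cast this
  have hlogn : 10 * ((Nat.log 2 n : ℝ) + 1) ≤ Λ := by
    refine le_trans ?_ hΛ3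
    have : Nat.log 2 n ≤ Nat.log 2 (Y.card ^ 2) := Nat.log_mono_right (by nlinarith)
    have : (Nat.log 2 n : ℝ) ≤ Nat.log 2 (Y.card ^ 2) := by exact_mod_cast this
    linarith
  obtain ⟨j, hj1, hj2⟩ := pow2_setup n Y.card 1 M hn hyn one_pos hM0
  have hst : 3 * n ≤ 4 * (TStar T C Y e M (2 ^ j) 1).card := by
    rw [← hTn]
    exact TStar_card D e hg.smono T C Y hT M (2 ^ j) 1 hM0 (by positivity) (by omega) (by rw [hTn]; exact hj1)
  have hsub : TStar T C Y e M (2 ^ j) 1 ⊆ T := Finset.filter_subset _ _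
  obtain ⟨W, P, hW0, hWn, hPne, hPs, hq0, hq1, hpw⟩ := level_log T B (TStar T C Y e M (2 ^ j) 1) B Z n M hTn hBn hsub subset_rfl hst (by omega)
    hn hM0 (by omega) hM1 (fun t ht b hb => hZ t (hsub ht) b hb) Λ hlogn
  have hP0 : 0 < P.card := Finset.card_pos.2 hPne
  have hP0' : (0 : ℝ) < P.card := by exact_mod_cast hP0
  have hW0' : (0 : ℝ) < W := by exact_mod_cast hW0
  obtain ⟨w, ew⟩ : ∃ w, w = Real.log W := ⟨_, rfl⟩
  obtain ⟨p, ep⟩ : ∃ p, p = Real.log P.card := ⟨_, rfl⟩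
  have hw0 : 0 ≤ w := by
    rw [ew]; exact Real.log_natCast_nonneg _
  have hp0 : 0 ≤ p := by
    rw [ep]; exact Real.log_natCast_nonneg _
  have hlM0 : 0 ≤ lM := by
    rw [elM]; exact Real.log_natCast_nonneg _
  have hwN : w ≤ N := by
    rw [ew, eN]; exact log3 hW0' (by exact_mod_cast hWn)
  have hpw' : p + w ≤ N + lM := by
    have : (P.card : ℝ) * W ≤ n * M := by exact_mod_cast hpw
    have := log3 (by positivity) this
    rw [Real.log_mul (by positivity) (by positivity), Real.log_mul (by positivity) (by positivity)] at this
    rw [ep, ew, eN, elM]; exact this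
  refine ⟨M, W, P, hM0, hMn, hW0, hWn, hPne, fun s hs => ⟨(hPs s hs).1, (hPs s hs).2.1⟩, lM, w, p, elM, ew, ep, hMa, hMb, by linarith, hw0, hwN, ?_⟩
  obtain ⟨q, eq⟩ : ∃ q, q = Real.log (nearQ (TStar T C Y e M (2 ^ j) 1) (fun t => rk T t / M) P).card := ⟨_, rfl⟩
  have hq0' : (0 : ℝ) < (nearQ (TStar T C Y e M (2 ^ j) 1) (fun t => rk T t / M) P).card := by exact_mod_cast hq0
  have hL0 : 0 < Λ := lt_of_lt_of_le (by norm_num) hΛ1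
  have hq : 2 * N ≤ lam + q + w := by
    have := log3 (by positivity) hq1
    rw [Real.log_mul (by positivity) (by positivity), Real.log_mul (by positivity) (by positivity), Real.log_pow] at this
    push_cast at this
    rw [eN, eq, ew, el]; linarith
  obtain ⟨X, eX⟩ : ∃ X, X = p + y - 2 * N + (w + lM) / 2 + 3 * lam := ⟨_, rfl⟩
  have natle : ∀ a b : ℕ, 0 < a → 0 < b → Real.log a ≤ Real.log b → a ≤ b := by
    intro a b ha hb h
    have := (Real.log_le_log_iff (by exact_mod_cast ha) (by exact_mod_cast hb)).1 h
    exact_mod_cast this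
  have h4M : 1 + lM ≤ Real.log ((4 * M : ℕ) : ℝ) := by
    push_cast
    rw [Real.log_mul (by norm_num) hM0'.ne', ← elM]
    have : Real.log 4 = 2 * Real.log 2 := by
      rw [show (4 : ℝ) = 2 ^ 2 by norm_num, Real.log_pow]; norm_num
    have := Real.log_two_gt_d9
    linarith
  by_cases hc : max 0 X ≤ lM
  · obtain ⟨i, i1, i2, i3⟩ := pow2_near (max 0 X) (le_max_left _ _)
    obtain ⟨lb, elb⟩ : ∃ lb, lb = Real.log ((2 ^ i : ℕ) : ℝ) := ⟨_, rfl⟩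
    rw [← elb] at i1 i2
    have hib : 2 ^ i ≤ 4 * M := by
      refine natle _ _ (by positivity) (by omega) ?_
      rw [← elb]; linarith
    have hbP : 2 ^ i ≤ P.card := by
      rcases le_or_gt X 0 with hX | hX
      · rw [i3 (max_eq_left hX)]; simpa using hP0
      · refine natle _ _ (by positivity) hP0 ?_
        rw [← elb, ← ep]
        rw [max_eq_right hX.le] at i2
        linarith
    have := T1_step D e t hg T C Y hT hY M i j n hTn hCn hn hM0 hMn hj1 hj2 hib P (fun s hs => (hPs s hs).1) hq0 hbP Λ hΛ1 hΛ2 hΛ3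
      q p N y lM lb lam eq ep eN ey elM elb el
    have j1 := le_max_left 0 X
    have j2 := le_max_right 0 X
    rcases this with h | h | h | h
    · exfalso; linarith
    · exfalso; linarith
    · rcases max_cases 0 X with ⟨hm, _⟩ | ⟨hm, _⟩ <;> rw [hm] at i2
      · right; right; right; left; linarith
      · right; left; linarith
    · rcases max_cases 0 X with ⟨hm, _⟩ | ⟨hm, _⟩ <;> rw [hm] at i2
      · right; right; right; right; linarith
      · left; linarith
  · push Not at hc
    have hX : lM < X := by
      rcases max_cases 0 X with ⟨hm, _⟩ | ⟨hm, _⟩ <;> rw [hm] at hc <;> linarith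
    obtain ⟨E, eE⟩ : ∃ E, E = 4 * N - w - p + lM - 2 * y - 6 * lam := ⟨_, rfl⟩
    have hE0 : lM + 2 ≤ E := by linarith
    have hEp : E ≤ p := by linarith
    have hexp : 1 ≤ Real.exp E := Real.one_le_exp (by linarith)
    set p' := ⌊Real.exp E⌋₊ with hp'
    have hp'1 : 0 < p' := Nat.floor_pos.2 hexp
    have hp'2 : (p' : ℝ) ≤ Real.exp E := Nat.floor_le (by positivity)
    have hp'3 : Real.exp E ≤ 2 * p' := by
      have := (Nat.lt_floor_add_one (Real.exp E)).le
      have : (1 : ℝ) ≤ p' := by exact_mod_cast hp'1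
      linarith
    have hp'0 : (0 : ℝ) < p' := by exact_mod_cast hp'1
    obtain ⟨lp', elp'⟩ : ∃ x, x = Real.log p' := ⟨_, rfl⟩
    have l1 : lp' ≤ E := by
      have := log3 hp'0 hp'2
      rw [Real.log_exp] at this
      linarith
    have l2 : E ≤ lp' + 1 := by
      have := log3 (Real.exp_pos _) hp'3
      rw [Real.log_exp, Real.log_mul (by norm_num) hp'0.ne'] at this
      linarith [Real.log_two_lt_d9]
    have hpp : p' ≤ P.card := natle _ _ hp'1 hP0 (by rw [← elp', ← ep]; linarith)
    obtain ⟨P', P1, P2, P3⟩ := top_subset P (fun s => wt (TStar T C Y e M (2 ^ j) 1) (fun t => rk T t / M) s) p' hpp hp'1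
    rw [← card_nearQ, ← card_nearQ] at P3
    have hq'0 : 0 < (nearQ (TStar T C Y e M (2 ^ j) 1) (fun t => rk T t / M) P').card := by
      rcases Nat.eq_zero_or_pos (nearQ (TStar T C Y e M (2 ^ j) 1) (fun t => rk T t / M) P').card with h | h
      · rw [h] at P3
        have : 0 < p' * (nearQ (TStar T C Y e M (2 ^ j) 1) (fun t => rk T t / M) P).card := by positivity
        omega
      · exact h
    obtain ⟨q', eq'⟩ : ∃ q, q = Real.log (nearQ (TStar T C Y e M (2 ^ j) 1) (fun t => rk T t / M) P').card := ⟨_, rfl⟩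
    have hqq : lp' + q ≤ p + q' := by
      have hq'0' : (0 : ℝ) < (nearQ (TStar T C Y e M (2 ^ j) 1) (fun t => rk T t / M) P').card := by exact_mod_cast hq'0
      have := log3 (by positivity) (by exact_mod_cast P3 : (p' : ℝ) * (nearQ (TStar T C Y e M (2 ^ j) 1) (fun t => rk T t / M) P).card ≤
        P.card * (nearQ (TStar T C Y e M (2 ^ j) 1) (fun t => rk T t / M) P').card)
      rw [Real.log_mul (by positivity) (by positivity), Real.log_mul (by positivity) (by positivity)] at this
      rw [elp', eq, ep, eq']; exact this
    obtain ⟨i, i1, i2, -⟩ := pow2_near lM hlM0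
    obtain ⟨lb, elb⟩ : ∃ lb, lb = Real.log ((2 ^ i : ℕ) : ℝ) := ⟨_, rfl⟩
    rw [← elb] at i1 i2
    have hib : 2 ^ i ≤ 4 * M := by
      refine natle _ _ (by positivity) (by omega) ?_
      rw [← elb]; linarith
    have hbP : 2 ^ i ≤ P'.card := by
      rw [P2]
      refine natle _ _ (by positivity) hp'1 ?_
      rw [← elb, ← elp']
      linarith
    have := T1_step D e t hg T C Y hT hY M i j n hTn hCn hn hM0 hMn hj1 hj2 hib P' (fun s hs => (hPs s (P1 hs)).1) hq'0 hbP Λ hΛ1 hΛ2 hΛ3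
      q' lp' N y lM lb lam eq' (by rw [P2]; exact elp') eN ey elM elb el
    rcases this with h | h | h | h
    · exfalso; linarith
    · exfalso; linarith
    · right; left; linarith
    · right; right; left; linarith


lemma nat_le_of_log (a b : ℕ) (ha : 0 < a) (hb : 0 < b) (h : Real.log a ≤ Real.log b) : a ≤ b := by
  have := (Real.log_le_log_iff (by exact_mod_cast ha) (by exact_mod_cast hb)).1 h
  exact_mod_cast this

lemma log_natmul (a b : ℕ) (ha : 0 < a) (hb : 0 < b) : Real.log ((a * b : ℕ) : ℝ) = Real.log a + Real.log b := by
  have ha' : (0 : ℝ) < a := by exact_mod_cast ha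
  have hb' : (0 : ℝ) < b := by exact_mod_cast hb
  push_cast
  exact Real.log_mul ha'.ne' hb'.ne'

set_option maxHeartbeats 1000000 in
/-- structure level for the set `T` itself -/
theorem AL (D : Set ℝ) (e : ℝ → ℝ) (he : StrictMonoOn e D) (T C Y Z : Finset ℝ)
    (hT : ∀ t ∈ T, t ∈ D) (hY : ∀ t ∈ T, ∀ c ∈ C, e t + c ∈ Y) (hZ : ∀ t ∈ T, ∀ b ∈ T, t + b ∈ Z) (n G : ℕ)
    (hTn : T.card = n) (hCn : C.card = n) (hn : 0 < n) (hG : 0 < G)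
    (Λ : ℝ) (hΛ1 : 2 ^ 40 ≤ Λ) (hΛ3 : 10 * ((Nat.log 2 (Y.card ^ 2) : ℝ) + 1) ≤ Λ)
    (N y lam : ℝ) (eN : N = Real.log n) (ey : y = Real.log Z.card) (el : lam = Real.log Λ)
    (h2 : y + 50 * lam ≤ 2 * N) :
    ∃ (M j : ℕ) (P : Finset ℝ), 0 < M ∧ 16 * M ≤ n ∧ 256 * G * Y.card * M ≤ n * 2 ^ j ∧ 2 ^ j * n ≤ 512 * G * Y.card * M ∧
      P.Nonempty ∧ (∀ s ∈ P, 0 < s) ∧ 0 < (nearQ (TStar T C Y e M (2 ^ j) G) (fun t => rk T t / M) P).card ∧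
      ∃ (lM w p q : ℝ), lM = Real.log M ∧ p = Real.log P.card ∧ q = Real.log (nearQ (TStar T C Y e M (2 ^ j) G) (fun t => rk T t / M) P).card ∧
      0 ≤ lM ∧ 0 ≤ p ∧
      y ≤ N + lM ∧ N + lM ≤ y + lam ∧ p + w ≤ N + lM ∧ 0 ≤ w ∧ w ≤ N ∧ 2 * N ≤ lam + q + w ∧ q ≤ p + w + 1 ∧ p + w ≤ q ∧
      1 + lM ≤ Real.log ((4 * M : ℕ) : ℝ) := by
  have hlam := lam_ge hΛ1 el
  have hyn : n ≤ Y.card := by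
    obtain ⟨a, ha⟩ : T.Nonempty := Finset.card_pos.1 (by omega)
    rw [← hCn]
    exact Finset.card_le_card_of_injOn (fun c => e a + c) (fun c hc => hY a ha c hc) (fun c _ c' _ h => by simpa using h)
  have hzn : n ≤ Z.card := by
    obtain ⟨a, ha⟩ : T.Nonempty := Finset.card_pos.1 (by omega)
    rw [← hTn]
    exact Finset.card_le_card_of_injOn (fun c => a + c) (fun c hc => hZ a ha c hc) (fun c _ c' _ h => by simpa using h)
  have hn0 : (0 : ℝ) < n := by exact_mod_cast hn
  have hz0 : (0 : ℝ) < Z.card := by exact_mod_cast (by omega : 0 < Z.card)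
  obtain ⟨M, hM0, hM1, hM2⟩ := M_setup n Z.card hn hzn
  have hM0' : (0 : ℝ) < M := by exact_mod_cast hM0
  obtain ⟨lM, elM⟩ : ∃ lM, lM = Real.log M := ⟨_, rfl⟩
  have hMa : y ≤ N + lM := by
    have : (Z.card : ℝ) ≤ n * M := by
      have : Z.card ≤ n * M := by omega
      exact_mod_cast this
    have := log3 hz0 this
    rw [Real.log_mul (by positivity) (by positivity)] at this
    rw [eN, ey, elM]; exact this
  have hMb : N + lM ≤ y + lam := by
    have : (n : ℝ) * M ≤ 13 * Z.card := by exact_mod_cast hM2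
    have := log_le_of_lam hΛ1 el (n * M) Z.card (by positivity) hz0 (this.trans (by gcongr; norm_num))
    rw [Real.log_mul (by positivity) (by positivity)] at this
    rw [eN, ey, elM]; linarith
  have hMn : 16 * M ≤ n := by
    have : Real.log (16 * M) ≤ Real.log n := by
      have := log_le_of_lam hΛ1 el (16 * M) M (by positivity) hM0' (by gcongr; norm_num)
      rw [← eN]; rw [← elM] at this
      linarith
    have := (Real.log_le_log_iff (by positivity) hn0).1 this
    exact_mod_cast this
  have hlogn : 10 * ((Nat.log 2 n : ℝ) + 1) ≤ Λ := by
    refine le_trans ?_ hΛ3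
    have : Nat.log 2 n ≤ Nat.log 2 (Y.card ^ 2) := Nat.log_mono_right (by nlinarith)
    have : (Nat.log 2 n : ℝ) ≤ Nat.log 2 (Y.card ^ 2) := by exact_mod_cast this
    linarith
  obtain ⟨j, hj1, hj2⟩ := pow2_setup n Y.card G M hn hyn hG hM0
  have hst : 3 * n ≤ 4 * (TStar T C Y e M (2 ^ j) G).card := by
    rw [← hTn]
    exact TStar_card D e he T C Y hT M (2 ^ j) G hM0 (by positivity) (by omega) (by rw [hTn]; exact hj1)
  have hsub : TStar T C Y e M (2 ^ j) G ⊆ T := Finset.filter_subset _ _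
  obtain ⟨W, P, hW0, hWn, hPne, hPs, hq0, hq1, hpw⟩ := level_log T T (TStar T C Y e M (2 ^ j) G) (TStar T C Y e M (2 ^ j) G) Z n M hTn hTn hsub hsub hst hst
    hn hM0 (by omega) hM1 (fun t ht b hb => hZ t (hsub ht) b (hsub hb)) Λ hlogn
  have hP0 : 0 < P.card := Finset.card_pos.2 hPne
  have hP0' : (0 : ℝ) < P.card := by exact_mod_cast hP0
  have hW0' : (0 : ℝ) < W := by exact_mod_cast hW0
  obtain ⟨w, ew⟩ : ∃ w, w = Real.log W := ⟨_, rfl⟩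
  obtain ⟨p, ep⟩ : ∃ p, p = Real.log P.card := ⟨_, rfl⟩
  have hw0 : 0 ≤ w := by
    rw [ew]; exact Real.log_natCast_nonneg _
  have hp0 : 0 ≤ p := by
    rw [ep]; exact Real.log_natCast_nonneg _
  have hlM0 : 0 ≤ lM := by
    rw [elM]; exact Real.log_natCast_nonneg _
  have hwN : w ≤ N := by
    rw [ew, eN]; exact log3 hW0' (by exact_mod_cast hWn)
  have hpw' : p + w ≤ N + lM := by
    have : (P.card : ℝ) * W ≤ n * M := by exact_mod_cast hpw
    have := log3 (by positivity) this
    rw [Real.log_mul (by positivity) (by positivity), Real.log_mul (by positivity) (by positivity)] at this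
    rw [ep, ew, eN, elM]; exact this
  obtain ⟨q, eq⟩ : ∃ q, q = Real.log (nearQ (TStar T C Y e M (2 ^ j) G) (fun t => rk T t / M) P).card := ⟨_, rfl⟩
  have hq0' : (0 : ℝ) < (nearQ (TStar T C Y e M (2 ^ j) G) (fun t => rk T t / M) P).card := by exact_mod_cast hq0
  have hL0 : 0 < Λ := lt_of_lt_of_le (by norm_num) hΛ1
  have hq : 2 * N ≤ lam + q + w := by
    have := log3 (by positivity) hq1
    rw [Real.log_mul (by positivity) (by positivity), Real.log_mul (by positivity) (by positivity), Real.log_pow] at this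
    push_cast at this
    rw [eN, eq, ew, el]; linarith
  have hqa : (nearQ (TStar T C Y e M (2 ^ j) G) (fun t => rk T t / M) P).card ≤ P.card * (2 * W) := by
    rw [card_nearQ, ← smul_eq_mul]
    exact Finset.sum_le_card_nsmul _ _ _ (fun s hs => (hPs s hs).2.2)
  have hqb : P.card * W ≤ (nearQ (TStar T C Y e M (2 ^ j) G) (fun t => rk T t / M) P).card := by
    rw [card_nearQ, ← smul_eq_mul]
    exact Finset.card_nsmul_le_sum _ _ _ (fun s hs => (hPs s hs).2.1)
  have hqa' : q ≤ p + w + 1 := by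
    have := log3 hq0' (by exact_mod_cast hqa : ((nearQ (TStar T C Y e M (2 ^ j) G) (fun t => rk T t / M) P).card : ℝ) ≤ P.card * (2 * W))
    rw [Real.log_mul (by positivity) (by positivity), Real.log_mul (by positivity) (by positivity), ← eq, ← ep, ← ew] at this
    linarith [Real.log_two_lt_d9]
  have hqb' : p + w ≤ q := by
    have := log3 (by positivity) (by exact_mod_cast hqb : (P.card : ℝ) * W ≤ ((nearQ (TStar T C Y e M (2 ^ j) G) (fun t => rk T t / M) P).card : ℝ))
    rw [Real.log_mul (by positivity) (by positivity), ← eq, ← ep, ← ew] at this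
    exact this
  have h4M : 1 + lM ≤ Real.log ((4 * M : ℕ) : ℝ) := by
    push_cast
    rw [Real.log_mul (by norm_num) hM0'.ne', ← elM]
    have : Real.log 4 = 2 * Real.log 2 := by
      rw [show (4 : ℝ) = 2 ^ 2 by norm_num, Real.log_pow]; norm_num
    have := Real.log_two_gt_d9
    linarith
  exact ⟨M, j, P, hM0, hMn, hj1, hj2, hPne, fun s hs => (hPs s hs).1, hq0, lM, w, p, q, elM, ep, eq, hlM0, hp0, hMa, hMb, hpw', hw0, hwN, hq, hqa', hqb', h4M⟩

set_option maxHeartbeats 1000000 in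
theorem T2 (D : Set ℝ) (e : ℝ → ℝ) (t : ℕ) (hg : Good D e t) (T C Y Z : Finset ℝ)
    (hT : ∀ t ∈ T, t ∈ D) (hY : ∀ t ∈ T, ∀ c ∈ C, e t + c ∈ Y) (hZ : ∀ t ∈ T, ∀ b ∈ T, t + b ∈ Z) (n : ℕ)
    (hTn : T.card = n) (hCn : C.card = n) (hn : 0 < n)
    (Λ : ℝ) (hΛ1 : 2 ^ 40 ≤ Λ) (hΛ2 : (t : ℝ) + 1 ≤ Λ) (hΛ3 : 10 * ((Nat.log 2 (Y.card ^ 2) : ℝ) + 1) ≤ Λ)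
    (N y z lam : ℝ) (eN : N = Real.log n) (ey : y = Real.log Z.card) (ez : z = Real.log Y.card) (el : lam = Real.log Λ)
    (h2 : 2 * y + 50 * lam ≤ 3 * N) (h3 : 50 * lam ≤ N) :
    9 * N ≤ 4 * z + 3 * y + 50 * lam ∨ 4 * N ≤ 2 * z + y + 50 * lam ∨ 7 * N ≤ 2 * z + 3 * y + 50 * lam := by
  classical
  have hlam := lam_ge hΛ1 el
  obtain ⟨M, j, P, hM0, hMn, hj1, hj2, hPne, hPs, hq0, lM, w, p, q, elM, ep, eq, hlM0, hp0, hMa, hMb, hpw, hw0, hwN, hq, hqa, hqb, h4M⟩ :=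
    AL D e hg.smono T C Y Z hT hY hZ n 1 hTn hCn hn one_pos Λ hΛ1 hΛ3 N y lam eN ey el (by linarith)
  obtain ⟨i, i1, i2, i3⟩ := pow2_near (max 0 (p - w + 3 * lam)) (le_max_left _ _)
  obtain ⟨lb, elb⟩ : ∃ lb, lb = Real.log ((2 ^ i : ℕ) : ℝ) := ⟨_, rfl⟩
  rw [← elb] at i1 i2
  have hmax : max 0 (p - w + 3 * lam) ≤ lM := max_le hlM0 (by linarith)
  have hib : 2 ^ i ≤ 4 * M := by
    refine nat_le_of_log _ _ (by positivity) (by omega) ?_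
    rw [← elb]; linarith
  have hP0 : 0 < P.card := Finset.card_pos.2 hPne
  have hbP : 2 ^ i ≤ P.card := by
    rcases le_or_gt (p - w + 3 * lam) 0 with hX | hX
    · rw [i3 (max_eq_left hX)]; simpa using hP0
    · refine nat_le_of_log _ _ (by positivity) hP0 ?_
      rw [← elb, ← ep]
      rw [max_eq_right hX.le] at i2
      linarith
  set 𝒟 : Finset (ℝ × ℝ) := C.image (fun c => (c, c)) with h𝒟
  have hDc : 𝒟.card = n := by
    rw [h𝒟, Finset.card_image_of_injective _ (fun a b h => (Prod.ext_iff.1 h).1), hCn]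
  have h𝒟m : ∀ p ∈ 𝒟, ∃ c ∈ C, p = (c, c) := by
    intro p hp
    obtain ⟨c, hc, rfl⟩ := Finset.mem_image.1 hp
    exact ⟨c, hc, rfl⟩
  have h := HT_log D e t hg T C Y hT hY M 1 i j 1 n one_pos hTn hCn hn hM0 hj1 hj2 (by omega) one_pos P hPs hq0 𝒟
    (by
      intro p hp
      obtain ⟨c, hc, rfl⟩ := h𝒟m p hp
      exact ⟨hc, hc, rfl⟩) (by omega) {0}
    (by
      intro p hp
      obtain ⟨c, hc, rfl⟩ := h𝒟m p hp
      simp) hbP (by omega) Λ hΛ1 hΛ2 hΛ3 q p _ N _ z lM lb _ lam eq ep rfl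
    eN rfl ez elM elb rfl el
  rw [hDc, ← eN] at h
  simp only [Finset.card_singleton, Nat.cast_one, Real.log_one] at h
  have j1 := le_max_left 0 (p - w + 3 * lam)
  have j2 := le_max_right 0 (p - w + 3 * lam)
  rcases h with h | h | h | h
  · exfalso; linarith [h.1]
  · exfalso; linarith
  · rcases max_cases 0 (p - w + 3 * lam) with ⟨hm, _⟩ | ⟨hm, _⟩ <;> rw [hm] at i2
    · right; left; linarith
    · right; right; linarith
  · left; linarith

set_option maxHeartbeats 1000000 in
theorem T3 (D : Set ℝ) (e : ℝ → ℝ) (t : ℕ) (hg : Good D e t) (T C Y Z : Finset ℝ)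
    (hT : ∀ t ∈ T, t ∈ D) (hY : ∀ t ∈ T, ∀ c ∈ C, e t + c ∈ Y) (hZ : ∀ t ∈ T, ∀ b ∈ T, t + b ∈ Z) (n : ℕ)
    (hTn : T.card = n) (hCn : C.card = n) (hn : 0 < n)
    (Λ : ℝ) (hΛ1 : 2 ^ 40 ≤ Λ) (hΛ2 : (t : ℝ) + 1 ≤ Λ) (hΛ3 : 10 * ((Nat.log 2 (Y.card ^ 2) : ℝ) + 1) ≤ Λ)
    (N y z lam : ℝ) (eN : N = Real.log n) (ey : y = Real.log Z.card) (ez : z = Real.log Y.card) (el : lam = Real.log Λ)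
    (h2 : 2 * y + 50 * lam ≤ 3 * N) (h3 : 50 * lam ≤ N)
    (MB WB : ℕ) (PB : Finset ℝ) (hMB : 0 < MB) (hWB : 0 < WB) (hWBn : WB ≤ n) (hPBne : PB.Nonempty)
    (hPB : ∀ s ∈ PB, 0 < s ∧ WB ≤ (C.filter (fun x => x + s ∈ C ∧ rk C (x + s) < rk C x + MB)).card)
    (lMB wB pB mu X : ℝ) (elMB : lMB = Real.log MB) (ewB : wB = Real.log WB) (epB : pB = Real.log PB.card)
    (emu : mu = N + lMB - pB - wB) (hmu : 0 ≤ mu) (hX0 : 0 ≤ X) (hX1 : X ≤ lMB) (hX2 : X ≤ y - N)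
    (hX3 : X + N / 2 + (y - N) + 50 * lam ≤ wB) :
    5 * N + 2 * X ≤ 4 * mu + 2 * z + 2 * y + 50 * lam ∨ 9 * N + X ≤ 6 * mu + 4 * z + 3 * y + 50 * lam ∨ 2 * N ≤ y + 2 * mu + 50 * lam := by
  classical
  have hlam := lam_ge hΛ1 el
  by_cases hlast : 2 * N ≤ y + 2 * mu + 50 * lam
  · right; right; exact hlast
  push Not at hlast
  have l2a := Real.log_two_gt_d9
  have l2b := Real.log_two_lt_d9
  have hexp : 1 ≤ Real.exp X := Real.one_le_exp hX0
  set κ := ⌊Real.exp X⌋₊ with hκd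
  have hκ0 : 0 < κ := Nat.floor_pos.2 hexp
  have hκ0' : (0 : ℝ) < κ := by exact_mod_cast hκ0
  obtain ⟨lκ, elκ⟩ : ∃ x, x = Real.log κ := ⟨_, rfl⟩
  have k1 : lκ ≤ X := by
    have := log3 hκ0' (Nat.floor_le (Real.exp_pos X).le)
    rw [Real.log_exp] at this
    linarith
  have k2 : X ≤ lκ + 1 := by
    have h1 := (Nat.lt_floor_add_one (Real.exp X)).le
    have h2 : (1 : ℝ) ≤ κ := by exact_mod_cast hκ0
    have h3 : Real.exp X ≤ 2 * κ := by linarith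
    have := log3 (Real.exp_pos _) h3
    rw [Real.log_exp, Real.log_mul (by norm_num) hκ0'.ne'] at this
    linarith
  have k0 : 0 ≤ lκ := by rw [elκ]; exact Real.log_natCast_nonneg _
  have hκM : κ ≤ MB := nat_le_of_log _ _ hκ0 hMB (by rw [← elκ, ← elMB]; linarith)
  obtain ⟨𝒟, H, d1, d2, d3⟩ := BS_main C PB n MB κ WB hCn hκ0 hκM hWBn hPB
  have hPB0 : 0 < PB.card := Finset.card_pos.2 hPBne
  have hPB0' : (0 : ℝ) < PB.card := by exact_mod_cast hPB0
  have hWB0' : (0 : ℝ) < WB := by exact_mod_cast hWB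
  have hMB0' : (0 : ℝ) < MB := by exact_mod_cast hMB
  have hn0 : (0 : ℝ) < n := by exact_mod_cast hn
  have hD0 : 0 < 𝒟.card := by
    rcases Nat.eq_zero_or_pos 𝒟.card with h | h
    · rw [h] at d3
      have : 0 < (PB.card * WB) ^ 2 * κ := by positivity
      omega
    · exact h
  have hD0' : (0 : ℝ) < 𝒟.card := by exact_mod_cast hD0
  obtain ⟨ld, eld⟩ : ∃ x, x = Real.log 𝒟.card := ⟨_, rfl⟩
  have l8 : Real.log 8 = 3 * Real.log 2 := by
    rw [show (8 : ℝ) = 2 ^ 3 by norm_num, Real.log_pow]; norm_num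
  have hld : N + lκ - 2 * mu - 3 ≤ ld := by
    have h1 : ((PB.card : ℝ) * WB) ^ 2 * κ ≤ 8 * n * (MB : ℝ) ^ 2 * 𝒟.card := by exact_mod_cast d3
    have := log3 (by positivity) h1
    rw [Real.log_mul (by positivity) (by positivity), Real.log_pow, Real.log_mul (by positivity) (by positivity),
      Real.log_mul (by positivity) (by positivity), Real.log_mul (by positivity) (by positivity), Real.log_mul (by positivity) (by positivity),
      Real.log_pow, ← elκ, ← ewB, ← epB, ← elMB, ← eN, ← eld] at this
    push_cast at this
    linarith
  obtain ⟨G, hGe⟩ : ∃ G : ℕ, G = ⌈2 * Real.exp (2 * mu)⌉₊ := ⟨_, rfl⟩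
  have hem : 1 ≤ Real.exp (2 * mu) := Real.one_le_exp (by linarith)
  have hG1 : 2 * Real.exp (2 * mu) ≤ G := by rw [hGe]; exact Nat.le_ceil _
  have hG2 : (G : ℝ) ≤ 4 * Real.exp (2 * mu) := by
    have := (Nat.ceil_lt_add_one (a := 2 * Real.exp (2 * mu)) (by positivity)).le
    rw [← hGe] at this
    linarith
  have hG0' : (0 : ℝ) < G := by linarith
  have hG0 : 0 < G := by exact_mod_cast hG0'
  obtain ⟨lG, elG⟩ : ∃ x, x = Real.log G := ⟨_, rfl⟩
  have hlG : lG ≤ 2 * mu + 2 := by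
    have := log3 hG0' hG2
    have l4 : Real.log 4 = 2 * Real.log 2 := by
      rw [show (4 : ℝ) = 2 ^ 2 by norm_num, Real.log_pow]; norm_num
    rw [Real.log_mul (by norm_num) (by positivity), Real.log_exp] at this
    linarith
  have hDc : κ * n ≤ 4 * G * 𝒟.card := by
    have e1 : Real.exp (2 * mu) * ((PB.card : ℝ) * WB) ^ 2 = ((n : ℝ) * MB) ^ 2 := by
      have : 2 * mu = Real.log (((n : ℝ) * MB) ^ 2) - Real.log (((PB.card : ℝ) * WB) ^ 2) := by
        rw [Real.log_pow, Real.log_pow, Real.log_mul (by positivity) (by positivity), Real.log_mul (by positivity) (by positivity), emu, eN, elMB, epB, ewB]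
        push_cast; ring
      rw [this, Real.exp_sub, Real.exp_log (by positivity), Real.exp_log (by positivity)]
      field_simp
    have h1 : ((PB.card : ℝ) * WB) ^ 2 * κ ≤ 8 * n * (MB : ℝ) ^ 2 * 𝒟.card := by exact_mod_cast d3
    have h2 : (8 * n * (MB : ℝ) ^ 2) * ((κ : ℝ) * n) ≤ (8 * n * (MB : ℝ) ^ 2) * (4 * G * 𝒟.card) := by
      calc (8 * n * (MB : ℝ) ^ 2) * ((κ : ℝ) * n) = 8 * (((n : ℝ) * MB) ^ 2) * κ := by ring
        _ = 4 * (2 * Real.exp (2 * mu)) * (((PB.card : ℝ) * WB) ^ 2 * κ) := by rw [← e1]; ring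
        _ ≤ 4 * G * (8 * n * (MB : ℝ) ^ 2 * 𝒟.card) := by gcongr
        _ = _ := by ring
    have h3 := le_of_mul_le_mul_left h2 (by positivity)
    exact_mod_cast h3
  obtain ⟨lH, elH⟩ : ∃ x, x = Real.log H.card := ⟨_, rfl⟩
  have hH0 : 0 < H.card := by
    obtain ⟨x, hx⟩ := Finset.card_pos.1 hD0
    exact Finset.card_pos.2 ⟨_, (d1 x hx).2.2.2⟩
  have hlH : lH + 2 * wB ≤ 3 + 2 * N + lκ := by
    have hH0' : (0 : ℝ) < H.card := by exact_mod_cast hH0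
    have h1 : (H.card : ℝ) * (WB : ℝ) ^ 2 ≤ 8 * (n : ℝ) ^ 2 * κ := by exact_mod_cast d2
    have := log3 (by positivity) h1
    rw [Real.log_mul (by positivity) (by positivity), Real.log_pow, Real.log_mul (by positivity) (by positivity), Real.log_mul (by positivity) (by positivity),
      Real.log_pow, ← elκ, ← ewB, ← eN, ← elH] at this
    push_cast at this
    linarith
  obtain ⟨M, j, P, hM0, hMn, hj1, hj2, hPne, hPs, hq0, lM, w, p, q, elM, ep, eq, hlM0, hp0, hMa, hMb, hpw, hw0, hwN, hq, hqa, hqb, h4M⟩ :=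
    AL D e hg.smono T C Y Z hT hY hZ n G hTn hCn hn hG0 Λ hΛ1 hΛ3 N y lam eN ey el (by linarith)
  have hP0 : 0 < P.card := Finset.card_pos.2 hPne
  obtain ⟨β, eβ⟩ : ∃ β, β = min (lM - lκ) p := ⟨_, rfl⟩
  have hβ0 : 0 ≤ β := by rw [eβ]; exact le_min (by linarith) hp0
  have hβ1 : β ≤ lM - lκ := by rw [eβ]; exact min_le_left _ _
  have hβ2 : β ≤ p := by rw [eβ]; exact min_le_right _ _
  obtain ⟨i, i1, i2⟩ : ∃ i : ℕ, β - 1 ≤ Real.log ((2 ^ i : ℕ) : ℝ) ∧ Real.log ((2 ^ i : ℕ) : ℝ) ≤ β := by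
    rcases le_or_gt β 1 with h | h
    · exact ⟨0, by simp; linarith, by simpa using hβ0⟩
    · obtain ⟨i, a, b, -⟩ := pow2_near (β - 1) (by linarith)
      exact ⟨i, a, by linarith⟩
  obtain ⟨lb, elb⟩ : ∃ lb, lb = Real.log ((2 ^ i : ℕ) : ℝ) := ⟨_, rfl⟩
  rw [← elb] at i1 i2
  have hbP : 2 ^ i ≤ P.card := by
    refine nat_le_of_log _ _ (by positivity) hP0 ?_
    rw [← elb, ← ep]; linarith
  have hκb : κ * 2 ^ i ≤ 4 * M := by
    refine nat_le_of_log _ _ (by positivity) (by omega) ?_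
    rw [log_natmul _ _ hκ0 (by positivity), ← elb, ← elκ]
    linarith
  have hbD : 2 * 2 ^ i ≤ 𝒟.card := by
    refine nat_le_of_log _ _ (by positivity) hD0 ?_
    rw [log_natmul _ _ two_pos (by positivity), ← elb, ← eld]
    push_cast
    linarith
  have h := HT_log D e t hg T C Y hT hY M κ i j G n hκ0 hTn hCn hn hM0 hj1 hj2 hκb hG0 P hPs hq0 𝒟
    (fun p hp => ⟨(d1 p hp).1, (d1 p hp).2.1, (d1 p hp).2.2.1⟩) hDc H (fun p hp => (d1 p hp).2.2.2) hbP hbD Λ hΛ1 hΛ2 hΛ3 q p ld N lG z lM lb lH lam eq ep eld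
    eN elG ez elM elb elH el
  rcases h with h | h | h | h
  · exfalso
    have h := h.1
    rcases min_cases (lM - lκ) p with ⟨hm, _⟩ | ⟨hm, _⟩ <;> rw [hm] at eβ <;> linarith
  · exfalso; linarith
  · left; linarith
  · right; left; linarith


lemma rk_neg (B : Finset ℝ) (b : ℝ) (hb : b ∈ B) : rk B b + rk (B.image (fun x => -x)) (-b) + 1 = B.card := by
  have h1 : rk (B.image (fun x => -x)) (-b) = (B.filter (fun x => b < x)).card := by
    rw [rk, Finset.filter_image, Finset.card_image_of_injective _ neg_injective]
    congr 1
    ext x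
    simp
  rw [h1, rk]
  have h2 := Finset.card_filter_add_card_filter_not (s := B) (fun x => x < b)
  have h3 : (B.filter (fun x => ¬ x < b)).card = (B.filter (fun x => b < x)).card + 1 := by
    rw [show B.filter (fun x => ¬ x < b) = insert b (B.filter (fun x => b < x)) by
      ext x
      simp only [Finset.mem_filter, Finset.mem_insert, not_lt]
      constructor
      · rintro ⟨h, h'⟩
        rcases h'.eq_or_lt with h'' | h''
        · exact Or.inl h''.symm
        · exact Or.inr ⟨h, h''⟩
      · rintro (rfl | ⟨h, h'⟩)
        · exact ⟨hb, le_rfl⟩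
        · exact ⟨h, h'.le⟩]
    rw [Finset.card_insert_of_notMem (by simp)]
  omega

lemma wt_neg (B : Finset ℝ) (M : ℕ) (hM : 0 < M) (s : ℝ) :
    wt (B.image (fun x => -x)) (fun b => rk (B.image (fun x => -x)) b / M) s ≤
      (B.filter (fun x => x + s ∈ B ∧ rk B (x + s) < rk B x + M)).card := by
  refine Finset.card_le_card_of_injOn (fun x => -(x + s)) ?_ ?_
  · intro x hx
    obtain ⟨h1, h2, h3⟩ := Finset.mem_filter.1 hx
    obtain ⟨a, ha, rfl⟩ := Finset.mem_image.1 h1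
    obtain ⟨b, hb, hbe⟩ := Finset.mem_image.1 h2
    have e1 : -(-a + s) = b := by linarith
    have e2 : b + s = a := by linarith
    simp only [e1]
    refine Finset.mem_coe.2 (Finset.mem_filter.2 ⟨hb, by rw [e2]; exact ha, ?_⟩)
    rw [e2]
    have r1 := rk_neg B a ha
    have r2 := rk_neg B b hb
    rw [← hbe] at h3
    simp only at h3
    have d1 := Nat.div_add_mod (rk (B.image (fun x => -x)) (-b)) M
    have d2 := Nat.div_add_mod (rk (B.image (fun x => -x)) (-a)) M
    have d3 := Nat.mod_lt (rk (B.image (fun x => -x)) (-b)) hM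
    have d4 := Nat.mod_lt (rk (B.image (fun x => -x)) (-a)) hM
    rw [h3] at d1
    omega
  · intro x _ y _ h
    simp only at h
    linarith

set_option maxHeartbeats 1000000 in
theorem convex_piece (g : Polynomial ℝ) (e : ℕ) (hd : g.natDegree = e + 2) (J : Set ℝ) (hJ : Cvx g J)
    (A B SA SB : Finset ℝ) (n : ℕ) (hA : A.card = n) (hB : B.card = n) (hn : 0 < n) (hAJ : ∀ a ∈ A, a ∈ J)
    (hSA : ∀ a ∈ A, ∀ a' ∈ A, a + a' ∈ SA) (hSB : ∀ a ∈ A, ∀ b ∈ B, g.eval a + b ∈ SB)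
    (Λ : ℝ) (hΛ1 : 2 ^ 40 ≤ Λ) (hΛ2 : (kdeg e : ℝ) + 1 ≤ Λ)
    (hΛ3 : 10 * ((Nat.log 2 (SA.card ^ 2) : ℝ) + 1) ≤ Λ) (hΛ4 : 10 * ((Nat.log 2 (SB.card ^ 2) : ℝ) + 1) ≤ Λ)
    (N y z lam : ℝ) (eN : N = Real.log n) (ey : y = Real.log SA.card) (ez : z = Real.log SB.card) (el : lam = Real.log Λ) :
    9 * N ≤ 3 * z + 4 * y + 10000 * lam ∨ 32 * N ≤ 13 * z + 12 * y + 10000 * lam := by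
  have hlam := lam_ge hΛ1 el
  by_contra hneg
  rw [not_or] at hneg
  obtain ⟨g1, g2⟩ := hneg
  push Not at g1 g2
  obtain ⟨a0, ha0⟩ : A.Nonempty := Finset.card_pos.1 (by omega)
  have hn0 : (0 : ℝ) < n := by exact_mod_cast hn
  have hyN : N ≤ y := by
    rw [eN, ey]
    refine log3 hn0 ?_
    have : n ≤ SA.card := by
      rw [← hA]
      exact Finset.card_le_card_of_injOn (fun c => a0 + c) (fun c hc => hSA a0 ha0 c hc) (fun c _ c' _ h => by simpa using h)
    exact_mod_cast this
  have hzN : N ≤ z := by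
    rw [eN, ez]
    refine log3 hn0 ?_
    have : n ≤ SB.card := by
      rw [← hB]
      exact Finset.card_le_card_of_injOn (fun c => g.eval a0 + c) (fun c hc => hSB a0 ha0 c hc) (fun c _ c' _ h => by simpa using h)
    exact_mod_cast this
  have hNl : 500 * lam ≤ N := by linarith
  have b1 : 2 * y + z + 50 * lam ≤ 4 * N := by linarith
  have b2 : 2 * y + 50 * lam ≤ 3 * N := by linarith
  have b3 : z + 50 * lam ≤ 2 * N := by linarith
  have t2 := T2 J (fun x => g.eval x) (kdeg e) (good_fwd g e hd J hJ) A B SB SA hAJ hSB hSA n hA hB hn Λ hΛ1 hΛ2 hΛ4 N y z lam eN ey ez el b2 (by linarith)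
  have hyb : 9 * y ≤ 11 * N + 1000 * lam := by
    by_contra hh
    push Not at hh
    rcases t2 with t2 | t2 | t2 <;> linarith
  have hzb : 4 * N ≤ 3 * z + 1000 * lam := by
    rcases t2 with t2 | t2 | t2 <;> linarith
  have hcn : ∀ S : Finset ℝ, (S.image (fun x => -x)).card = S.card := fun S => Finset.card_image_of_injective _ neg_injective
  have hgi : Set.InjOn (fun x => g.eval x) J := hJ.smono.injOn
  obtain ⟨M, W, P, hM0, hMn, hW0, hWn, hPne, hPs, lM, w, p, elM, ew, ep, c1, c2, c3, c4, c5, t1⟩ :=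
    T1 _ _ _ (good_inv g e hd J hJ) (A.image (fun a => -g.eval a)) (A.image (fun x => -x)) (SA.image (fun x => -x)) (B.image (fun x => -x)) (SB.image (fun x => -x))
      (by
        intro t ht
        obtain ⟨a, ha, rfl⟩ := Finset.mem_image.1 ht
        exact ⟨a, hAJ a ha, by simp⟩)
      (by
        intro t ht c hc
        obtain ⟨a, ha, rfl⟩ := Finset.mem_image.1 ht
        obtain ⟨a', ha', rfl⟩ := Finset.mem_image.1 hc
        have : Function.invFunOn (fun x => g.eval x) J (- - g.eval a) = a := by
          rw [neg_neg]
          exact hgi.leftInvOn_invFunOn (hAJ a ha)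
        simp only [this]
        refine Finset.mem_image.2 ⟨a + a', hSA a ha a' ha', by ring⟩)
      (by
        intro t ht c hc
        obtain ⟨a, ha, rfl⟩ := Finset.mem_image.1 ht
        obtain ⟨b, hb, rfl⟩ := Finset.mem_image.1 hc
        refine Finset.mem_image.2 ⟨g.eval a + b, hSB a ha b hb, by ring⟩) n
      (by
        rw [Finset.card_image_of_injOn, hA]
        intro a ha a' ha' h
        exact hgi (hAJ a ha) (hAJ a' ha') (by simpa using h))
      (by rw [hcn, hA]) (by rw [hcn, hB]) hn Λ hΛ1 hΛ2 (by rw [hcn]; exact hΛ3) N y z lam eN (by rw [hcn]; exact ey) (by rw [hcn]; exact ez) el b1 b2 b3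
  obtain ⟨mu, emu⟩ : ∃ mu, mu = N + lM - p - w := ⟨_, rfl⟩
  by_cases hneg : w - N / 2 - (y - N) - 50 * lam < 0
  · rcases t1 with t1 | t1 | t1 | t1 | t1 <;> linarith
  push Not at hneg
  rcases t1 with t1 | t1 | t1 | t1 | t1
  · have hmu : 0 ≤ mu := by linarith
    · obtain ⟨X, eX⟩ : ∃ X, X = min (y - N) (w - N / 2 - (y - N) - 50 * lam) := ⟨_, rfl⟩
      have hXa : X ≤ y - N := by rw [eX]; exact min_le_left _ _
      have hXb : X ≤ w - N / 2 - (y - N) - 50 * lam := by rw [eX]; exact min_le_right _ _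
      have hX0 : 0 ≤ X := by rw [eX]; exact le_min (by linarith) hneg
      have t3 := T3 J (fun x => g.eval x) (kdeg e) (good_fwd g e hd J hJ) A B SB SA hAJ hSB hSA n hA hB hn Λ hΛ1 hΛ2 hΛ4 N y z lam eN ey ez el b2 (by linarith)
        M W P hM0 hW0 hWn hPne (fun s hs => ⟨(hPs s hs).1, (hPs s hs).2.trans (wt_neg B M hM0 s)⟩) lM w p mu X elM ew ep emu hmu hX0 (by linarith) hXa (by linarith)
      rcases min_cases (y - N) (w - N / 2 - (y - N) - 50 * lam) with ⟨hm, _⟩ | ⟨hm, _⟩ <;> rw [hm] at eX <;>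
        rcases t3 with t3 | t3 | t3 <;> linarith
  all_goals linarith


theorem piece2 (g : Polynomial ℝ) (e : ℕ) (hd : g.natDegree = e + 2) (J : Set ℝ) (hJo : J.OrdConnected) (hJp : IsOpen J)
    (hs1 : (∀ x ∈ J, 0 < g.derivative.eval x) ∨ (∀ x ∈ J, g.derivative.eval x < 0))
    (hs2 : ∀ x ∈ J, 0 < g.derivative.derivative.eval x)
    (A B SA SB : Finset ℝ) (n : ℕ) (hA : A.card = n) (hB : B.card = n) (hn : 0 < n) (hAJ : ∀ a ∈ A, a ∈ J)
    (hSA : ∀ a ∈ A, ∀ a' ∈ A, a + a' ∈ SA) (hSB : ∀ a ∈ A, ∀ b ∈ B, g.eval a + b ∈ SB)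
    (Λ : ℝ) (hΛ1 : 2 ^ 40 ≤ Λ) (hΛ2 : (kdeg e : ℝ) + 1 ≤ Λ)
    (hΛ3 : 10 * ((Nat.log 2 (SA.card ^ 2) : ℝ) + 1) ≤ Λ) (hΛ4 : 10 * ((Nat.log 2 (SB.card ^ 2) : ℝ) + 1) ≤ Λ)
    (N y z lam : ℝ) (eN : N = Real.log n) (ey : y = Real.log SA.card) (ez : z = Real.log SB.card) (el : lam = Real.log Λ) :
    9 * N ≤ 3 * z + 4 * y + 10000 * lam ∨ 32 * N ≤ 13 * z + 12 * y + 10000 * lam := by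
  rcases hs1 with hs1 | hs1
  · exact convex_piece g e hd J ⟨hJo, hJp, hs1, hs2⟩ A B SA SB n hA hB hn hAJ hSA hSB Λ hΛ1 hΛ2 hΛ3 hΛ4 N y z lam eN ey ez el
  · have hcn : ∀ S : Finset ℝ, (S.image (fun x => -x)).card = S.card := fun S => Finset.card_image_of_injective _ neg_injective
    have hev : ∀ x, (g.comp (-Polynomial.X)).eval x = g.eval (-x) := fun x => by simp
    have hd1 : ∀ x, (g.comp (-Polynomial.X)).derivative.eval x = - g.derivative.eval (-x) := fun x => by
      simp [Polynomial.derivative_comp]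
    have hd2 : ∀ x, (g.comp (-Polynomial.X)).derivative.derivative.eval x = g.derivative.derivative.eval (-x) := fun x => by
      simp [Polynomial.derivative_comp]
    refine convex_piece (g.comp (-Polynomial.X)) e (by rw [Polynomial.natDegree_comp]; simp [hd]) (Neg.neg ⁻¹' J)
      ⟨?_, hJp.preimage continuous_neg, ?_, ?_⟩ (A.image (fun x => -x)) B (SA.image (fun x => -x)) SB n (by rw [hcn, hA]) hB hn ?_ ?_ ?_
      Λ hΛ1 hΛ2 (by rw [hcn]; exact hΛ3) hΛ4 N y z lam eN (by rw [hcn]; exact ey) ez el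
    · constructor
      intro a ha b hb x hx
      exact hJo.out (x := -b) (y := -a) hb ha ⟨neg_le_neg hx.2, neg_le_neg hx.1⟩
    · intro x hx
      rw [hd1]
      linarith [hs1 _ hx]
    · intro x hx
      rw [hd2]
      exact hs2 _ hx
    · intro a ha
      obtain ⟨b, hb, rfl⟩ := Finset.mem_image.1 ha
      simpa using hAJ b hb
    · intro a ha a' ha'
      obtain ⟨b, hb, rfl⟩ := Finset.mem_image.1 ha
      obtain ⟨b', hb', rfl⟩ := Finset.mem_image.1 ha'
      exact Finset.mem_image.2 ⟨b + b', hSA b hb b' hb', by ring⟩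
    · intro a ha b hb
      obtain ⟨c, hc, rfl⟩ := Finset.mem_image.1 ha
      rw [hev, neg_neg]
      exact hSB c hc b hb

theorem piece3 (g : Polynomial ℝ) (e : ℕ) (hd : g.natDegree = e + 2) (J : Set ℝ) (hJo : J.OrdConnected) (hJp : IsOpen J)
    (hs1 : (∀ x ∈ J, 0 < g.derivative.eval x) ∨ (∀ x ∈ J, g.derivative.eval x < 0))
    (hs2 : (∀ x ∈ J, 0 < g.derivative.derivative.eval x) ∨ (∀ x ∈ J, g.derivative.derivative.eval x < 0))
    (A B SA SB : Finset ℝ) (n : ℕ) (hA : A.card = n) (hB : B.card = n) (hn : 0 < n) (hAJ : ∀ a ∈ A, a ∈ J)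
    (hSA : ∀ a ∈ A, ∀ a' ∈ A, a + a' ∈ SA) (hSB : ∀ a ∈ A, ∀ b ∈ B, g.eval a + b ∈ SB)
    (Λ : ℝ) (hΛ1 : 2 ^ 40 ≤ Λ) (hΛ2 : (kdeg e : ℝ) + 1 ≤ Λ)
    (hΛ3 : 10 * ((Nat.log 2 (SA.card ^ 2) : ℝ) + 1) ≤ Λ) (hΛ4 : 10 * ((Nat.log 2 (SB.card ^ 2) : ℝ) + 1) ≤ Λ)
    (N y z lam : ℝ) (eN : N = Real.log n) (ey : y = Real.log SA.card) (ez : z = Real.log SB.card) (el : lam = Real.log Λ) :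
    9 * N ≤ 3 * z + 4 * y + 10000 * lam ∨ 32 * N ≤ 13 * z + 12 * y + 10000 * lam := by
  rcases hs2 with hs2 | hs2
  · exact piece2 g e hd J hJo hJp hs1 hs2 A B SA SB n hA hB hn hAJ hSA hSB Λ hΛ1 hΛ2 hΛ3 hΛ4 N y z lam eN ey ez el
  · have hcn : ∀ S : Finset ℝ, (S.image (fun x => -x)).card = S.card := fun S => Finset.card_image_of_injective _ neg_injective
    refine piece2 (-g) e (by rw [Polynomial.natDegree_neg, hd]) J hJo hJp ?_ ?_ A (B.image (fun x => -x)) SA (SB.image (fun x => -x)) n hA (by rw [hcn, hB]) hn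
      hAJ hSA ?_ Λ hΛ1 hΛ2 hΛ3 (by rw [hcn]; exact hΛ4) N y z lam eN ey (by rw [hcn]; exact ez) el
    · rcases hs1 with h | h
      · right
        intro x hx
        have := h x hx
        simpa using this
      · left
        intro x hx
        have := h x hx
        simpa using this
    · intro x hx
      have := hs2 x hx
      simpa using this
    · intro a ha b hb
      obtain ⟨c, hc, rfl⟩ := Finset.mem_image.1 hb
      exact Finset.mem_image.2 ⟨g.eval a + c, hSB a ha c hc, by simp; ring⟩

lemma const_sign (f : Polynomial ℝ) (J : Set ℝ) (hJ : J.OrdConnected) (h0 : ∀ x ∈ J, f.eval x ≠ 0) :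
    (∀ x ∈ J, 0 < f.eval x) ∨ (∀ x ∈ J, f.eval x < 0) := by
  by_contra h
  rw [not_or] at h
  obtain ⟨h1, h2⟩ := h
  push Not at h1 h2
  obtain ⟨x, hx, hx'⟩ := h1
  obtain ⟨x2, hx2, hx2'⟩ := h2
  have := (hJ.isPreconnected.image _ f.continuous.continuousOn).ordConnected.out (Set.mem_image_of_mem _ hx) (Set.mem_image_of_mem _ hx2) ⟨hx', hx2'⟩
  obtain ⟨c, hc, hc'⟩ := this
  exact h0 c hc hc'

set_option maxHeartbeats 1000000 in
theorem all_pieces (g : Polynomial ℝ) (e : ℕ) (hd : g.natDegree = e + 2)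
    (A B SA SB : Finset ℝ) (n : ℕ) (hA : A.card = n) (hB : B.card = n) (hn : 0 < n)
    (hSA : ∀ a ∈ A, ∀ a' ∈ A, a + a' ∈ SA) (hSB : ∀ a ∈ A, ∀ b ∈ B, g.eval a + b ∈ SB)
    (Λ : ℝ) (hΛ1 : 2 ^ 40 ≤ Λ) (hΛ2 : (kdeg e : ℝ) + 1 ≤ Λ)
    (hΛ3 : 10 * ((Nat.log 2 (SA.card ^ 2) : ℝ) + 1) ≤ Λ) (hΛ4 : 10 * ((Nat.log 2 (SB.card ^ 2) : ℝ) + 1) ≤ Λ)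
    (N y z lam : ℝ) (eN : N = Real.log n) (ey : y = Real.log SA.card) (ez : z = Real.log SB.card) (el : lam = Real.log Λ) :
    9 * N ≤ 3 * z + 4 * y + 10100 * lam ∨ 32 * N ≤ 13 * z + 12 * y + 10100 * lam := by
  classical
  have hlam := lam_ge hΛ1 el
  have hy0 : 0 ≤ y := by rw [ey]; exact Real.log_natCast_nonneg _
  have hz0 : 0 ≤ z := by rw [ez]; exact Real.log_natCast_nonneg _
  have hn0 : (0 : ℝ) < n := by exact_mod_cast hn
  have hL0 : 0 < Λ := lt_of_lt_of_le (by norm_num) hΛ1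
  have hk : 4 * e + 4 ≤ kdeg e := by
    rw [kdeg]
    have h1 : 1 ≤ (e + 1) ^ 4 := Nat.one_le_pow _ _ (by omega)
    calc 4 * e + 4 ≤ 1 * (e + 2 + 3) * (e + 1 + (e + 1)) := by nlinarith
      _ ≤ _ := by gcongr
  have hkΛ : ((4 * e + 4 : ℕ) : ℝ) ≤ Λ := by
    have : ((4 * e + 4 : ℕ) : ℝ) ≤ kdeg e := by exact_mod_cast hk
    linarith
  have hg'd : g.derivative.natDegree = e + 1 := by rw [Polynomial.natDegree_derivative, hd]; rfl
  have hg''d : g.derivative.derivative.natDegree = e := by rw [Polynomial.natDegree_derivative, hg'd]; rfl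
  have hg' : g.derivative ≠ 0 := by
    intro h; rw [h] at hg'd; simp at hg'd
  have hg'' : g.derivative.derivative ≠ 0 := by
    intro h
    have := Polynomial.natDegree_eq_zero_of_derivative_eq_zero h
    omega
  set R : Finset ℝ := g.derivative.roots.toFinset ∪ g.derivative.derivative.roots.toFinset with hR
  have hRc : R.card ≤ 2 * e + 1 := by
    refine (Finset.card_union_le _ _).trans ?_
    have h1 := (Multiset.toFinset_card_le g.derivative.roots).trans (Polynomial.card_roots' _)
    have h2 := (Multiset.toFinset_card_le g.derivative.derivative.roots).trans (Polynomial.card_roots' _)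
    omega
  have hRm : ∀ x, x ∉ R → g.derivative.eval x ≠ 0 ∧ g.derivative.derivative.eval x ≠ 0 := by
    intro x hx
    rw [hR, Finset.mem_union, not_or, Multiset.mem_toFinset, Multiset.mem_toFinset, Polynomial.mem_roots hg', Polynomial.mem_roots hg''] at hx
    exact hx
  by_cases hsmall : n ≤ 4 * e + 2
  · left
    have : N ≤ lam := by
      rw [eN, el]
      refine log3 hn0 (le_trans ?_ hkΛ)
      exact_mod_cast (by omega : n ≤ 4 * e + 4)
    linarith
  push Not at hsmall
  have hAR : n ≤ 2 * (A \ R).card := by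
    have := Finset.le_card_sdiff R A
    omega
  obtain ⟨r, hr, hrc⟩ : ∃ r ∈ Finset.range (2 * e + 2), (A \ R).card ≤ (2 * e + 2) * ((A \ R).filter (fun a => rk R a = r)).card := by
    by_contra hcon
    push Not at hcon
    have hs : (A \ R).card = ∑ r ∈ Finset.range (2 * e + 2), ((A \ R).filter (fun a => rk R a = r)).card :=
      Finset.card_eq_sum_card_fiberwise (fun a _ => Finset.mem_coe.2 (Finset.mem_range.2 (by have := rk_le R a; omega)))
    have hlt : ∑ r ∈ Finset.range (2 * e + 2), (2 * e + 2) * ((A \ R).filter (fun a => rk R a = r)).card < ∑ r ∈ Finset.range (2 * e + 2), (A \ R).card :=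
      Finset.sum_lt_sum_of_nonempty ⟨0, by simp⟩ hcon
    rw [← Finset.mul_sum, ← hs, Finset.sum_const, Finset.card_range, smul_eq_mul] at hlt
    exact lt_irrefl _ hlt
  set A' := (A \ R).filter (fun a => rk R a = r) with hA'
  have hA'n : n ≤ (4 * e + 4) * A'.card := by nlinarith
  have hA'0 : 0 < A'.card := by
    rcases Nat.eq_zero_or_pos A'.card with h | h
    · rw [h] at hA'n; omega
    · exact h
  have hA'A : ∀ a ∈ A', a ∈ A ∧ a ∉ R ∧ rk R a = r := by
    intro a ha
    obtain ⟨h1, h2⟩ := Finset.mem_filter.1 ha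
    rw [Finset.mem_sdiff] at h1
    exact ⟨h1.1, h1.2, h2⟩
  have hA'le : A'.card ≤ n := by
    rw [← hA]; exact Finset.card_le_card (fun a ha => (hA'A a ha).1)
  obtain ⟨B', hB'1, hB'2⟩ := Finset.exists_subset_card_eq (s := B) (n := A'.card) (by omega)
  obtain ⟨a0, ha0⟩ := Finset.card_pos.1 hA'0
  obtain ⟨-, ha0R, ha0r⟩ := hA'A a0 ha0
  set J : Set ℝ := ⋂ z ∈ R, (if z < a0 then Set.Ioi z else Set.Iio z) with hJ
  have hJm : ∀ x, x ∈ J ↔ ∀ z ∈ R, x ∈ (if z < a0 then Set.Ioi z else Set.Iio z) := by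
    intro x; rw [hJ]; simp only [Set.mem_iInter]
  have hJo : J.OrdConnected := by
    refine Set.ordConnected_iInter fun z => Set.ordConnected_iInter fun _ => ?_
    split_ifs
    · exact Set.ordConnected_Ioi
    · exact Set.ordConnected_Iio
  have hJp : IsOpen J := by
    refine isOpen_biInter_finset fun z _ => ?_
    split_ifs
    · exact isOpen_Ioi
    · exact isOpen_Iio
  have hJR : ∀ x ∈ J, x ∉ R := by
    intro x hx hxR
    have := (hJm x).1 hx x hxR
    split_ifs at this <;> simp at this
  have hA'J : ∀ a ∈ A', a ∈ J := by
    intro a ha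
    obtain ⟨-, haR, har⟩ := hA'A a ha
    rw [hJm]
    intro z hz
    split_ifs with h
    · by_contra hc
      simp only [Set.mem_Ioi, not_lt] at hc
      have h1 := rk_mono R hc
      have h2 := rk_lt R hz h
      omega
    · by_contra hc
      simp only [Set.mem_Iio, not_lt] at hc
      push Not at h
      have h1 := rk_mono R h
      have h2 := rk_lt R hz (lt_of_le_of_ne hc (fun h => haR (h ▸ hz)))
      omega
  have main := piece3 g e hd J hJo hJp (const_sign _ J hJo (fun x hx => (hRm x (hJR x hx)).1)) (const_sign _ J hJo (fun x hx => (hRm x (hJR x hx)).2))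
    A' B' SA SB A'.card rfl hB'2 hA'0 hA'J (fun a ha a' ha' => hSA a (hA'A a ha).1 a' (hA'A a' ha').1)
    (fun a ha b hb => hSB a (hA'A a ha).1 b (hB'1 hb)) Λ hΛ1 hΛ2 hΛ3 hΛ4 _ y z lam rfl ey ez el
  have hN : N ≤ lam + Real.log A'.card := by
    have hA'0' : (0 : ℝ) < A'.card := by exact_mod_cast hA'0
    have h1 : (n : ℝ) ≤ ((4 * e + 4 : ℕ) : ℝ) * A'.card := by exact_mod_cast hA'n
    have h2 : (n : ℝ) ≤ Λ * A'.card := h1.trans (by gcongr)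
    have := log3 hn0 h2
    rw [Real.log_mul hL0.ne' hA'0'.ne', ← eN, ← el] at this
    exact this
  rcases main with h | h
  · left; linarith
  · right; linarith


lemma kdeg_mono {a b : ℕ} (h : a ≤ b) : kdeg a ≤ kdeg b := by
  unfold kdeg
  gcongr

lemma natlog_le (m n : ℕ) (hn : 0 < n) (hm : m ≤ n ^ 2) (δ : ℝ) (hδ : 0 < δ) :
    10 * ((Nat.log 2 (m ^ 2) : ℝ) + 1) ≤ (10 + 80 / δ) * (n : ℝ) ^ δ := by
  have hn1 : (1 : ℝ) ≤ n := by exact_mod_cast hn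
  have h1 : Nat.log 2 (m ^ 2) ≤ Nat.log 2 (n ^ 4) := Nat.log_mono_right (by
    calc m ^ 2 ≤ (n ^ 2) ^ 2 := Nat.pow_le_pow_left hm 2
      _ = _ := by ring)
  have h2 : (Nat.log 2 (n ^ 4) : ℝ) * Real.log 2 ≤ 4 * Real.log n := by
    have := Nat.pow_log_le_self 2 (x := n ^ 4) (by positivity)
    have h3 : ((2 : ℝ)) ^ (Nat.log 2 (n ^ 4)) ≤ (n : ℝ) ^ 4 := by exact_mod_cast this
    have := log3 (by positivity) h3
    rw [Real.log_pow, Real.log_pow] at this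
    push_cast at this
    exact this
  have h4 : Real.log n ≤ (n : ℝ) ^ δ / δ := Real.log_le_rpow_div (by positivity) hδ
  have h5 : (1 : ℝ) ≤ (n : ℝ) ^ δ := Real.one_le_rpow hn1 hδ.le
  have h6 : (Nat.log 2 (m ^ 2) : ℝ) ≤ Nat.log 2 (n ^ 4) := by exact_mod_cast h1
  have h7 : (Nat.log 2 (n ^ 4) : ℝ) ≤ 8 * Real.log n := by
    have a1 := Real.log_two_gt_d9
    have a2 : (0 : ℝ) ≤ (Nat.log 2 (n ^ 4) : ℝ) := by positivity
    nlinarith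
  have h8 : (10 + 80 / δ) * (n : ℝ) ^ δ = 10 * (n : ℝ) ^ δ + 80 * ((n : ℝ) ^ δ / δ) := by ring
  rw [h8]
  linarith

lemma final_exp (n S L : ℝ) (hn : 1 ≤ n) (hS : 0 < S) (hL : 0 < L) (a b ε c : ℝ) (hc : -c + (a - ε) * Real.log n - b * Real.log S ≤ Real.log L) :
    Real.exp (-c) * (n ^ (a - ε) / S ^ b) ≤ L := by
  have hn0 : 0 < n := by linarith
  rw [← Real.exp_log hL, Real.rpow_def_of_pos hn0, Real.rpow_def_of_pos hS, ← Real.exp_sub, ← Real.exp_add, Real.exp_le_exp]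
  linarith

open Pointwise in
theorem final (d : ℕ) (ε : ℝ) (hε : 0 < ε) :
    ∃ C : ℝ, 0 < C ∧
      ∀ g : Polynomial ℝ, g.natDegree ≤ d → 2 ≤ g.natDegree →
        ∀ A B : Finset ℝ, A.card = B.card →
          C * min
              ((A.card : ℝ) ^ ((32:ℝ)/13 - ε) / ((A + A).card : ℝ) ^ ((12:ℝ)/13))
              ((A.card : ℝ) ^ ((3:ℝ) - ε) / ((A + A).card : ℝ) ^ ((4:ℝ)/3))
            ≤ ((A.image (fun a => g.eval a) + B).card : ℝ) := by
  set δ : ℝ := ε / 10100 with hδd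
  have hδ : 0 < δ := by positivity
  set C0 : ℝ := 2 ^ 40 + kdeg d + 1 + 10 + 80 / δ with hC0
  have hq : 0 < 80 / δ := by positivity
  have hk0 : (0 : ℝ) ≤ kdeg d := by positivity
  have hC01 : 1 ≤ C0 := by
    have : (1 : ℝ) ≤ 2 ^ 40 := by norm_num
    linarith
  have hlC : 0 ≤ Real.log C0 := Real.log_nonneg hC01
  refine ⟨Real.exp (-(10100 * Real.log C0)), Real.exp_pos _, ?_⟩
  intro g hgd hg2 A B hAB
  rcases Nat.eq_zero_or_pos A.card with h0 | hn
  · have hA : A = ∅ := Finset.card_eq_zero.1 h0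
    subst hA
    have : ((((∅ : Finset ℝ) + ∅).card : ℕ) : ℝ) = 0 := by simp
    rw [this, Real.zero_rpow (by norm_num), Real.zero_rpow (by norm_num)]
    simp
  obtain ⟨e, he⟩ : ∃ e, g.natDegree = e + 2 := ⟨g.natDegree - 2, by omega⟩
  set SA := A + A with hSA
  set SB := A.image (fun a => g.eval a) + B with hSB
  set n := A.card with hnd
  have hSAc : SA.card ≤ n ^ 2 := by
    rw [sq]; exact Finset.card_add_le
  have hSBc : SB.card ≤ n ^ 2 := by
    refine (Finset.card_add_le).trans ?_
    rw [sq, ← hAB]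
    exact Nat.mul_le_mul_right _ Finset.card_image_le
  have hn1 : (1 : ℝ) ≤ n := by exact_mod_cast hn
  have hn0 : (0 : ℝ) < n := by linarith
  have hnδ : (1 : ℝ) ≤ (n : ℝ) ^ δ := Real.one_le_rpow hn1 hδ.le
  obtain ⟨a0, ha0⟩ : A.Nonempty := Finset.card_pos.1 hn
  obtain ⟨b0, hb0⟩ : B.Nonempty := Finset.card_pos.1 (by omega)
  have hSA0 : (0 : ℝ) < SA.card := by
    have : 0 < SA.card := Finset.card_pos.2 ⟨_, Finset.add_mem_add ha0 ha0⟩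
    exact_mod_cast this
  have hSB0 : (0 : ℝ) < SB.card := by
    have : 0 < SB.card := Finset.card_pos.2 ⟨_, Finset.add_mem_add (Finset.mem_image_of_mem _ ha0) hb0⟩
    exact_mod_cast this
  have hle : ∀ x, 0 ≤ x → x ≤ C0 → x ≤ C0 * (n : ℝ) ^ δ := by
    intro x hx0 hx
    nlinarith
  have hke : (kdeg e : ℝ) ≤ kdeg d := by
    exact_mod_cast kdeg_mono (by omega : e ≤ d)
  have h40 : (0 : ℝ) ≤ 2 ^ 40 := by norm_num
  have hC0' : 10 + 80 / δ ≤ C0 := by linarith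
  have hmain := all_pieces g e he A B SA SB n rfl (by omega) hn (fun a ha a' ha' => Finset.add_mem_add ha ha')
    (fun a ha b hb => Finset.add_mem_add (Finset.mem_image_of_mem _ ha) hb) (C0 * (n : ℝ) ^ δ)
    (hle _ h40 (by linarith)) (hle _ (by positivity) (by linarith))
    ((natlog_le SA.card n hn hSAc δ hδ).trans (by gcongr)) ((natlog_le SB.card n hn hSBc δ hδ).trans (by gcongr))
    _ _ _ _ rfl rfl rfl rfl
  have hlog : Real.log (C0 * (n : ℝ) ^ δ) = Real.log C0 + δ * Real.log n := by
    rw [Real.log_mul (by linarith) (by linarith), Real.log_rpow hn0]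
  rw [hlog] at hmain
  have hN0 : 0 ≤ Real.log n := Real.log_nonneg hn1
  have hεN : 0 ≤ ε * Real.log n := by positivity
  have hδN : δ * Real.log n * 10100 = ε * Real.log n := by rw [hδd]; ring
  rcases hmain with h | h
  · refine le_trans (mul_le_mul_of_nonneg_left (min_le_right _ _) (Real.exp_pos _).le) ?_
    refine final_exp n SA.card SB.card hn1 hSA0 hSB0 3 (4 / 3) ε _ ?_
    linarith
  · refine le_trans (mul_le_mul_of_nonneg_left (min_le_left _ _) (Real.exp_pos _).le) ?_
    refine final_exp n SA.card SB.card hn1 hSA0 hSB0 (32 / 13) (12 / 13) ε _ ?_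
    linarith

open Polynomial Finset Pointwise

theorem stmt3 (d : ℕ) (ε : ℝ) (hε : 0 < ε) :
    ∃ C : ℝ, 0 < C ∧
      ∀ g : Polynomial ℝ, g.natDegree ≤ d → 2 ≤ g.natDegree →
        ∀ A B : Finset ℝ, A.card = B.card →
          C * min
              ((A.card : ℝ) ^ ((32:ℝ)/13 - ε) / ((A + A).card : ℝ) ^ ((12:ℝ)/13))
              ((A.card : ℝ) ^ ((3:ℝ) - ε) / ((A + A).card : ℝ) ^ ((4:ℝ)/3))
            ≤ ((A.image (fun a => g.eval a) + B).card : ℝ) := by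
  exact final d ε hε
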